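/- Let g satisfy the standing kernel assumptions and let L be the associated nonlocal operator. Let F₁ be an upper semicontinuous bounded viscosity subsolution and F₂ a lower semicontinuous bounded viscosity supersolution of ∂ₜF + (∂ₓF)₊ L[F] = 0 on (0,∞) × ℝ, and assume that at least one of F₁, F₂ is Lipschitz continuous in the space variable, locally uniformly in time. If F₁(0,·) ≤ F₂(0,·), then F₁(t,·) ≤ F₂(t,·) for all t ≥ 0. -/

import Mathlib

open Filter Set MeasureTheory Topology

/-- The principal value `H̃[φ](x) = pv ∫ (φ(x) - φ(y))/(x-y)² dy` converges to `L`. -/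
def HTildeTendsto (φ : ℝ → ℝ) (x L : ℝ) : Prop :=
  Tendsto (fun ε : ℝ => ∫ y in {y : ℝ | ε ≤ |x - y|}, (φ x - φ y) / (x - y) ^ 2)
    (𝓝[>] 0) (𝓝 L)

/-- The value of the principal value `H̃[φ](x)` (junk value if the limit does not exist). -/
noncomputable def HTilde (φ : ℝ → ℝ) (x : ℝ) : ℝ :=
  limUnder (𝓝[>] (0 : ℝ))
    (fun ε : ℝ => ∫ y in {y : ℝ | ε ≤ |x - y|}, (φ x - φ y) / (x - y) ^ 2)

/-- Test functions: continuously differentiable in time and, for each time, bounded in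
space, twice differentiable in space with bounded second spatial derivative. -/
def TestFun (φ : ℝ → ℝ → ℝ) : Prop :=
  (∀ x, ContDiff ℝ 1 fun t => φ t x) ∧
  ∀ t : ℝ,
    (∃ M, ∀ x, |φ t x| ≤ M) ∧
    (∀ x, DifferentiableAt ℝ (φ t) x) ∧
    (∀ x, DifferentiableAt ℝ (deriv (φ t)) x) ∧
    (∃ M, ∀ x, |deriv (deriv (φ t)) x| ≤ M)

/-- Viscosity subsolution of `∂ₜF + (∂ₓF)₊ Op[F] = 0` on `(0,∞) × ℝ`. -/
def IsSubsolution (Op : (ℝ → ℝ) → ℝ → ℝ) (F : ℝ → ℝ → ℝ) : Prop :=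
  UpperSemicontinuousOn (fun p : ℝ × ℝ => F p.1 p.2) (Set.Ici 0 ×ˢ Set.univ) ∧
  ∀ φ : ℝ → ℝ → ℝ, TestFun φ → ∀ t₀ x₀ : ℝ, 0 < t₀ →
    (∀ t x : ℝ, 0 ≤ t → (t, x) ≠ (t₀, x₀) → F t x - φ t x < F t₀ x₀ - φ t₀ x₀) →
    deriv (fun t => φ t x₀) t₀ + max (deriv (φ t₀) x₀) 0 * Op (φ t₀) x₀ ≤ 0

/-- Viscosity supersolution of `∂ₜF + (∂ₓF)₊ Op[F] = 0` on `(0,∞) × ℝ`. -/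
def IsSupersolution (Op : (ℝ → ℝ) → ℝ → ℝ) (F : ℝ → ℝ → ℝ) : Prop :=
  LowerSemicontinuousOn (fun p : ℝ × ℝ => F p.1 p.2) (Set.Ici 0 ×ˢ Set.univ) ∧
  ∀ φ : ℝ → ℝ → ℝ, TestFun φ → ∀ t₀ x₀ : ℝ, 0 < t₀ →
    (∀ t x : ℝ, 0 ≤ t → (t, x) ≠ (t₀, x₀) → F t₀ x₀ - φ t₀ x₀ < F t x - φ t x) →
    0 ≤ deriv (fun t => φ t x₀) t₀ + max (deriv (φ t₀) x₀) 0 * Op (φ t₀) x₀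

/-- Lower semicontinuous envelope `F₋(t,x) = liminf_{0 ≤ s → t, y → x} F(s,y)`. -/
noncomputable def lscEnv (F : ℝ → ℝ → ℝ) (t x : ℝ) : ℝ :=
  liminf (fun p : ℝ × ℝ => F p.1 p.2) (𝓝[Set.Ici 0 ×ˢ Set.univ] (t, x))

/-- Viscosity solution: an usc subsolution whose lsc envelope is a supersolution. -/
def IsSolution (Op : (ℝ → ℝ) → ℝ → ℝ) (F : ℝ → ℝ → ℝ) : Prop :=
  IsSubsolution Op F ∧ IsSupersolution Op (fun t x => lscEnv F t x)

/-- The standing assumptions on the kernel `g`: nonnegativity, differentiability in the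
first variable, uniform Lipschitz continuity in the first variable, two-sided bounds
near `z = 0`, and the logarithmic-derivative estimate near `z = 0`. -/
def StandingKernel (g : ℝ → ℝ → ℝ) : Prop :=
  (∀ x z, 0 ≤ g x z) ∧
  (∀ x z, DifferentiableAt ℝ (fun x' => g x' z) x) ∧
  ∃ C : ℝ, 0 < C ∧ ∃ α₀ : ℝ, 0 < α₀ ∧
    (∀ x y z : ℝ, |g x z - g y z| ≤ C * |x - y|) ∧
    (∀ x z : ℝ, |z| < α₀ → C⁻¹ ≤ g x z ∧ g x z ≤ C) ∧
    (∀ x z : ℝ, |z| < α₀ →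
      |deriv (fun x' => g x' z) x / g x z - deriv (fun x' => g x' 0) x / g x 0| ≤ C * |z|)

/-- The nonlocal operator `L[φ](x) = pv ∫ g(x,z)(φ(x) - φ(x+z))/z² dz`
(junk value if the principal value does not exist). -/
noncomputable def Lop (g : ℝ → ℝ → ℝ) (φ : ℝ → ℝ) (x : ℝ) : ℝ :=
  limUnder (𝓝[>] (0 : ℝ))
    (fun ε : ℝ => ∫ z in {z : ℝ | ε ≤ |z|}, g x z * (φ x - φ (x + z)) / z ^ 2)

/-- Functions on the line that are bounded together with their first two derivatives. -/
def C2b (f : ℝ → ℝ) : Prop :=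
  ∃ (f' f'' : ℝ → ℝ) (B : ℝ), (∀ x, HasDerivAt f (f' x) x) ∧ (∀ x, HasDerivAt f' (f'' x) x) ∧
    ∀ x, |f x| ≤ B ∧ |f' x| ≤ B ∧ |f'' x| ≤ B

theorem C2b.const (a : ℝ) : C2b fun _ => a :=
  ⟨fun _ => 0, fun _ => 0, |a|, fun x => hasDerivAt_const x a, fun x => hasDerivAt_const x 0,
    fun x => by simp⟩

theorem C2b.add {f g : ℝ → ℝ} (hf : C2b f) (hg : C2b g) : C2b fun x => f x + g x := by
  obtain ⟨f', f'', B, h1, h2, h3⟩ := hf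
  obtain ⟨g', g'', D, k1, k2, k3⟩ := hg
  refine ⟨fun x => f' x + g' x, fun x => f'' x + g'' x, B + D, fun x => (h1 x).add (k1 x),
    fun x => (h2 x).add (k2 x), fun x => ⟨?_, ?_, ?_⟩⟩
  · exact (abs_add_le _ _).trans (add_le_add (h3 x).1 (k3 x).1)
  · exact (abs_add_le _ _).trans (add_le_add (h3 x).2.1 (k3 x).2.1)
  · exact (abs_add_le _ _).trans (add_le_add (h3 x).2.2 (k3 x).2.2)

theorem C2b.mul {f g : ℝ → ℝ} (hf : C2b f) (hg : C2b g) : C2b fun x => f x * g x := by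
  obtain ⟨f', f'', B, h1, h2, h3⟩ := hf
  obtain ⟨g', g'', D, k1, k2, k3⟩ := hg
  have hB : 0 ≤ B := (abs_nonneg _).trans (h3 0).1
  have hD : 0 ≤ D := (abs_nonneg _).trans (k3 0).1
  have key : ∀ a b : ℝ, |a| ≤ B → |b| ≤ D → |a * b| ≤ B * D := fun a b ha hb => by
    rw [abs_mul]; exact mul_le_mul ha hb (abs_nonneg _) hB
  have hBD : 0 ≤ B * D := mul_nonneg hB hD
  refine ⟨fun x => f' x * g x + f x * g' x,
    fun x => (f'' x * g x + f' x * g' x) + (f' x * g' x + f x * g'' x), 4 * (B * D),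
    fun x => (h1 x).mul (k1 x),
    fun x => ((h2 x).mul (k1 x)).add ((h1 x).mul (k2 x)), fun x => ?_⟩
  obtain ⟨a1, a2, a3⟩ := h3 x
  obtain ⟨b1, b2, b3⟩ := k3 x
  have e1 := key _ _ a1 b1
  have e2 := key _ _ a2 b1
  have e3 := key _ _ a1 b2
  have e4 := key _ _ a3 b1
  have e5 := key _ _ a2 b2
  have e6 := key _ _ a1 b3
  refine ⟨by linarith, ?_, ?_⟩
  · exact (abs_add_le _ _).trans (by linarith)
  · refine (abs_add_le _ _).trans ?_
    have := abs_add_le (f'' x * g x) (f' x * g' x)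
    have := abs_add_le (f' x * g' x) (f x * g'' x)
    linarith

theorem C2b.const_mul {f : ℝ → ℝ} (a : ℝ) (hf : C2b f) : C2b fun x => a * f x :=
  (C2b.const a).mul hf

theorem C2b.comp_sub {f : ℝ → ℝ} (hf : C2b f) (a : ℝ) : C2b fun x => f (x - a) := by
  obtain ⟨f', f'', B, h1, h2, h3⟩ := hf
  exact ⟨fun x => f' (x - a), fun x => f'' (x - a), B, fun x => (h1 _).comp_sub_const x a,
    fun x => (h2 _).comp_sub_const x a, fun x => h3 _⟩

theorem C2b.continuous {f : ℝ → ℝ} (hf : C2b f) : Continuous f := by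
  obtain ⟨f', f'', B, h1, h2, h3⟩ := hf
  exact continuous_iff_continuousAt.2 fun x => (h1 x).continuousAt

theorem C2b.bounded {f : ℝ → ℝ} (hf : C2b f) : ∃ B, ∀ x, |f x| ≤ B := by
  obtain ⟨f', f'', B, h1, h2, h3⟩ := hf
  exact ⟨B, fun x => (h3 x).1⟩

theorem ContDiff.c2b {f : ℝ → ℝ} (hf : ContDiff ℝ 2 f) (hc : HasCompactSupport f) : C2b f := by
  have h1 : ContDiff ℝ 1 (deriv f) := by
    have : ContDiff ℝ (1 + 1) f := by simpa [one_add_one_eq_two] using hf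
    exact (contDiff_succ_iff_deriv.1 this).2.2
  have h2 : Continuous (deriv (deriv f)) := h1.continuous_deriv le_rfl
  obtain ⟨B0, hB0⟩ := hf.continuous.bounded_above_of_compact_support hc
  obtain ⟨B1, hB1⟩ := h1.continuous.bounded_above_of_compact_support hc.deriv
  obtain ⟨B2, hB2⟩ := h2.bounded_above_of_compact_support hc.deriv.deriv
  refine ⟨deriv f, deriv (deriv f), max B0 (max B1 B2),
    fun x => (hf.differentiable (by norm_num) x).hasDerivAt,
    fun x => (h1.differentiable (by norm_num) x).hasDerivAt, fun x => ⟨?_, ?_, ?_⟩⟩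
  · exact (hB0 x).trans (le_max_left _ _)
  · exact (hB1 x).trans ((le_max_left _ _).trans (le_max_right _ _))
  · exact (hB2 x).trans ((le_max_right _ _).trans (le_max_right _ _))

/-- A sum of a space profile and a time profile is a test function. -/
theorem C2b.testFun {θ : ℝ → ℝ} (hθ : C2b θ) {w : ℝ → ℝ} (hw : ContDiff ℝ 1 w) :
    TestFun fun t x => θ x + w t := by
  refine ⟨fun x => contDiff_const.add hw, fun t => ?_⟩
  obtain ⟨f', f'', B, h1, h2, h3⟩ := hθ.add (C2b.const (w t))
  have e1 : deriv (fun x => θ x + w t) = f' := funext fun x => (h1 x).deriv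
  have e2 : deriv f' = f'' := funext fun x => (h2 x).deriv
  refine ⟨⟨B, fun x => (h3 x).1⟩, fun x => (h1 x).differentiableAt, fun x => ?_, B, fun x => ?_⟩
  · rw [e1]; exact (h2 x).differentiableAt
  · rw [e1, e2]; exact (h3 x).2.2

/-- `z ↦ z² / (1 + z²)`, a bounded substitute for the square. -/
noncomputable def bsq (z : ℝ) : ℝ := z ^ 2 / (1 + z ^ 2)

/-- `z ↦ z / (1 + z²)`, a bounded substitute for the identity. -/
noncomputable def blin (z : ℝ) : ℝ := z / (1 + z ^ 2)

theorem blin_c2b : C2b blin := by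
  have hp : ∀ z : ℝ, 0 < 1 + z ^ 2 := fun z => by positivity
  refine ⟨fun z => (1 - z ^ 2) / (1 + z ^ 2) ^ 2, fun z => (2 * z ^ 3 - 6 * z) / (1 + z ^ 2) ^ 3,
    8, fun z => ?_, fun z => ?_, fun z => ⟨?_, ?_, ?_⟩⟩
  · have h := (hasDerivAt_id z).div (((hasDerivAt_pow 2 z).const_add 1)) (hp z).ne'
    refine h.congr_deriv ?_
    have := (hp z).ne'
    simp only [id]
    field_simp
    ring
  · have h := (((hasDerivAt_pow 2 z).const_sub 1)).div
      ((((hasDerivAt_pow 2 z).const_add 1)).pow 2) (pow_pos (hp z) 2).ne'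
    refine h.congr_deriv ?_
    have := (hp z).ne'
    simp only [Pi.pow_apply]
    field_simp
    ring
  · rw [blin, abs_div, abs_of_pos (hp z), div_le_iff₀ (hp z), abs_le]
    constructor <;> nlinarith [sq_nonneg (z - 1), sq_nonneg (z + 1)]
  · rw [abs_div, abs_of_pos (pow_pos (hp z) 2), div_le_iff₀ (pow_pos (hp z) 2), abs_le]
    constructor <;> nlinarith [sq_nonneg z, sq_nonneg (z ^ 2)]
  · rw [abs_div, abs_of_pos (pow_pos (hp z) 3), div_le_iff₀ (pow_pos (hp z) 3)]
    have h1 : |2 * z ^ 3 - 6 * z| ≤ 2 * |z| ^ 3 + 6 * |z| := by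
      refine (abs_sub _ _).trans ?_
      simp [abs_mul, abs_pow]
    have h2 : z ^ 2 = |z| ^ 2 := (sq_abs z).symm
    rw [h2]
    have h3 := abs_nonneg z
    set a := |z|
    have : (1:ℝ) + 3 * a^2 + 3 * a^4 ≤ (1 + a^2)^3 := by nlinarith [pow_nonneg h3 6]
    nlinarith [sq_nonneg (a - 1), sq_nonneg (a^2 - a), sq_nonneg (a^2-1)]

theorem bsq_eq (z : ℝ) : bsq z = 1 - 1 / (1 + z ^ 2) := by
  have : (1 + z ^ 2) ≠ 0 := by positivity
  rw [bsq]; field_simp; ring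

theorem bsq_nonneg (z : ℝ) : 0 ≤ bsq z := by rw [bsq]; positivity

theorem bsq_le_one (z : ℝ) : bsq z ≤ 1 := by
  rw [bsq_eq]
  have : (0:ℝ) < 1 / (1 + z ^ 2) := by positivity
  linarith

theorem bsq_pos {z : ℝ} (hz : z ≠ 0) : 0 < bsq z := by rw [bsq]; positivity

theorem bsq_mono {d z : ℝ} (hd : 0 ≤ d) (h : d ≤ |z|) : bsq d ≤ bsq z := by
  rw [bsq_eq, bsq_eq]
  have : d ^ 2 ≤ z ^ 2 := by rw [← sq_abs z]; gcongr
  gcongr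

theorem bsq_zero : bsq 0 = 0 := by simp [bsq]

theorem blin_zero : blin 0 = 0 := by simp [blin]

theorem abs_blin_le_one (z : ℝ) : |blin z| ≤ 1 := by
  have hp : 0 < 1 + z ^ 2 := by positivity
  rw [blin, abs_div, abs_of_pos hp, div_le_iff₀ hp, abs_le]
  constructor <;> nlinarith [sq_nonneg (z - 1), sq_nonneg (z + 1)]

theorem blin_eq (z : ℝ) : blin z = z - z * bsq z := by
  have : (1 + z ^ 2) ≠ 0 := by positivity
  rw [blin, bsq]; field_simp; ring

theorem bsq_c2b : C2b bsq := by
  have hp : ∀ z : ℝ, 0 < 1 + z ^ 2 := fun z => by positivity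
  refine ⟨fun z => 2 * z / (1 + z ^ 2) ^ 2, fun z => (2 - 6 * z ^ 2) / (1 + z ^ 2) ^ 3,
    8, fun z => ?_, fun z => ?_, fun z => ⟨?_, ?_, ?_⟩⟩
  · have h := (hasDerivAt_pow 2 z).div (((hasDerivAt_pow 2 z).const_add 1)) (hp z).ne'
    refine h.congr_deriv ?_
    have := (hp z).ne'
    field_simp
    ring
  · have h := ((hasDerivAt_id z).const_mul 2).div
      ((((hasDerivAt_pow 2 z).const_add 1)).pow 2) (pow_pos (hp z) 2).ne'
    refine h.congr_deriv ?_
    have := (hp z).ne'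
    simp only [Pi.pow_apply, id]
    field_simp
    ring
  · rw [abs_of_nonneg (bsq_nonneg z)]; linarith [bsq_le_one z]
  · rw [abs_div, abs_of_pos (pow_pos (hp z) 2), div_le_iff₀ (pow_pos (hp z) 2), abs_le]
    constructor <;> nlinarith [sq_nonneg (z - 1), sq_nonneg (z + 1), sq_nonneg (z ^ 2)]
  · rw [abs_div, abs_of_pos (pow_pos (hp z) 3), div_le_iff₀ (pow_pos (hp z) 3), abs_le]
    have : (1:ℝ) + 3 * z ^ 2 ≤ (1 + z ^ 2) ^ 3 := by
      nlinarith [sq_nonneg (z ^ 3), sq_nonneg (z ^ 2)]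
    constructor <;> nlinarith [sq_nonneg z]

theorem hasDerivAt_blin_zero : HasDerivAt blin 1 0 := by
  have h := (hasDerivAt_id (0:ℝ)).div ((hasDerivAt_pow 2 (0:ℝ)).const_add 1) (by norm_num)
  exact h.congr_deriv (by simp)

theorem hasDerivAt_bsq_zero : HasDerivAt bsq 0 0 := by
  have h := (hasDerivAt_pow 2 (0:ℝ)).div ((hasDerivAt_pow 2 (0:ℝ)).const_add 1) (by norm_num)
  exact h.congr_deriv (by simp)

/-- The truncated singular integral. -/
noncomputable def truncOp (g : ℝ → ℝ → ℝ) (φ : ℝ → ℝ) (x e : ℝ) : ℝ :=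
  ∫ z in {z : ℝ | e ≤ |z|}, g x z * (φ x - φ (x + z)) / z ^ 2

/-- `Op` is the principal value operator with kernel `g`, with value `c` where the limit does not
exist. -/
def IsPV (g : ℝ → ℝ → ℝ) (c : ℝ) (Op : (ℝ → ℝ) → ℝ → ℝ) : Prop :=
  ∀ φ x, (∀ l, Tendsto (truncOp g φ x) (𝓝[>] 0) (𝓝 l) → Op φ x = l) ∧
    ((¬ ∃ l, Tendsto (truncOp g φ x) (𝓝[>] 0) (𝓝 l)) → Op φ x = c)

theorem isPV_Lop (g : ℝ → ℝ → ℝ) : ∃ c, IsPV g c (Lop g) := by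
  refine ⟨@Classical.epsilon ℝ ⟨0⟩ fun _ => False, fun φ x => ⟨fun l hl => hl.limUnder_eq, ?_⟩⟩
  intro h
  have : (fun l : ℝ => map (truncOp g φ x) (𝓝[>] 0) ≤ 𝓝 l) = fun _ => False := by
    funext l
    exact eq_false fun hl => h ⟨l, hl⟩
  unfold Lop limUnder lim
  change Classical.epsilon (fun l : ℝ => map (truncOp g φ x) (𝓝[>] 0) ≤ 𝓝 l) = _
  rw [this]

/-- The kernel seen after the reflection `x ↦ -x`. -/
def reflKernel (g : ℝ → ℝ → ℝ) : ℝ → ℝ → ℝ := fun x z => g (-x) (-z)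

/-- The operator seen after the reflection `x ↦ -x`, `F ↦ -F`. -/
def reflOp (Op : (ℝ → ℝ) → ℝ → ℝ) : (ℝ → ℝ) → ℝ → ℝ := fun φ x => -Op (fun y => -φ (-y)) (-x)

theorem truncOp_refl (g : ℝ → ℝ → ℝ) (φ : ℝ → ℝ) (x e : ℝ) :
    truncOp (reflKernel g) φ x e = -truncOp g (fun y => -φ (-y)) (-x) e := by
  have hm : MeasurableSet {z : ℝ | e ≤ |z|} := measurableSet_le measurable_const measurable_id.abs
  simp only [truncOp, reflKernel]
  rw [← integral_indicator hm, ← integral_indicator hm, ← integral_neg,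
    ← integral_neg_eq_self]
  congr 1
  funext z
  simp only [indicator, mem_ofPred_eq, abs_neg]
  split_ifs
  · simp only [neg_neg, neg_add_rev]
    rw [show -z + x = x + -z by ring]; ring
  · simp

theorem IsPV.refl {g : ℝ → ℝ → ℝ} {c : ℝ} {Op : (ℝ → ℝ) → ℝ → ℝ} (h : IsPV g c Op) :
    IsPV (reflKernel g) (-c) (reflOp Op) := by
  intro φ x
  have e : truncOp (reflKernel g) φ x = fun e => -truncOp g (fun y => -φ (-y)) (-x) e :=
    funext fun e => truncOp_refl g φ x e
  rw [e]
  refine ⟨fun l hl => ?_, fun hl => ?_⟩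
  · have := (h (fun y => -φ (-y)) (-x)).1 (-l) (by simpa using hl.neg)
    simp [reflOp, this]
  · have := (h (fun y => -φ (-y)) (-x)).2 (fun ⟨l, hh⟩ => hl ⟨-l, hh.neg⟩)
    simp [reflOp, this]

theorem TestFun.refl {φ : ℝ → ℝ → ℝ} (h : TestFun φ) : TestFun fun t y => -φ t (-y) := by
  obtain ⟨h1, h2⟩ := h
  refine ⟨fun x => (h1 (-x)).neg, fun t => ?_⟩
  obtain ⟨⟨M, hM⟩, h3, h4, M', hM'⟩ := h2 t
  have e1 : deriv (fun y => -φ t (-y)) = fun y => deriv (φ t) (-y) := by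
    funext y
    rw [deriv.fun_neg, deriv_comp_neg, neg_neg]
  have e2 : deriv (fun y => deriv (φ t) (-y)) = fun y => -deriv (deriv (φ t)) (-y) := by
    funext y
    rw [deriv_comp_neg]
  refine ⟨⟨M, fun x => by simpa using hM (-x)⟩, fun x => ?_, fun x => ?_, M', fun x => ?_⟩
  · exact ((h3 (-x)).comp x differentiableAt_id.neg).neg
  · rw [e1]; exact (h4 (-x)).comp x differentiableAt_id.neg
  · rw [e1, e2]; simpa using hM' (-x)

theorem IsSupersolution.refl {Op : (ℝ → ℝ) → ℝ → ℝ} {F : ℝ → ℝ → ℝ} (h : IsSupersolution Op F) :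
    IsSubsolution (reflOp Op) fun t x => -F t (-x) := by
  obtain ⟨h1, h2⟩ := h
  refine ⟨?_, fun φ hφ t₀ x₀ ht h => ?_⟩
  · have hc : ContinuousOn (fun p : ℝ × ℝ => (p.1, -p.2)) (Set.Ici 0 ×ˢ Set.univ) := by fun_prop
    intro p hp y hy
    have := (hc p hp).tendsto_nhdsWithin (t := Set.Ici 0 ×ˢ Set.univ)
      (fun q hq => ⟨hq.1, mem_univ _⟩)
    have := this.eventually (h1 (p.1, -p.2) ⟨hp.1, mem_univ _⟩ (-y) (by simp at hy ⊢; linarith))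
    filter_upwards [this] with q hq
    simp at hq ⊢; linarith
  · have := h2 _ hφ.refl t₀ (-x₀) ht (fun t x ht' hne => by
      have := h t (-x) ht' (fun hh => hne (by simp at hh ⊢; exact ⟨hh.1, by linarith⟩))
      simp at this ⊢; linarith)
    have e1 : deriv (fun y => -φ t₀ (-y)) (-x₀) = deriv (φ t₀) x₀ := by
      rw [deriv.fun_neg, deriv_comp_neg, neg_neg, neg_neg]
    rw [e1] at this
    simp only [neg_neg, deriv.fun_neg] at this
    simp only [reflOp]
    linarith

theorem IsSubsolution.refl {Op : (ℝ → ℝ) → ℝ → ℝ} {F : ℝ → ℝ → ℝ} (h : IsSubsolution Op F) :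
    IsSupersolution (reflOp Op) fun t x => -F t (-x) := by
  obtain ⟨h1, h2⟩ := h
  refine ⟨?_, fun φ hφ t₀ x₀ ht h => ?_⟩
  · have hc : ContinuousOn (fun p : ℝ × ℝ => (p.1, -p.2)) (Set.Ici 0 ×ˢ Set.univ) := by fun_prop
    intro p hp y hy
    have := (hc p hp).tendsto_nhdsWithin (t := Set.Ici 0 ×ˢ Set.univ)
      (fun q hq => ⟨hq.1, mem_univ _⟩)
    have := this.eventually (h1 (p.1, -p.2) ⟨hp.1, mem_univ _⟩ (-y) (by simp at hy ⊢; linarith))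
    filter_upwards [this] with q hq
    simp at hq ⊢; linarith
  · have := h2 _ hφ.refl t₀ (-x₀) ht (fun t x ht' hne => by
      have := h t (-x) ht' (fun hh => hne (by simp at hh ⊢; exact ⟨hh.1, by linarith⟩))
      simp at this ⊢; linarith)
    have e1 : deriv (fun y => -φ t₀ (-y)) (-x₀) = deriv (φ t₀) x₀ := by
      rw [deriv.fun_neg, deriv_comp_neg, neg_neg, neg_neg]
    rw [e1] at this
    simp only [neg_neg, deriv.fun_neg] at this
    simp only [reflOp]
    linarith

/-- Quantitative form of the standing assumptions, invariant under reflection. -/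
structure KernelBd (g : ℝ → ℝ → ℝ) (C α : ℝ) : Prop where
  one_le : 1 ≤ C
  pos : 0 < α
  le_one : α ≤ 1
  nonneg : ∀ x z, 0 ≤ g x z
  lip : ∀ x y z, |g x z - g y z| ≤ C * |x - y|
  lower : ∀ x z, |z| < α → C⁻¹ ≤ g x z
  upper : ∀ x z, |z| < α → g x z ≤ C
  ratio : ∀ x y z, |z| < α → |g x z - g x 0 / g y 0 * g y z| ≤ C * |z| * |x - y|

theorem KernelBd.refl {g : ℝ → ℝ → ℝ} {C α : ℝ} (h : KernelBd g C α) :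
    KernelBd (reflKernel g) C α where
  one_le := h.one_le
  pos := h.pos
  le_one := h.le_one
  nonneg x z := h.nonneg _ _
  lip x y z := by
    have := h.lip (-x) (-y) (-z)
    rwa [show -x - -y = -(x - y) by ring, abs_neg] at this
  lower x z hz := h.lower _ _ (by rwa [abs_neg])
  upper x z hz := h.upper _ _ (by rwa [abs_neg])
  ratio x y z hz := by
    have := h.ratio (-x) (-y) (-z) (by rwa [abs_neg])
    rw [show -x - -y = -(x - y) by ring, abs_neg, abs_neg] at this
    simpa [reflKernel] using this

theorem StandingKernel.kernelBd {g : ℝ → ℝ → ℝ} (hg : StandingKernel g) :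
    ∃ C α, KernelBd g C α := by
  obtain ⟨h0, hd, C, hC, α, hα, h1, h2, h3⟩ := hg
  set A := max C 1 with hA
  have hA1 : 1 ≤ A := le_max_right _ _
  have hCA : C ≤ A := le_max_left _ _
  have hA0 : 0 < A := by linarith
  have hA4 : A ≤ A ^ 4 := by
    calc A = A ^ 1 := (pow_one A).symm
      _ ≤ A ^ 4 := pow_le_pow_right₀ hA1 (by norm_num)
  have hlow : ∀ x z, |z| < α → A⁻¹ ≤ g x z := fun x z hz =>
    (inv_anti₀ hC hCA).trans (h2 x z hz).1
  have hup : ∀ x z, |z| < α → g x z ≤ A := fun x z hz => (h2 x z hz).2.trans hCA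
  refine ⟨A ^ 4, min α 1, one_le_pow₀ hA1, lt_min hα one_pos, min_le_right _ _, h0, ?_, ?_, ?_, ?_⟩
  · exact fun x y z => (h1 x y z).trans
      (mul_le_mul_of_nonneg_right (hCA.trans hA4) (abs_nonneg _))
  · exact fun x z hz => (inv_anti₀ hA0 hA4).trans (hlow x z (hz.trans_le (min_le_left _ _)))
  · exact fun x z hz => (hup x z (hz.trans_le (min_le_left _ _))).trans hA4
  · intro x y z hz
    replace hz := hz.trans_le (min_le_left _ _)
    have hz0 : |(0:ℝ)| < α := by simpa using hα
    have hp : ∀ x, 0 < g x z := fun x => (inv_pos.2 hA0).trans_le (hlow x z hz)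
    have hp0 : ∀ x, 0 < g x 0 := fun x => (inv_pos.2 hA0).trans_le (hlow x 0 hz0)
    set G : ℝ → ℝ := fun x => Real.log (g x z) - Real.log (g x 0) with hG
    have hGd : ∀ x, HasDerivAt G
        (deriv (fun x' => g x' z) x / g x z - deriv (fun x' => g x' 0) x / g x 0) x := fun x =>
      ((hd x z).hasDerivAt.log (hp x).ne').sub ((hd x 0).hasDerivAt.log (hp0 x).ne')
    have hGl : |G x - G y| ≤ C * |z| * |x - y| := by
      have := convex_univ.norm_image_sub_le_of_norm_hasDerivWithin_le (f := G) (C := C * |z|)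
        (fun x _ => (hGd x).hasDerivWithinAt) (fun x _ => h3 x z hz) (mem_univ y) (mem_univ x)
      simpa using this
    have hexp : ∀ x, Real.exp (G x) = g x z / g x 0 := fun x => by
      rw [hG]; simp only; rw [Real.exp_sub, Real.exp_log (hp x), Real.exp_log (hp0 x)]
    have hle : ∀ x, Real.exp (G x) ≤ A ^ 2 := fun x => by
      rw [hexp, div_le_iff₀ (hp0 x)]
      have e1 := hlow x 0 hz0
      have e2 := hup x z hz
      have : A ^ 2 * A⁻¹ = A := by field_simp
      nlinarith [sq_nonneg A]
    have hexpl : |Real.exp (G x) - Real.exp (G y)| ≤ A ^ 2 * |G x - G y| := by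
      wlog hxy : G y ≤ G x generalizing x y
      · rw [abs_sub_comm, abs_sub_comm (G x)]
        refine this y x ?_ (le_of_not_ge hxy)
        rwa [abs_sub_comm, abs_sub_comm y]
      rw [abs_of_nonneg (sub_nonneg.2 (Real.exp_le_exp.2 hxy)), abs_of_nonneg (sub_nonneg.2 hxy)]
      have e1 : Real.exp (G y) = Real.exp (G x) * Real.exp (-(G x - G y)) := by
        rw [← Real.exp_add]; congr 1; ring
      have e2 := Real.add_one_le_exp (-(G x - G y))
      have e3 := Real.exp_pos (G x)
      have e4 := hle x
      rw [e1]
      nlinarith [mul_le_mul_of_nonneg_left e2 e3.le,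
        mul_le_mul_of_nonneg_right e4 (sub_nonneg.2 hxy)]
    have e : g x z - g x 0 / g y 0 * g y z = g x 0 * (Real.exp (G x) - Real.exp (G y)) := by
      rw [hexp, hexp]
      have := (hp0 x).ne'
      have := (hp0 y).ne'
      field_simp
    rw [e, abs_mul, abs_of_pos (hp0 x)]
    calc g x 0 * |Real.exp (G x) - Real.exp (G y)| ≤ A * (A ^ 2 * (A * |z| * |x - y|)) := by
          have e5 : C * |z| * |x - y| ≤ A * |z| * |x - y| := by gcongr
          have := hup x 0 hz0
          gcongr
          exact hexpl.trans (mul_le_mul_of_nonneg_left (hGl.trans e5) (sq_nonneg A))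
      _ = A ^ 4 * |z| * |x - y| := by ring

theorem measurableSet_le_abs (r : ℝ) : MeasurableSet {z : ℝ | r ≤ |z|} :=
  measurableSet_le measurable_const measurable_id.abs

theorem integrableOn_inv_sq {r : ℝ} (hr : 0 < r) :
    IntegrableOn (fun z : ℝ => 1 / z ^ 2) {z : ℝ | r ≤ |z|} := by
  have h : Integrable fun z : ℝ => (1 + 1 / r ^ 2) * (1 + z ^ 2)⁻¹ :=
    integrable_inv_one_add_sq.const_mul _
  refine Integrable.mono' h.integrableOn (by measurability) ?_
  refine (ae_restrict_iff' (measurableSet_le_abs r)).2 (Eventually.of_forall fun z hz => ?_)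
  have hz' : r ≤ |z| := hz
  have h1 : r ^ 2 ≤ z ^ 2 := by rw [← sq_abs z]; gcongr
  have h2 : 0 < r ^ 2 := by positivity
  have h3 : 0 < z ^ 2 := by linarith
  rw [Real.norm_of_nonneg (by positivity), ← div_eq_mul_inv, div_le_div_iff₀ h3 (by positivity)]
  have : 1 ≤ 1 / r ^ 2 * z ^ 2 := by
    rw [one_div, inv_mul_eq_div, le_div_iff₀ h2]; linarith
  linarith

/-- The points at which the kernel is integrable away from the singularity. -/
def regSet (g : ℝ → ℝ → ℝ) : Set ℝ :=
  {x | ∀ r > 0, IntegrableOn (fun z => g x z / z ^ 2) {z : ℝ | r ≤ |z|}}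

theorem KernelBd.isClosed_regSet {g : ℝ → ℝ → ℝ} {C α : ℝ} (h : KernelBd g C α) :
    IsClosed (regSet g) := by
  refine isClosed_of_closure_subset fun x hx r hr => ?_
  obtain ⟨u, hu, hux⟩ := mem_closure_iff_seq_limit.1 hx
  have hm : AEStronglyMeasurable (fun z => g x z / z ^ 2) (volume.restrict {z : ℝ | r ≤ |z|}) := by
    refine aestronglyMeasurable_of_tendsto_ae atTop (fun n => (hu n r hr).1)
      (Eventually.of_forall fun z => ?_)
    refine Tendsto.div_const ?_ _
    rw [tendsto_iff_norm_sub_tendsto_zero]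
    have h0 : Tendsto (fun n => C * |u n - x|) atTop (𝓝 (C * 0)) := by
      refine Tendsto.const_mul _ ?_
      simpa using (tendsto_iff_norm_sub_tendsto_zero.1 hux)
    rw [mul_zero] at h0
    exact squeeze_zero (fun n => norm_nonneg _) (fun n => h.lip _ _ _) h0
  refine Integrable.mono' ((hu 0 r hr).add ((integrableOn_inv_sq hr).const_mul (C * |x - u 0|)))
    hm (Eventually.of_forall fun z => ?_)
  have h1 := h.lip x (u 0) z
  have h2 := (abs_le.1 h1).2
  rw [Real.norm_of_nonneg (div_nonneg (h.nonneg _ _) (sq_nonneg _))]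
  simp only [Pi.add_apply]
  rw [mul_one_div, ← add_div]
  gcongr
  linarith

theorem op_add_bsq_of_notMem {g : ℝ → ℝ → ℝ} {c : ℝ} {Op : (ℝ → ℝ) → ℝ → ℝ} (hOp : IsPV g c Op)
    {x : ℝ} (hx : x ∉ regSet g) {φ : ℝ → ℝ} (hφ : C2b φ) :
    ∃ N₀, ∀ N ≥ N₀, Op (fun y => φ y + N * bsq (y - x)) x = 0 := by
  simp only [regSet, mem_ofPred_eq, not_forall] at hx
  obtain ⟨r, hr, hni⟩ := hx
  obtain ⟨B, hB⟩ := hφ.bounded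
  have hb := bsq_pos hr.ne'
  refine ⟨(2 * B + 1) / bsq r, fun N hN => (hOp _ x).1 0 ?_⟩
  have hN0 : 2 * B + 1 ≤ N * bsq r := (div_le_iff₀ hb).1 hN
  have hB0 : 0 ≤ B := (abs_nonneg _).trans (hB 0)
  have hNp : 0 ≤ N := by
    by_contra hh; push Not at hh
    nlinarith
  set ψ : ℝ → ℝ := fun y => φ y + N * bsq (y - x) with hψ
  have hψc : Continuous ψ := (hφ.add ((bsq_c2b.comp_sub x).const_mul N)).continuous
  have hle : ∀ z, r ≤ |z| → ψ x - ψ (x + z) ≤ -1 := fun z hz => by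
    have e1 := abs_le.1 (hB x)
    have e2 := abs_le.1 (hB (x + z))
    have e3 := mul_le_mul_of_nonneg_left (bsq_mono hr.le hz) hNp
    simp only [hψ, sub_self, bsq_zero, add_sub_cancel_left]
    linarith
  have hev : ∀ᶠ e in 𝓝[>] (0:ℝ), truncOp g ψ x e = 0 := by
    filter_upwards [Ioo_mem_nhdsGT hr] with e he
    refine integral_undef fun hint => hni ?_
    have h1 : IntegrableOn (fun z => g x z * (ψ x - ψ (x + z)) / z ^ 2) {z : ℝ | r ≤ |z|} :=
      IntegrableOn.mono_set hint fun z (hz : r ≤ |z|) => he.2.le.trans hz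
    have h2 := Integrable.bdd_mul (f := fun z => (ψ x - ψ (x + z))⁻¹) (c := 1) h1
      (Measurable.aestronglyMeasurable (by
        have : Continuous fun z => ψ x - ψ (x + z) := by fun_prop
        exact this.measurable.inv))
      ((ae_restrict_iff' (measurableSet_le_abs r)).2 (Eventually.of_forall fun z hz => by
        have := hle z hz
        rw [norm_inv, Real.norm_eq_abs]
        exact inv_le_one_of_one_le₀ (by rw [abs_of_neg (by linarith)]; linarith)))
    refine h2.congr ((ae_restrict_iff' (measurableSet_le_abs r)).2
      (Eventually.of_forall fun z hz => ?_))
    have := hle z hz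
    have h3 : ψ x - ψ (x + z) ≠ 0 := by linarith
    have hz0 : z ≠ 0 := by rintro rfl; simp at hz; linarith
    simp only
    field_simp
  exact tendsto_const_nhds.congr' (hev.mono fun e he => he.symm)

theorem IsSubsolution.nonpos_of_local_le {g : ℝ → ℝ → ℝ} {c : ℝ} {Op : (ℝ → ℝ) → ℝ → ℝ}
    (hOp : IsPV g c Op) {F : ℝ → ℝ → ℝ} (hF : IsSubsolution Op F) {M : ℝ}
    (hM : ∀ t x, 0 ≤ t → |F t x| ≤ M) {t y a p Q d : ℝ} (ht : 0 < t) (hd : 0 < d)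
    (hloc : ∀ s z, 0 ≤ s → |z| < d → F s (y + z) ≤ F t y + a * (s - t) + p * z + Q * z ^ 2)
    (hp : p ≤ 0 ∨ y ∉ regSet g) : a ≤ 0 := by
  have hbd := bsq_pos hd.ne'
  have hθ : C2b fun x => p * blin (x - y) := (blin_c2b.comp_sub y).const_mul p
  obtain ⟨N₀, hN₀⟩ : ∃ N₀, ∀ N ≥ N₀,
      max p 0 * Op (fun x => p * blin (x - y) + N * bsq (x - y)) y = 0 := by
    rcases hp with hp | hp
    · exact ⟨0, fun N _ => by rw [max_eq_right hp, zero_mul]⟩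
    · obtain ⟨N₀, h⟩ := op_add_bsq_of_notMem hOp hp hθ
      exact ⟨N₀, fun N hN => by rw [h N hN, mul_zero]⟩
  set N := max N₀ (max ((2 * M + |p| + a ^ 2 / 4 + 1) / bsq d) (|Q| * (1 + d ^ 2) + |p| * d + 1))
    with hN
  have hN1 : N₀ ≤ N := le_max_left _ _
  have hN2 : 2 * M + |p| + a ^ 2 / 4 + 1 ≤ N * bsq d :=
    (div_le_iff₀ hbd).1 ((le_max_left _ _).trans (le_max_right _ _))
  have hN3 : |Q| * (1 + d ^ 2) + |p| * d + 1 ≤ N := (le_max_right _ _).trans (le_max_right _ _)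
  have hNp : 0 ≤ N := by
    have : 0 ≤ |Q| * (1 + d ^ 2) + |p| * d + 1 := by positivity
    linarith
  have hθ2 : C2b fun x => p * blin (x - y) + N * bsq (x - y) :=
    hθ.add ((bsq_c2b.comp_sub y).const_mul N)
  have htest := hF.2 _ (hθ2.testFun (w := fun s => a * (s - t) + (s - t) ^ 2) (by fun_prop)) t y ht
    (fun s x hs hne => by
      simp only [sub_self, blin_zero, bsq_zero, mul_zero, add_zero, ne_eq, OfNat.ofNat_ne_zero,
        not_false_eq_true, zero_pow]
      obtain ⟨z, rfl⟩ : ∃ z, x = y + z := ⟨x - y, by ring⟩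
      rw [add_sub_cancel_left]
      have hτ := sq_nonneg (s - t)
      rcases lt_or_ge |z| d with hz | hz
      · have h1 := hloc s z hs hz
        rw [blin_eq]
        have h2 : z ^ 2 ≤ bsq z * (1 + d ^ 2) := by
          have e : z ^ 2 = bsq z * (1 + z ^ 2) := by
            have : (1 + z ^ 2) ≠ 0 := by positivity
            rw [bsq]; field_simp
          have : z ^ 2 ≤ d ^ 2 := by rw [← sq_abs z]; gcongr
          nlinarith [bsq_nonneg z]
        have h3 : Q * z ^ 2 ≤ |Q| * (bsq z * (1 + d ^ 2)) :=
          mul_le_mul (le_abs_self _) h2 (sq_nonneg _) (abs_nonneg _)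
        have h4 : p * (z * bsq z) ≤ |p| * d * bsq z := by
          have e1 : p * z ≤ |p| * d := by
            calc p * z ≤ |p * z| := le_abs_self _
              _ = |p| * |z| := abs_mul _ _
              _ ≤ |p| * d := by gcongr
          nlinarith [bsq_nonneg z]
        have h5 := mul_le_mul_of_nonneg_right hN3 (bsq_nonneg z)
        have h6 : 0 < bsq z + (s - t) ^ 2 := by
          rcases eq_or_ne z 0 with rfl | hz0
          · have : s ≠ t := fun h => hne (by simp [h])
            have : s - t ≠ 0 := sub_ne_zero.2 this
            have := bsq_nonneg 0
            positivity
          · have := bsq_pos hz0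
            positivity
        nlinarith
      · have h1 := mul_le_mul_of_nonneg_left (bsq_mono hd.le hz) hNp
        have h2 := (abs_le.1 (hM s (y + z) hs)).2
        have h3 := (abs_le.1 (hM t y ht.le)).1
        have h4 : -|p| ≤ p * blin z := by
          have : |p * blin z| ≤ |p| := by
            rw [abs_mul]; exact mul_le_of_le_one_right (abs_nonneg _) (abs_blin_le_one z)
          exact (abs_le.1 this).1.trans' (by simp)
        nlinarith [sq_nonneg (s - t + a / 2)])
  have e1 : deriv (fun s => p * blin (y - y) + N * bsq (y - y) + (a * (s - t) + (s - t) ^ 2)) t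
      = a := by
    have := (((hasDerivAt_id t).sub_const t).const_mul a).add (((hasDerivAt_id t).sub_const t).pow 2)
    refine ((this.const_add (p * blin (y - y) + N * bsq (y - y)))).deriv.trans ?_
    simp
  have e2 : deriv (fun x => p * blin (x - y) + N * bsq (x - y) + (a * (t - t) + (t - t) ^ 2)) y
      = p := by
    have h1 : HasDerivAt (fun x => blin (x - y)) 1 y :=
      HasDerivAt.comp_sub_const y y (by simpa using hasDerivAt_blin_zero)
    have h2 : HasDerivAt (fun x => bsq (x - y)) 0 y :=
      HasDerivAt.comp_sub_const y y (by simpa using hasDerivAt_bsq_zero)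
    refine (((h1.const_mul p).add (h2.const_mul N)).add_const _).deriv.trans ?_
    simp
  have e3 : (fun x => p * blin (x - y) + N * bsq (x - y) + (a * (t - t) + (t - t) ^ 2))
      = fun x => p * blin (x - y) + N * bsq (x - y) := by
    funext x; simp
  rw [e1, e2, e3, hN₀ N hN1, add_zero] at htest
  exact htest

theorem IsSubsolution.le_of_boundary_le {g : ℝ → ℝ → ℝ} {c : ℝ} {Op : (ℝ → ℝ) → ℝ → ℝ}
    (hOp : IsPV g c Op) {F : ℝ → ℝ → ℝ} (hF : IsSubsolution Op F) {M : ℝ}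
    (hM : ∀ t x, 0 ≤ t → |F t x| ≤ M) {l r x₀ A B Q : ℝ} {β : ℝ → ℝ}
    (hβ : ∀ y, β y = A + B * (y - x₀) + Q * (y - x₀) ^ 2)
    (hp : ∀ y ∈ Ioo l r, B + 2 * Q * (y - x₀) ≤ 0 ∨ y ∉ regSet g)
    (h0 : ∀ y ∈ Icc l r, F 0 y ≤ β y) (hl : ∀ s, 0 ≤ s → F s l ≤ β l)
    (hr : ∀ s, 0 ≤ s → F s r ≤ β r) {t y : ℝ} (ht : 0 ≤ t) (hy : y ∈ Icc l r) :
    F t y ≤ β y := by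
  by_contra! hlt
  set σ := F t y - β y with hσ
  have hσ0 : 0 < σ := sub_pos.2 hlt
  set η := σ / (t + 1) with hη
  have hη0 : 0 < η := by positivity
  have hηt : η * t < σ := by
    rw [hη, div_mul_eq_mul_div, div_lt_iff₀ (by positivity)]; nlinarith
  have hβc : Continuous β := by
    rw [show β = fun y => A + B * (y - x₀) + Q * (y - x₀) ^ 2 from funext hβ]; fun_prop
  obtain ⟨D, hD⟩ := (isCompact_Icc (a := l) (b := r)).exists_bound_of_continuousOn
    hβc.continuousOn
  set T := max t ((M + D) / η) with hT
  have husc : UpperSemicontinuousOn (fun q : ℝ × ℝ => F q.1 q.2 + (-β q.2 - η * q.1))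
      (Icc 0 T ×ˢ Icc l r) :=
    (hF.1.mono (prod_mono (fun s hs => hs.1) (subset_univ _))).add
      ((by fun_prop : Continuous fun q : ℝ × ℝ => -β q.2 - η * q.1).continuousOn.upperSemicontinuousOn)
  have hmem : ((t, y) : ℝ × ℝ) ∈ Icc 0 T ×ˢ Icc l r := ⟨⟨ht, le_max_left _ _⟩, hy⟩
  obtain ⟨⟨s, x⟩, ⟨hs, hx⟩, hmax⟩ :=
    husc.exists_isMaxOn ⟨_, hmem⟩ (isCompact_Icc.prod isCompact_Icc)
  have hpos : 0 < F s x - β x - η * s := by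
    have := isMaxOn_iff.1 hmax _ hmem
    simp only at this
    linarith
  have hηs : 0 ≤ η * s := mul_nonneg hη0.le hs.1
  have hs0 : 0 < s := by
    refine lt_of_le_of_ne hs.1 fun h => ?_
    subst h
    have := h0 x hx
    linarith
  have hxl : l < x := lt_of_le_of_ne hx.1 fun h => by subst h; linarith [hl s hs.1]
  have hxr : x < r := lt_of_le_of_ne hx.2 fun h => by subst h; linarith [hr s hs.1]
  have := hF.nonpos_of_local_le hOp hM (t := s) (y := x) (a := η) (p := B + 2 * Q * (x - x₀))
    (Q := Q) (d := min (x - l) (r - x)) hs0 (lt_min (by linarith) (by linarith))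
    (fun s' z hs' hz => by
      have hz1 := abs_lt.1 (hz.trans_le (min_le_left _ _))
      have hz2 := abs_lt.1 (hz.trans_le (min_le_right _ _))
      have hmz : x + z ∈ Icc l r := ⟨by linarith, by linarith⟩
      have hval : F s' (x + z) - β (x + z) - η * s' ≤ F s x - β x - η * s := by
        rcases le_or_gt s' T with h | h
        · have := isMaxOn_iff.1 hmax (s', x + z) ⟨⟨hs', h⟩, hmz⟩
          simp only at this
          linarith
        · have e1 := (abs_le.1 (hM s' (x + z) hs')).2
          have e2 := (abs_le.1 (hD _ hmz)).1
          have e3 : (M + D) / η ≤ s' := (le_max_right _ _).trans h.le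
          rw [div_le_iff₀ hη0] at e3
          linarith
      rw [hβ, hβ] at hval
      linarith [hval]) (hp x ⟨hxl, hxr⟩)
  linarith

theorem IsSubsolution.le_initial_of_notMem {g : ℝ → ℝ → ℝ} {c : ℝ} {Op : (ℝ → ℝ) → ℝ → ℝ}
    (hOp : IsPV g c Op) (hreg : IsClosed (regSet g)) {F : ℝ → ℝ → ℝ} (hF : IsSubsolution Op F)
    {M : ℝ} (hM : ∀ t x, 0 ≤ t → |F t x| ≤ M) {x₀ : ℝ} (hx₀ : x₀ ∉ regSet g) {t : ℝ}
    (ht : 0 ≤ t) : F t x₀ ≤ F 0 x₀ := by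
  refine le_of_forall_pos_le_add fun σ hσ => ?_
  have husc := hF.1 (0, x₀) ⟨mem_Ici.2 le_rfl, mem_univ _⟩ (F 0 x₀ + σ) (by simp; exact hσ)
  have hcont : Tendsto (fun y : ℝ => ((0 : ℝ), y)) (𝓝 x₀) (𝓝[Ici 0 ×ˢ univ] (0, x₀)) :=
    tendsto_nhdsWithin_iff.2 ⟨(by fun_prop : Continuous fun y : ℝ => ((0 : ℝ), y)).tendsto x₀,
      Eventually.of_forall fun y => ⟨mem_Ici.2 le_rfl, mem_univ _⟩⟩
  have hev := (hcont.eventually husc).and (hreg.isOpen_compl.mem_nhds hx₀)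
  obtain ⟨d, hd, hball⟩ := Metric.eventually_nhds_iff.1 hev
  have hin : ∀ y ∈ Icc (x₀ - d / 2) (x₀ + d / 2), dist y x₀ < d := fun y hy => by
    rw [Real.dist_eq, abs_lt]; constructor <;> linarith [hy.1, hy.2]
  set N := 2 * M / (d / 2) ^ 2 with hN
  have hNd : N * (d / 2) ^ 2 = 2 * M := by rw [hN]; field_simp
  have hM0 : 0 ≤ M := (abs_nonneg _).trans (hM 0 0 le_rfl)
  have hN0 : 0 ≤ N := by positivity
  have h0 := (abs_le.1 (hM 0 x₀ le_rfl)).1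
  have := hF.le_of_boundary_le hOp hM (l := x₀ - d / 2) (r := x₀ + d / 2) (x₀ := x₀)
    (A := F 0 x₀ + σ) (B := 0) (Q := N) (fun y => rfl)
    (fun y hy => Or.inr (hball (hin y (Ioo_subset_Icc_self hy))).2)
    (fun y hy => by
      have := (hball (hin y hy)).1
      simp only at this
      nlinarith [sq_nonneg (y - x₀)])
    (fun s hs => by
      have := (abs_le.1 (hM s (x₀ - d / 2) hs)).2
      have e : (x₀ - d / 2 - x₀) ^ 2 = (d / 2) ^ 2 := by ring
      rw [e]; linarith)
    (fun s hs => by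
      have := (abs_le.1 (hM s (x₀ + d / 2) hs)).2
      have e : (x₀ + d / 2 - x₀) ^ 2 = (d / 2) ^ 2 := by ring
      rw [e]; linarith)
    ht (y := x₀) ⟨by linarith, by linarith⟩
  simpa using this

theorem IsSubsolution.le_linear_of_notMem {g : ℝ → ℝ → ℝ} {c : ℝ} {Op : (ℝ → ℝ) → ℝ → ℝ}
    (hOp : IsPV g c Op) (hreg : IsClosed (regSet g)) {F : ℝ → ℝ → ℝ} (hF : IsSubsolution Op F)
    {M : ℝ} (hM : ∀ t x, 0 ≤ t → |F t x| ≤ M) {x₀ d m : ℝ} (hx₀ : x₀ ∉ regSet g) (hd : 0 < d)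
    (h0 : ∀ y ∈ Icc (x₀ - d) x₀, F 0 y ≤ m) {t y : ℝ} (ht : 0 ≤ t) (hy : y ∈ Icc (x₀ - d) x₀) :
    F t y ≤ m + 2 * M / d * (x₀ - y) := by
  have hM0 : 0 ≤ M := (abs_nonneg _).trans (hM 0 0 le_rfl)
  have hx : F 0 x₀ ≤ m := h0 x₀ ⟨by linarith, le_rfl⟩
  have hm := (abs_le.1 (hM 0 x₀ le_rfl)).1
  have hq : 0 ≤ 2 * M / d := by positivity
  have := hF.le_of_boundary_le hOp hM (l := x₀ - d) (r := x₀) (x₀ := x₀)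
    (A := m) (B := -(2 * M / d)) (Q := 0) (fun y => rfl)
    (fun y hy => Or.inl (by simpa using hq))
    (fun y hy => by nlinarith [h0 y hy, hy.2])
    (fun s hs => by
      have := (abs_le.1 (hM s (x₀ - d) hs)).2
      have e : -(2 * M / d) * (x₀ - d - x₀) = 2 * M := by field_simp; ring
      rw [e]; linarith)
    (fun s hs => by
      have := hF.le_initial_of_notMem hOp hreg hM hx₀ hs
      simp; linarith)
    ht hy
  linarith

theorem mem_regSet_refl {g : ℝ → ℝ → ℝ} {x : ℝ} : x ∈ regSet (reflKernel g) ↔ -x ∈ regSet g := by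
  have : ∀ r : ℝ, IntegrableOn (fun z => reflKernel g x z / z ^ 2) {z : ℝ | r ≤ |z|} ↔
      IntegrableOn (fun z => g (-x) z / z ^ 2) {z : ℝ | r ≤ |z|} := fun r => by
    rw [← integrable_indicator_iff (measurableSet_le_abs r),
      ← integrable_indicator_iff (measurableSet_le_abs r), ← integrable_comp_mul_left_iff _ (neg_ne_zero.2 one_ne_zero)]
    refine iff_of_eq (congrArg (fun f => Integrable f volume) (funext fun z => ?_))
    simp [indicator, reflKernel]
  simp [regSet, this]

theorem IsSupersolution.initial_le_of_notMem {g : ℝ → ℝ → ℝ} {c : ℝ} {Op : (ℝ → ℝ) → ℝ → ℝ}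
    (hOp : IsPV g c Op) (hreg : IsClosed (regSet (reflKernel g))) {F : ℝ → ℝ → ℝ}
    (hF : IsSupersolution Op F)
    {M : ℝ} (hM : ∀ t x, 0 ≤ t → |F t x| ≤ M) {x₀ : ℝ} (hx₀ : x₀ ∉ regSet g) {t : ℝ}
    (ht : 0 ≤ t) : F 0 x₀ ≤ F t x₀ := by
  have := hF.refl.le_initial_of_notMem hOp.refl hreg (M := M)
    (fun t x ht => by simpa using hM t (-x) ht) (x₀ := -x₀)
    (by rwa [mem_regSet_refl, neg_neg]) ht
  simpa using this

theorem IsSupersolution.linear_le_of_notMem {g : ℝ → ℝ → ℝ} {c : ℝ} {Op : (ℝ → ℝ) → ℝ → ℝ}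
    (hOp : IsPV g c Op) (hreg : IsClosed (regSet (reflKernel g))) {F : ℝ → ℝ → ℝ}
    (hF : IsSupersolution Op F)
    {M : ℝ} (hM : ∀ t x, 0 ≤ t → |F t x| ≤ M) {x₀ d m : ℝ} (hx₀ : x₀ ∉ regSet g) (hd : 0 < d)
    (h0 : ∀ y ∈ Icc x₀ (x₀ + d), m ≤ F 0 y) {t y : ℝ} (ht : 0 ≤ t) (hy : y ∈ Icc x₀ (x₀ + d)) :
    m - 2 * M / d * (y - x₀) ≤ F t y := by
  have := hF.refl.le_linear_of_notMem hOp.refl hreg (M := M)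
    (fun t x ht => by simpa using hM t (-x) ht) (x₀ := -x₀) (d := d) (m := -m)
    (by rwa [mem_regSet_refl, neg_neg]) hd
    (fun y hy => by
      have := h0 (-y) ⟨by linarith [hy.2], by linarith [hy.1]⟩
      linarith) ht (y := -y) ⟨by linarith [hy.2], by linarith [hy.1]⟩
  simp only [neg_neg] at this
  linarith

/-- The Steklov average of a Lipschitz function. -/
theorem exists_steklov {f : ℝ → ℝ} {K m : ℝ} (hm : 0 < m)
    (hK : ∀ x y, |f x - f y| ≤ K * |x - y|) :
    ∃ f₁ : ℝ → ℝ, (∀ z, HasDerivAt f₁ ((f (z + m) - f z) / m) z) ∧ (∀ z, |f₁ z - f z| ≤ K * m) ∧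
      ∀ x y, |f₁ x - f₁ y| ≤ K * |x - y| := by
  have hK0 : 0 ≤ K := by simpa using (abs_nonneg _).trans (hK 1 0)
  have hc : Continuous f := (LipschitzWith.of_dist_le_mul (K := ⟨K, hK0⟩) fun x y =>
    hK x y).continuous
  have hder : ∀ z, HasDerivAt (fun z => (∫ t in (0 : ℝ)..(z + m), f t) - ∫ t in (0 : ℝ)..z, f t)
      (f (z + m) - f z) z := fun z =>
    ((hc.integral_hasStrictDerivAt 0 (z + m)).hasDerivAt.comp_add_const z m).sub
      (hc.integral_hasStrictDerivAt 0 z).hasDerivAt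
  have hd := fun z => (hder z).div_const m
  have hb : ∀ z, |(f (z + m) - f z) / m| ≤ K := fun z => by
    rw [abs_div, abs_of_pos hm, div_le_iff₀ hm]
    simpa [abs_of_pos hm] using hK (z + m) z
  refine ⟨_, hd, fun z => ?_, fun x y => ?_⟩
  · have e1 : (∫ t in (0 : ℝ)..(z + m), f t) - ∫ t in (0 : ℝ)..z, f t = ∫ t in z..(z + m), f t :=
      intervalIntegral.integral_interval_sub_left (hc.intervalIntegrable _ _)
        (hc.intervalIntegrable _ _)
    have e2 : (∫ t in z..(z + m), f t) - m * f z = ∫ t in z..(z + m), (f t - f z) := by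
      rw [intervalIntegral.integral_sub (hc.intervalIntegrable _ _) (by simp)]
      simp
    have e3 : ‖∫ t in z..(z + m), (f t - f z)‖ ≤ K * m * |z + m - z| := by
      refine intervalIntegral.norm_integral_le_of_norm_le_const fun t ht => ?_
      rw [uIoc_of_le (by linarith)] at ht
      refine (hK t z).trans (mul_le_mul_of_nonneg_left ?_ hK0)
      rw [abs_of_pos (by linarith [ht.1])]; linarith [ht.2]
    rw [e1, show (∫ t in z..(z + m), f t) / m - f z = ((∫ t in z..(z + m), f t) - m * f z) / m by
      field_simp, e2, abs_div, abs_of_pos hm, div_le_iff₀ hm]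
    simpa [abs_of_pos hm] using e3
  · exact convex_univ.norm_image_sub_le_of_norm_hasDerivWithin_le
      (fun x _ => (hd x).hasDerivWithinAt) (fun x _ => hb x) (mem_univ y) (mem_univ x)

theorem exists_c2b_above {f : ℝ → ℝ} {K B τ : ℝ} (hτ : 0 < τ)
    (hK : ∀ x y, |f x - f y| ≤ K * |x - y|) (hB : ∀ x, |f x| ≤ B) :
    ∃ f₂, C2b f₂ ∧ ∀ z, f z < f₂ z ∧ f₂ z < f z + 2 * τ := by
  have hK0 : 0 ≤ K := by simpa using (abs_nonneg _).trans (hK 1 0)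
  set m := τ / (2 * K + 1) with hm
  have hm0 : 0 < m := by positivity
  have hKm : 2 * (K * m) < τ := by
    have : (2 * K + 1) * m = τ := by rw [hm]; field_simp
    linarith
  obtain ⟨f₁, h1, h2, h3⟩ := exists_steklov hm0 hK
  obtain ⟨f₂, k1, k2, k3⟩ := exists_steklov hm0 h3
  have hclose : ∀ z, |f₂ z - f z| ≤ 2 * (K * m) := fun z => by
    have := abs_sub_le (f₂ z) (f₁ z) (f z)
    linarith [h2 z, k2 z]
  refine ⟨fun z => f₂ z + τ, C2b.add ?_ (C2b.const τ), fun z => ?_⟩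
  · refine ⟨_, fun z => ((f (z + m + m) - f (z + m)) / m - (f (z + m) - f z) / m) / m,
      B + τ + K + 2 * K / m, k1, fun z =>
        (((h1 (z + m)).comp_add_const z m).sub (h1 z)).div_const m, fun z => ⟨?_, ?_, ?_⟩⟩
    · have e : 0 ≤ 2 * K / m := by positivity
      have := abs_sub_abs_le_abs_sub (f₂ z) (f z)
      linarith [hclose z, hB z]
    · have e : 0 ≤ 2 * K / m := by positivity
      have hB0 := (abs_nonneg _).trans (hB 0)
      have : |(f₁ (z + m) - f₁ z) / m| ≤ K := by
        rw [abs_div, abs_of_pos hm0, div_le_iff₀ hm0]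
        simpa [abs_of_pos hm0] using h3 (z + m) z
      linarith
    · have hb : ∀ z, |(f (z + m) - f z) / m| ≤ K := fun z => by
        rw [abs_div, abs_of_pos hm0, div_le_iff₀ hm0]
        simpa [abs_of_pos hm0] using hK (z + m) z
      have hB0 := (abs_nonneg _).trans (hB 0)
      have : |((f (z + m + m) - f (z + m)) / m - (f (z + m) - f z) / m) / m| ≤ 2 * K / m := by
        rw [abs_div, abs_of_pos hm0]
        gcongr
        refine (abs_sub _ _).trans ?_
        linarith [hb z, hb (z + m)]
      linarith
  · have := abs_le.1 (hclose z)
    constructor <;> linarith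

theorem exists_c2b_below {f : ℝ → ℝ} {K B τ : ℝ} (hτ : 0 < τ)
    (hK : ∀ x y, |f x - f y| ≤ K * |x - y|) (hB : ∀ x, |f x| ≤ B) :
    ∃ f₂, C2b f₂ ∧ ∀ z, f z - 2 * τ < f₂ z ∧ f₂ z < f z := by
  obtain ⟨u, h1, h2⟩ := exists_c2b_above (f := fun x => -f x) (B := B) hτ
    (fun x y => by rw [neg_sub_neg, abs_sub_comm]; exact hK x y) (fun x => by simpa using hB x)
  refine ⟨fun z => -1 * u z, h1.const_mul (-1), fun z => ?_⟩
  have := h2 z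
  constructor <;> linarith

theorem exists_cutoff {b : ℝ} (hb : 0 < b) : ∃ ζ : ℝ → ℝ, C2b ζ ∧ C2b (fun z => ζ z * z) ∧
    C2b (fun z => ζ z * z ^ 2) ∧ (∀ z, 0 ≤ ζ z ∧ ζ z ≤ 1) ∧ (∀ z, |z| ≤ b → ζ z = 1) ∧
    ∀ z, 2 * b ≤ |z| → ζ z = 0 := by
  let u : ContDiffBump (0 : ℝ) := ⟨b, 2 * b, hb, by linarith⟩
  refine ⟨u, u.contDiff.c2b u.hasCompactSupport, ?_, ?_, fun z => ⟨u.nonneg, u.le_one⟩,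
    fun z hz => u.one_of_mem_closedBall (by simpa using hz),
    fun z hz => u.zero_of_le_dist (by simpa using hz)⟩
  · exact (u.contDiff.mul contDiff_id).c2b u.hasCompactSupport.mul_right
  · exact (u.contDiff.mul (contDiff_id.pow 2)).c2b u.hasCompactSupport.mul_right

/-- A test profile which is an exact parabola near the origin and follows `f` away from it. -/
theorem exists_glued {b : ℝ} (hb : 0 < b) : ∃ ζ : ℝ → ℝ, (∀ z, 0 ≤ ζ z ∧ ζ z ≤ 1) ∧
    (∀ z, |z| ≤ b → ζ z = 1) ∧ (∀ z, 2 * b ≤ |z| → ζ z = 0) ∧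
    ∀ f₂, C2b f₂ → ∀ s Λ : ℝ,
      C2b (fun z => ζ z * (s * z + Λ * z ^ 2) + (1 - ζ z) * f₂ z) ∧
      HasDerivAt (fun z => ζ z * (s * z + Λ * z ^ 2) + (1 - ζ z) * f₂ z) s 0 := by
  obtain ⟨ζ, h1, h2, h3, h4, h5, h6⟩ := exists_cutoff hb
  refine ⟨ζ, h4, h5, h6, fun f₂ hf s Λ => ⟨?_, ?_⟩⟩
  · have := ((h2.const_mul s).add (h3.const_mul Λ)).add
      (((C2b.const 1).add (h1.const_mul (-1))).mul hf)
    convert this using 2 with z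
    ring
  have : HasDerivAt (fun z : ℝ => s * z + Λ * z ^ 2) s 0 := by
    have := ((hasDerivAt_id (0 : ℝ)).const_mul s).add ((hasDerivAt_pow 2 (0 : ℝ)).const_mul Λ)
    exact this.congr_deriv (by simp)
  refine this.congr_of_eventuallyEq ?_
  filter_upwards [Metric.ball_mem_nhds (0 : ℝ) hb] with z hz
  have : ζ z = 1 := h5 z (by simpa using (Metric.mem_ball.1 hz).le)
  rw [this]; ring

/-- The symmetric annulus `e ≤ |z| < s`. -/
def ann (e s : ℝ) : Set ℝ := {z : ℝ | e ≤ |z| ∧ |z| < s}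

theorem measurableSet_ann (e s : ℝ) : MeasurableSet (ann e s) :=
  (measurableSet_le measurable_const measurable_id.abs).inter
    (measurableSet_lt measurable_id.abs measurable_const)

theorem measurableSet_abs_lt (s : ℝ) : MeasurableSet {z : ℝ | |z| < s} :=
  measurableSet_lt measurable_id.abs measurable_const

theorem volume_abs_lt (s : ℝ) : volume {z : ℝ | |z| < s} = ENNReal.ofReal (2 * s) := by
  have : {z : ℝ | |z| < s} = Metric.ball 0 s := by ext z; simp
  rw [this, Real.volume_ball]

theorem volume_real_abs_lt {s : ℝ} (hs : 0 ≤ s) : volume.real {z : ℝ | |z| < s} = 2 * s := by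
  rw [measureReal_def, volume_abs_lt, ENNReal.toReal_ofReal (by linarith)]

theorem tendsto_setIntegral_le_abs {f : ℝ → ℝ} (hf : Integrable f) :
    Tendsto (fun e => ∫ z in {z : ℝ | e ≤ |z|}, f z) (𝓝[>] 0) (𝓝 (∫ z, f z)) := by
  simp_rw [← integral_indicator (measurableSet_le_abs _)]
  refine tendsto_integral_filter_of_dominated_convergence (fun z => ‖f z‖)
    (Eventually.of_forall fun e => (hf.indicator (measurableSet_le_abs e)).1)
    (Eventually.of_forall fun e => Eventually.of_forall fun z => norm_indicator_le_norm_self _ _)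
    hf.norm ?_
  have : ∀ᵐ z : ℝ, z ≠ 0 := by simp [ae_iff]
  filter_upwards [this] with z hz
  refine tendsto_const_nhds.congr' ?_
  filter_upwards [Ioo_mem_nhdsGT (abs_pos.2 hz)] with e he
  rw [indicator_of_mem]
  exact he.2.le

theorem integrableOn_ann_inv_abs {e s : ℝ} (he : 0 < e) :
    IntegrableOn (fun z : ℝ => 1 / |z|) (ann e s) := by
  have hfin : volume (ann e s) < ⊤ :=
    (measure_mono fun z hz => hz.2).trans_lt ((volume_abs_lt s).trans_lt ENNReal.ofReal_lt_top)
  refine Measure.integrableOn_of_bounded (M := 1 / e) hfin.ne (by measurability) ?_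
  refine (ae_restrict_iff' (measurableSet_ann e s)).2 (Eventually.of_forall fun z hz => ?_)
  have := hz.1
  rw [Real.norm_of_nonneg (by positivity)]
  gcongr

theorem integral_ann_inv_abs {e s : ℝ} (he : 0 < e) (hes : e ≤ s) :
    ∫ z in ann e s, 1 / |z| = 2 * Real.log (s / e) := by
  rw [← integral_indicator (measurableSet_ann e s)]
  have : (ann e s).indicator (fun z : ℝ => 1 / |z|) =
      fun z => (Ico e s).indicator (fun u : ℝ => 1 / u) |z| := by
    funext z; simp only [indicator, ann, mem_ofPred_eq, mem_Ico]; congr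
  have h2 : Ico e s ∩ Ioi 0 = Ico e s := inter_eq_left.2 fun u hu => he.trans_le hu.1
  rw [this, integral_comp_abs, integral_indicator measurableSet_Ico,
    Measure.restrict_restrict measurableSet_Ico, h2, integral_Ico_eq_integral_Ioc,
    ← intervalIntegral.integral_of_le hes, integral_one_div_of_pos he (he.trans_le hes)]

/-- Upper bound for an integral from different bounds near zero, on an annulus and at infinity. -/
theorem integral_le_of_three {F f₃ : ℝ → ℝ} {b α c₁ c₂ : ℝ} (hb : 0 < b) (hbα : b ≤ α)
    (hF : Integrable F) (h1 : ∀ z, |z| < b → F z ≤ c₁)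
    (h2 : ∀ z, b ≤ |z| → |z| < α → F z ≤ c₂ / |z|) (h3 : ∀ z, α ≤ |z| → F z ≤ f₃ z)
    (hf₃ : IntegrableOn f₃ {z : ℝ | α ≤ |z|}) :
    ∫ z, F z ≤ 2 * b * c₁ + 2 * c₂ * Real.log (α / b) + ∫ z in {z : ℝ | α ≤ |z|}, f₃ z := by
  have hc1 : {z : ℝ | |z| < α}ᶜ = {z : ℝ | α ≤ |z|} := by ext z; simp
  have hdisj : Disjoint {z : ℝ | |z| < b} (ann b α) :=
    Set.disjoint_left.2 fun z hz hz' => absurd hz'.1 (not_le.2 hz)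
  have hun : {z : ℝ | |z| < α} = {z : ℝ | |z| < b} ∪ ann b α := by
    ext z
    simp only [ann, mem_ofPred_eq, mem_union]
    constructor
    · intro h
      rcases lt_or_ge |z| b with h' | h'
      · exact Or.inl h'
      · exact Or.inr ⟨h', h⟩
    · rintro (h | h)
      · exact h.trans_le hbα
      · exact h.2
  rw [← integral_add_compl (measurableSet_abs_lt α) hF, hc1, hun,
    setIntegral_union hdisj (measurableSet_ann b α) hF.integrableOn hF.integrableOn]
  refine add_le_add (add_le_add ?_ ?_) ?_
  · calc ∫ z in {z : ℝ | |z| < b}, F z ≤ ∫ z in {z : ℝ | |z| < b}, c₁ := by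
          refine setIntegral_mono_on hF.integrableOn ?_ (measurableSet_abs_lt b) h1
          exact integrableOn_const (by rw [volume_abs_lt]; exact ENNReal.ofReal_ne_top)
      _ = 2 * b * c₁ := by rw [setIntegral_const, volume_real_abs_lt hb.le, smul_eq_mul]
  · calc ∫ z in ann b α, F z ≤ ∫ z in ann b α, c₂ * (1 / |z|) := by
          refine setIntegral_mono_on hF.integrableOn ((integrableOn_ann_inv_abs hb).const_mul _)
            (measurableSet_ann b α) fun z hz => ?_
          rw [mul_one_div]; exact h2 z hz.1 hz.2
      _ = 2 * c₂ * Real.log (α / b) := by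
          rw [integral_const_mul, integral_ann_inv_abs hb hbα]; ring
  · exact setIntegral_mono_on hF.integrableOn hf₃ (measurableSet_le_abs α) h3

theorem log_tail {a α : ℝ} (ha : 0 < a) (hα : 0 < α) :
    IntegrableOn (fun z : ℝ => Real.log (1 + |z| / a) / z ^ 2) {z : ℝ | α ≤ |z|} ∧
    ∫ z in {z : ℝ | α ≤ |z|}, Real.log (1 + |z| / a) / z ^ 2 ≤
      2 / a * (1 + Real.log (1 + a / α)) := by
  set f : ℝ → ℝ := fun u => Real.log (1 + u / a) / u ^ 2 with hf
  set G : ℝ → ℝ := fun u => -(Real.log (1 + u / a) / u) + 1 / a * (Real.log (u / (a + u))) with hG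
  have hder : ∀ u ∈ Ici α, HasDerivAt G (f u) u := by
    intro u hu
    have hu0 : 0 < u := hα.trans_le hu
    have h1 : HasDerivAt (fun u : ℝ => 1 + u / a) (1 / a) u :=
      ((hasDerivAt_id u).div_const a).const_add 1
    have hp : 0 < 1 + u / a := by positivity
    have h2 := (h1.log hp.ne').div (hasDerivAt_id u) hu0.ne'
    have h3 : HasDerivAt (fun u : ℝ => u / (a + u)) _ u :=
      (hasDerivAt_id u).div ((hasDerivAt_id u).const_add a) (by positivity)
    have hq : 0 < u / (a + u) := by positivity
    have h4 := (h3.log hq.ne').const_mul (1 / a)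
    refine (h2.neg.add h4).congr_deriv ?_
    simp only [id, hf]
    have : a + u ≠ 0 := by positivity
    have : a ≠ 0 := ha.ne'
    have : u ≠ 0 := hu0.ne'
    generalize Real.log (1 + u / a) = w
    field_simp
    ring
  have hpos : ∀ u ∈ Ioi α, 0 ≤ f u := fun u hu => by
    have hu0 : 0 < u := hα.trans hu
    exact div_nonneg (Real.log_nonneg (by have : 0 ≤ u / a := by positivity
                                          linarith)) (sq_nonneg _)
  have hlim : Tendsto G atTop (𝓝 0) := by
    have e1 : Tendsto (fun u : ℝ => Real.log (1 + u / a) / u) atTop (𝓝 0) := by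
      have h := Real.isLittleO_log_id_atTop.tendsto_div_nhds_zero
      have h1 : Tendsto (fun u : ℝ => 1 + u / a) atTop atTop :=
        tendsto_atTop_add_const_left _ _ (tendsto_id.atTop_div_const ha)
      have h2 := h.comp h1
      have h3 : Tendsto (fun u : ℝ => (1 + u / a) / u) atTop (𝓝 (1 / a)) := by
        have : Tendsto (fun u : ℝ => u⁻¹ + 1 / a) atTop (𝓝 (0 + 1 / a)) :=
          tendsto_inv_atTop_zero.add_const _
        rw [zero_add] at this
        refine this.congr' ?_
        filter_upwards [eventually_gt_atTop 0] with u hu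
        field_simp
      have h4 := h2.mul h3
      rw [zero_mul] at h4
      refine h4.congr' ?_
      filter_upwards [eventually_gt_atTop 0] with u hu
      have : 0 < 1 + u / a := by positivity
      simp only [Function.comp, id]
      field_simp
    have e2 : Tendsto (fun u : ℝ => Real.log (u / (a + u))) atTop (𝓝 0) := by
      rw [← Real.log_one]
      refine (Real.continuousAt_log one_ne_zero).tendsto.comp ?_
      have : Tendsto (fun u : ℝ => 1 - a * (a + u)⁻¹) atTop (𝓝 (1 - a * 0)) :=
        ((tendsto_inv_atTop_zero.comp (tendsto_atTop_add_const_left _ a tendsto_id)).const_mul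
          a).const_sub 1
      rw [mul_zero, sub_zero] at this
      refine this.congr' ?_
      filter_upwards [eventually_gt_atTop 0] with u hu
      have : a + u ≠ 0 := by positivity
      field_simp
      ring
    have := e1.neg.add (e2.const_mul (1 / a))
    rwa [mul_zero, neg_zero, add_zero] at this
  have hint := integrableOn_Ioi_deriv_of_nonneg' hder hpos hlim
  have hval := integral_Ioi_of_hasDerivAt_of_nonneg' hder hpos hlim
  have hfun : ({z : ℝ | α ≤ |z|}).indicator (fun z : ℝ => Real.log (1 + |z| / a) / z ^ 2) =
      fun z => (Ici α).indicator f |z| := by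
    funext z
    simp only [indicator, mem_ofPred_eq, mem_Ici, hf, sq_abs]
  have hI : Integrable fun z => (Ici α).indicator f |z| := by
    have h1 : Integrable ((Ici α).indicator f) :=
      (integrable_indicator_iff measurableSet_Ici).2 (Iff.mpr integrableOn_Ici_iff_integrableOn_Ioi hint)
    refine (h1.add h1.comp_neg).congr (Eventually.of_forall fun z => ?_)
    simp only [Pi.add_apply]
    rcases le_total 0 z with hz | hz
    · have : -z ∉ Ici α := fun h => by have : α ≤ -z := h; linarith
      rw [indicator_of_notMem this, abs_of_nonneg hz, add_zero]
    · have : z ∉ Ici α := fun h => by have : α ≤ z := h; linarith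
      rw [indicator_of_notMem this, abs_of_nonpos hz, zero_add]
  refine ⟨?_, ?_⟩
  · rw [← integrable_indicator_iff (measurableSet_le_abs α), hfun]; exact hI
  · have h2 : Ici α ∩ Ioi 0 = Ici α := inter_eq_left.2 fun u hu => hα.trans_le hu
    rw [← integral_indicator (measurableSet_le_abs α), hfun, integral_comp_abs,
      integral_indicator measurableSet_Ici, Measure.restrict_restrict measurableSet_Ici, h2,
      integral_Ici_eq_integral_Ioi, hval]
    have e1 : Real.log (1 + α / a) ≤ α / a := by
      have := Real.log_le_sub_one_of_pos (show 0 < 1 + α / a by positivity)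
      linarith
    have e2 : Real.log (α / (a + α)) = -Real.log (1 + a / α) := by
      rw [← Real.log_inv]; congr 1; field_simp; ring
    simp only [hG]
    rw [e2]
    have e3 : Real.log (1 + α / a) / α ≤ 1 / a := by
      rw [div_le_iff₀ hα]; rw [one_div_mul_eq_div]; exact e1
    have : 2 / a * (1 + Real.log (1 + a / α)) = 2 * (1 / a + 1 / a * Real.log (1 + a / α)) := by ring
    rw [this]
    linarith

/-- The odd part of the truncated singular integral. -/
noncomputable def oddInt (g : ℝ → ℝ → ℝ) (x e s : ℝ) : ℝ := ∫ z in ann e s, g x z / z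

theorem aestronglyMeasurable_of_mem_regSet {g : ℝ → ℝ → ℝ} {x : ℝ} (hx : x ∈ regSet g) :
    AEStronglyMeasurable (fun z => g x z) := by
  refine AEMeasurable.aestronglyMeasurable ?_
  have h1 : ∀ n : ℕ, AEMeasurable (fun z => g x z)
      (volume.restrict {z : ℝ | 1 / ((n : ℝ) + 1) ≤ |z|}) := fun n => by
    have hn : 0 < 1 / ((n : ℝ) + 1) := by positivity
    have := (hx _ hn).1.aemeasurable.mul (measurable_id.pow_const 2).aemeasurable
    refine this.congr ((ae_restrict_iff' (measurableSet_le_abs _)).2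
      (Eventually.of_forall fun z hz => ?_))
    have hz' : 1 / ((n : ℝ) + 1) ≤ |z| := hz
    have : z ≠ 0 := abs_pos.1 (hn.trans_le hz')
    simp only [Pi.mul_apply, id]
    field_simp
  have h2 := AEMeasurable.iUnion h1
  rwa [Measure.restrict_eq_self_of_ae_mem] at h2
  have : ∀ᵐ z : ℝ, z ≠ 0 := by simp [ae_iff]
  filter_upwards [this] with z hz
  obtain ⟨n, hn⟩ := exists_nat_one_div_lt (abs_pos.2 hz)
  exact mem_iUnion.2 ⟨n, hn.le⟩

section
variable {g : ℝ → ℝ → ℝ} {C α : ℝ}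

theorem KernelBd.C_pos (h : KernelBd g C α) : 0 < C := one_pos.trans_le h.one_le

theorem KernelBd.integrableOn_odd (h : KernelBd g C α) {x : ℝ} (hx : x ∈ regSet g) {e s : ℝ}
    (he : 0 < e) (hs : s ≤ α) : IntegrableOn (fun z => g x z / z) (ann e s) := by
  refine Integrable.mono' ((integrableOn_ann_inv_abs (s := s) he).const_mul C)
    ((aestronglyMeasurable_of_mem_regSet hx).restrict.div₀
      (measurable_id.aestronglyMeasurable)) ?_
  refine (ae_restrict_iff' (measurableSet_ann e s)).2 (Eventually.of_forall fun z hz => ?_)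
  rw [norm_div, Real.norm_of_nonneg (h.nonneg _ _), Real.norm_eq_abs, mul_one_div]
  have := h.upper x z (hz.2.trans_le hs)
  gcongr

theorem KernelBd.oddInt_add (h : KernelBd g C α) {x : ℝ} (hx : x ∈ regSet g) {e s t : ℝ}
    (he : 0 < e) (hes : e ≤ s) (hst : s ≤ t) (ht : t ≤ α) :
    oddInt g x e t = oddInt g x e s + oddInt g x s t := by
  have hdisj : Disjoint (ann e s) (ann s t) :=
    Set.disjoint_left.2 fun z hz hz' => absurd hz'.1 (not_le.2 hz.2)
  have hun : ann e t = ann e s ∪ ann s t := by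
    ext z
    constructor
    · intro hz
      rcases lt_or_ge |z| s with h' | h'
      · exact Or.inl ⟨hz.1, h'⟩
      · exact Or.inr ⟨h', hz.2⟩
    · rintro (hz | hz)
      · exact ⟨hz.1, hz.2.trans_le hst⟩
      · exact ⟨hes.trans hz.1, hz.2⟩
  rw [oddInt, hun, setIntegral_union hdisj (measurableSet_ann s t)
    (h.integrableOn_odd hx he (hst.trans ht)) (h.integrableOn_odd hx (he.trans_le hes) ht)]
  rfl

theorem KernelBd.abs_oddInt_le (h : KernelBd g C α) {x : ℝ} {e s : ℝ}
    (he : 0 < e) (hes : e ≤ s) (hs : s ≤ α) : |oddInt g x e s| ≤ 2 * C * Real.log (s / e) := by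
  have := norm_integral_le_of_norm_le (f := fun z => g x z / z)
    ((integrableOn_ann_inv_abs (s := s) he).const_mul C)
    ((ae_restrict_iff' (measurableSet_ann e s)).2 (Eventually.of_forall fun z hz => by
      rw [norm_div, Real.norm_of_nonneg (h.nonneg _ _), Real.norm_eq_abs, mul_one_div]
      have := h.upper x z (hz.2.trans_le hs)
      gcongr))
  rw [integral_const_mul, integral_ann_inv_abs he hes] at this
  rw [show 2 * C * Real.log (s / e) = C * (2 * Real.log (s / e)) by ring]
  exact this

theorem KernelBd.ratio_nonneg (h : KernelBd g C α) (x y : ℝ) : 0 ≤ g x 0 / g y 0 :=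
  div_nonneg (h.nonneg _ _) (h.nonneg _ _)

theorem KernelBd.center_pos (h : KernelBd g C α) (x : ℝ) : 0 < g x 0 :=
  (inv_pos.2 h.C_pos).trans_le (h.lower x 0 (by simpa using h.pos))

theorem KernelBd.inv_center_le (h : KernelBd g C α) (x : ℝ) : (g x 0)⁻¹ ≤ C :=
  inv_le_of_inv_le₀ h.C_pos (h.lower x 0 (by simpa using h.pos))

theorem KernelBd.ratio_le (h : KernelBd g C α) (x y : ℝ) : g x 0 / g y 0 ≤ C ^ 2 := by
  rw [div_eq_mul_inv, sq]
  exact mul_le_mul (h.upper x 0 (by simpa using h.pos)) (h.inv_center_le y)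
    (inv_nonneg.2 (h.nonneg _ _)) h.C_pos.le

theorem KernelBd.abs_ratio_sub_one_le (h : KernelBd g C α) (x y : ℝ) :
    |g x 0 / g y 0 - 1| ≤ C ^ 2 * |x - y| := by
  have := (h.center_pos y).ne'
  rw [show g x 0 / g y 0 - 1 = (g x 0 - g y 0) * (g y 0)⁻¹ by field_simp, abs_mul,
    abs_of_nonneg (inv_nonneg.2 (h.nonneg y 0))]
  calc _ ≤ C * |x - y| * C := mul_le_mul (h.lip _ _ _) (h.inv_center_le y)
        (inv_nonneg.2 (h.nonneg _ _)) (mul_nonneg h.C_pos.le (abs_nonneg _))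
    _ = _ := by ring

theorem KernelBd.abs_ratio_div_le (h : KernelBd g C α) (x y : ℝ) {z : ℝ} (hz : |z| < α) :
    |g x z / z - g x 0 / g y 0 * (g y z / z)| ≤ C * |x - y| := by
  rcases eq_or_ne z 0 with rfl | hz0
  · simpa using mul_nonneg h.C_pos.le (abs_nonneg (x - y))
  · rw [show g x z / z - g x 0 / g y 0 * (g y z / z) = (g x z - g x 0 / g y 0 * g y z) / z by ring,
      abs_div, div_le_iff₀ (abs_pos.2 hz0)]
    have := h.ratio x y z hz
    linarith

theorem KernelBd.oddInt_sub (h : KernelBd g C α) {x y : ℝ} (hx : x ∈ regSet g)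
    (hy : y ∈ regSet g) {e s : ℝ} (he : 0 < e) (hs : s ≤ α) :
    oddInt g x e s - g x 0 / g y 0 * oddInt g y e s =
      ∫ z in ann e s, (g x z / z - g x 0 / g y 0 * (g y z / z)) := by
  rw [integral_sub (h.integrableOn_odd hx he hs) ((h.integrableOn_odd hy he hs).const_mul _),
    integral_const_mul]
  rfl

theorem KernelBd.abs_oddInt_sub_le (h : KernelBd g C α) {x y : ℝ} (hx : x ∈ regSet g)
    (hy : y ∈ regSet g) {e s : ℝ} (he : 0 < e) (hes : e ≤ s) (hs : s ≤ α) :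
    |oddInt g x e s - g x 0 / g y 0 * oddInt g y e s| ≤ 2 * C * s * |x - y| := by
  rw [h.oddInt_sub hx hy he hs]
  have hsub : ann e s ⊆ {z : ℝ | |z| < s} := fun z hz => hz.2
  have hfin : volume (ann e s) < ⊤ :=
    (measure_mono hsub).trans_lt ((volume_abs_lt s).trans_lt ENNReal.ofReal_lt_top)
  have h1 := norm_setIntegral_le_of_norm_le_const (f := fun z =>
    g x z / z - g x 0 / g y 0 * (g y z / z)) (C := C * |x - y|) hfin
    (fun z hz => h.abs_ratio_div_le x y (hz.2.trans_le hs))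
  have h2 : volume.real (ann e s) ≤ 2 * s := by
    rw [← volume_real_abs_lt (he.le.trans hes)]
    exact measureReal_mono hsub (by rw [volume_abs_lt]; exact ENNReal.ofReal_ne_top)
  have h3 := mul_le_mul_of_nonneg_left h2 (mul_nonneg h.C_pos.le (abs_nonneg (x - y)))
  rw [Real.norm_eq_abs] at h1
  linarith

theorem KernelBd.exists_tendsto_oddInt (h : KernelBd g C α) {x y : ℝ} (hx : x ∈ regSet g)
    (hy : y ∈ regSet g) {j : ℝ} (hj : Tendsto (fun e => oddInt g y e α) (𝓝[>] 0) (𝓝 j)) :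
    ∃ j', Tendsto (fun e => oddInt g x e α) (𝓝[>] 0) (𝓝 j') := by
  set f : ℝ → ℝ := ({z : ℝ | |z| < α}).indicator fun z =>
    g x z / z - g x 0 / g y 0 * (g y z / z) with hf
  have hfi : Integrable f := by
    rw [hf, integrable_indicator_iff (measurableSet_abs_lt α)]
    refine Measure.integrableOn_of_bounded (M := C * |x - y|)
      (by rw [volume_abs_lt]; exact ENNReal.ofReal_ne_top) ?_ ?_
    · have hm := measurable_id.aestronglyMeasurable (μ := (volume : Measure ℝ))
      exact ((aestronglyMeasurable_of_mem_regSet hx).div₀ hm).sub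
        (((aestronglyMeasurable_of_mem_regSet hy).div₀ hm).const_mul _)
    · exact (ae_restrict_iff' (measurableSet_abs_lt α)).2
        (Eventually.of_forall fun z hz => h.abs_ratio_div_le x y hz)
  refine ⟨_, ((tendsto_setIntegral_le_abs hfi).add (hj.const_mul (g x 0 / g y 0))).congr' ?_⟩
  filter_upwards [self_mem_nhdsWithin] with e he
  have : ∫ z in {z : ℝ | e ≤ |z|}, f z =
      ∫ z in ann e α, (g x z / z - g x 0 / g y 0 * (g y z / z)) := by
    rw [hf, setIntegral_indicator (measurableSet_abs_lt α)]
    rfl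
  rw [this, ← h.oddInt_sub hx hy he le_rfl]
  ring

theorem KernelBd.exists_oddInt_bound (h : KernelBd g C α) {y : ℝ}
    (hy : y ∈ regSet g) {j : ℝ} (hj : Tendsto (fun e => oddInt g y e α) (𝓝[>] 0) (𝓝 j)) :
    ∃ D, 0 ≤ D ∧ ∀ x ∈ regSet g, ∀ e, 0 < e → e ≤ α →
      |oddInt g x e α| ≤ D * (1 + Real.log (1 + |x|)) := by
  have hC := h.C_pos
  obtain ⟨B, hB⟩ : ∃ B, ∀ e, 0 < e → e ≤ α → |oddInt g y e α| ≤ B := by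
    have h1 : ∀ᶠ e in 𝓝[>] (0:ℝ), |oddInt g y e α| < |j| + 1 :=
      hj.abs.eventually_lt_const (by linarith)
    obtain ⟨u, hu, hu'⟩ := (mem_nhdsGT_iff_exists_Ioo_subset).1 h1
    have hu0 : 0 < u := hu
    refine ⟨max (|j| + 1) (2 * C * Real.log (α / u)), fun e he hea => ?_⟩
    rcases lt_or_ge e u with hh | hh
    · exact (hu' ⟨he, hh⟩).le.trans (le_max_left _ _)
    · refine (h.abs_oddInt_le he hea le_rfl).trans (le_trans ?_ (le_max_right _ _))
      have hα := h.pos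
      gcongr
  have hB0 : 0 ≤ B := (abs_nonneg _).trans (hB α h.pos le_rfl)
  have hly : 0 ≤ Real.log (1 + |y|) := Real.log_nonneg (by linarith [abs_nonneg y])
  refine ⟨2 * C ^ 2 * B + 4 * C + 2 * C * Real.log (1 + |y|), by positivity,
    fun x hx e he hea => ?_⟩
  set u := |x - y| with hu
  have hu0 : 0 ≤ u := abs_nonneg _
  have hα := h.pos
  have hlx : 0 ≤ Real.log (1 + |x|) := Real.log_nonneg (by linarith [abs_nonneg x])
  have hlog : Real.log (1 + u) ≤ Real.log (1 + |x|) + Real.log (1 + |y|) := by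
    rw [← Real.log_mul (by positivity) (by positivity)]
    refine Real.log_le_log (by positivity) ?_
    have := abs_sub x y
    nlinarith [abs_nonneg x, abs_nonneg y, mul_nonneg (abs_nonneg x) (abs_nonneg y)]
  have hfin : 2 * C ^ 2 * B + 2 * C + 2 * C * Real.log (1 + u) ≤
      (2 * C ^ 2 * B + 4 * C + 2 * C * Real.log (1 + |y|)) * (1 + Real.log (1 + |x|)) := by
    have e1 := mul_le_mul_of_nonneg_left hlog (by positivity : 0 ≤ 2 * C)
    have e2 : 0 ≤ 2 * C ^ 2 * B := by positivity
    have e3 : 0 ≤ C * Real.log (1 + |y|) := by positivity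
    nlinarith [mul_nonneg e2 hlx, mul_nonneg e3 hlx, mul_nonneg hC.le hlx]
  refine le_trans ?_ hfin
  set s := α / (1 + u) with hs
  have hs0 : 0 < s := by positivity
  have hsα : s ≤ α := div_le_self hα.le (by linarith)
  have hαs : α / s = 1 + u := by rw [hs]; field_simp
  rcases le_or_gt s e with hse | hse
  · have e1 := h.abs_oddInt_le (x := x) he hea le_rfl
    have e2 : Real.log (α / e) ≤ Real.log (1 + u) := by
      rw [← hαs]; gcongr
    have e3 := mul_le_mul_of_nonneg_left e2 (by positivity : 0 ≤ 2 * C)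
    have e4 : 0 ≤ 2 * C ^ 2 * B := by positivity
    linarith
  · rw [h.oddInt_add hx he hse.le hsα le_rfl]
    have e1 := h.abs_oddInt_le (x := x) hs0 hsα le_rfl
    rw [hαs] at e1
    have e2 := h.abs_oddInt_sub_le hx hy he hse.le hsα
    have e3 : |oddInt g y e s| ≤ 2 * B := by
      have := h.oddInt_add hy he hse.le hsα le_rfl
      have e0 : oddInt g y e s = oddInt g y e α - oddInt g y s α := by linarith
      rw [e0]
      refine (abs_sub _ _).trans ?_
      linarith [hB e he hea, hB s hs0 hsα]
    have e4 : |g x 0 / g y 0 * oddInt g y e s| ≤ C ^ 2 * (2 * B) := by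
      rw [abs_mul, abs_of_nonneg (h.ratio_nonneg x y)]
      exact mul_le_mul (h.ratio_le x y) e3 (abs_nonneg _) (sq_nonneg _)
    have e5 : 2 * C * s * u ≤ 2 * C := by
      have : s * u ≤ 1 := by
        rw [hs, div_mul_eq_mul_div, div_le_one (by positivity)]
        nlinarith [h.le_one]
      nlinarith
    have e6 := abs_sub_abs_le_abs_sub (oddInt g x e s) (g x 0 / g y 0 * oddInt g y e s)
    have e7 := abs_add_le (oddInt g x e s) (oddInt g x s α)
    linarith

/-- The mass of the kernel away from the singularity. -/
noncomputable def tailMass (g : ℝ → ℝ → ℝ) (α x : ℝ) : ℝ :=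
  ∫ z in {z : ℝ | α ≤ |z|}, g x z / z ^ 2

theorem KernelBd.tailMass_le (h : KernelBd g C α) {x y : ℝ} (hx : x ∈ regSet g)
    (hy : y ∈ regSet g) :
    tailMass g α x ≤ tailMass g α y + C * |x - y| * ∫ z in {z : ℝ | α ≤ |z|}, 1 / z ^ 2 := by
  unfold tailMass
  rw [← integral_const_mul, ← integral_add (hy α h.pos)
    ((integrableOn_inv_sq h.pos).const_mul _)]
  refine setIntegral_mono (hx α h.pos) ((hy α h.pos).add
    ((integrableOn_inv_sq h.pos).const_mul _)) fun z => ?_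
  have := (abs_le.1 (h.lip x y z)).2
  simp only
  rw [mul_one_div, ← add_div]
  gcongr
  linarith

theorem KernelBd.tailMass_nonneg (h : KernelBd g C α) (x : ℝ) : 0 ≤ tailMass g α x :=
  integral_nonneg fun _ => div_nonneg (h.nonneg _ _) (sq_nonneg _)
end

/-- A profile `θ` with its linear part `s z` removed near the origin. -/
noncomputable def remainder (α s : ℝ) (θ : ℝ → ℝ) (z : ℝ) : ℝ :=
  θ z - if |z| < α then s * z else 0

/-- The absolutely convergent part of the principal value. -/
noncomputable def remInt (g : ℝ → ℝ → ℝ) (x α s : ℝ) (θ : ℝ → ℝ) : ℝ :=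
  ∫ z, g x z * remainder α s θ z / z ^ 2

/-- Bounds for a profile `θ` with slope `s` at the origin. -/
structure ProfileBd (θ : ℝ → ℝ) (s Λ b α K B : ℝ) : Prop where
  cont : Continuous θ
  near : ∀ z, |z| < b → |θ z - s * z| ≤ Λ * z ^ 2
  mid : ∀ z, b ≤ |z| → |z| < α → |θ z - s * z| ≤ K * |z|
  far : ∀ z, α ≤ |z| → |θ z| ≤ B

section
variable {g : ℝ → ℝ → ℝ} {C α : ℝ} {θ : ℝ → ℝ} {s Λ b K B : ℝ}

theorem ProfileBd.apply_zero (hθ : ProfileBd θ s Λ b α K B) (hb : 0 < b) : θ 0 = 0 := by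
  have := hθ.near 0 (by simpa using hb)
  simpa using this

theorem KernelBd.rem_near (h : KernelBd g C α) (hθ : ProfileBd θ s Λ b α K B) (hb : 0 < b)
    (hbα : b ≤ α) (x : ℝ) {z : ℝ} (hz : |z| < b) :
    |g x z * remainder α s θ z / z ^ 2| ≤ C * Λ := by
  have hzα := hz.trans_le hbα
  have hC := h.C_pos
  have h1 := hθ.near z hz
  have hΛ : 0 ≤ Λ := by
    have := (abs_nonneg _).trans (hθ.near (b / 2) (by rw [abs_of_pos] <;> linarith))
    by_contra! hh
    nlinarith [sq_pos_of_pos (half_pos hb)]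
  rw [remainder, if_pos hzα]
  rcases eq_or_ne z 0 with rfl | hz0
  · simp; positivity
  · have hz2 : 0 < z ^ 2 := by positivity
    rw [abs_div, abs_of_pos hz2, div_le_iff₀ hz2, abs_mul, abs_of_nonneg (h.nonneg _ _), mul_assoc]
    exact mul_le_mul (h.upper x z hzα) h1 (abs_nonneg _) hC.le

theorem KernelBd.rem_mid (h : KernelBd g C α) (hθ : ProfileBd θ s Λ b α K B) (hb : 0 < b) (x : ℝ)
    {z : ℝ} (hz : b ≤ |z|) (hzα : |z| < α) :
    |g x z * remainder α s θ z / z ^ 2| ≤ C * K / |z| := by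
  have hC := h.C_pos
  have h1 := hθ.mid z hz hzα
  have hz1 : 0 < |z| := hb.trans_le hz
  have hz2 : 0 < z ^ 2 := by rw [← sq_abs]; positivity
  rw [remainder, if_pos hzα, abs_div, abs_of_pos hz2, div_le_div_iff₀ hz2 hz1, abs_mul,
    abs_of_nonneg (h.nonneg _ _)]
  calc _ ≤ C * (K * |z|) * |z| := by
        gcongr
        exact h.upper x z hzα
    _ = C * K * z ^ 2 := by rw [← sq_abs z]; ring

theorem KernelBd.rem_far (h : KernelBd g C α) (hθ : ProfileBd θ s Λ b α K B) (x : ℝ)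
    {z : ℝ} (hz : α ≤ |z|) :
    |g x z * remainder α s θ z / z ^ 2| ≤ B * (g x z / z ^ 2) := by
  have h1 := hθ.far z hz
  rw [remainder, if_neg (not_lt.2 hz), sub_zero, abs_div, abs_of_nonneg (sq_nonneg z), abs_mul,
    abs_of_nonneg (h.nonneg _ _), ← mul_div_assoc, mul_comm B]
  have := h.nonneg x z
  gcongr

theorem KernelBd.integrable_rem (h : KernelBd g C α) (hθ : ProfileBd θ s Λ b α K B) (hb : 0 < b)
    (hbα : b ≤ α) {x : ℝ} (hx : x ∈ regSet g) :
    Integrable fun z => g x z * remainder α s θ z / z ^ 2 := by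
  have hm : AEStronglyMeasurable (fun z => g x z * remainder α s θ z / z ^ 2) := by
    refine ((aestronglyMeasurable_of_mem_regSet hx).mul ?_).div₀
      (by fun_prop : Continuous fun z : ℝ => z ^ 2).aestronglyMeasurable
    have h1 : Measurable fun z : ℝ => if |z| < α then s * z else 0 :=
      Measurable.ite (measurableSet_abs_lt α) (by fun_prop) measurable_const
    exact (hθ.cont.measurable.sub h1).aestronglyMeasurable
  have hC := h.C_pos
  have h1 : IntegrableOn (fun z => g x z * remainder α s θ z / z ^ 2) {z : ℝ | |z| < α} := by
    refine Measure.integrableOn_of_bounded (M := max (C * Λ) (C * |K| / b))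
      (by rw [volume_abs_lt]; exact ENNReal.ofReal_ne_top) hm ?_
    refine (ae_restrict_iff' (measurableSet_abs_lt α)).2 (Eventually.of_forall fun z hz => ?_)
    rcases lt_or_ge |z| b with hh | hh
    · exact (h.rem_near hθ hb hbα x hh).trans (le_max_left _ _)
    · refine (h.rem_mid hθ hb x hh hz).trans (le_trans ?_ (le_max_right _ _))
      have := le_abs_self K
      gcongr
  have h2 : IntegrableOn (fun z => g x z * remainder α s θ z / z ^ 2) {z : ℝ | α ≤ |z|} := by
    refine Integrable.mono' ((hx α h.pos).const_mul B) hm.restrict ?_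
    exact (ae_restrict_iff' (measurableSet_le_abs α)).2
      (Eventually.of_forall fun z hz => h.rem_far hθ x hz)
  have h3 := h1.union h2
  have : {z : ℝ | |z| < α} ∪ {z : ℝ | α ≤ |z|} = univ := by
    ext z; simp [lt_or_ge]
  rwa [this, integrableOn_univ] at h3

theorem KernelBd.truncOp_profile (h : KernelBd g C α) (hθ : ProfileBd θ s Λ b α K B) (hb : 0 < b)
    (hbα : b ≤ α) {x : ℝ} (hx : x ∈ regSet g) {e : ℝ} (he : 0 < e) :
    truncOp g (fun y => θ (y - x)) x e =
      -s * oddInt g x e α - ∫ z in {z : ℝ | e ≤ |z|}, g x z * remainder α s θ z / z ^ 2 := by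
  have h1 : oddInt g x e α =
      ∫ z in {z : ℝ | e ≤ |z|}, ({z : ℝ | |z| < α}).indicator (fun z => g x z / z) z := by
    rw [setIntegral_indicator (measurableSet_abs_lt α)]; rfl
  have hi : IntegrableOn (({z : ℝ | |z| < α}).indicator (fun z => g x z / z))
      {z : ℝ | e ≤ |z|} := by
    rw [integrableOn_indicator_iff (measurableSet_abs_lt α), inter_comm]
    exact h.integrableOn_odd hx he le_rfl
  rw [h1, ← integral_const_mul, ← integral_sub (hi.const_mul _)
    (h.integrable_rem hθ hb hbα hx).integrableOn, truncOp]
  congr 1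
  funext z
  simp only [sub_self, hθ.apply_zero hb, add_sub_cancel_left, remainder, indicator, mem_ofPred_eq]
  rcases eq_or_ne z 0 with rfl | hz
  · simp
  · split_ifs <;> field_simp <;> ring

theorem KernelBd.op_profile (h : KernelBd g C α) (hθ : ProfileBd θ s Λ b α K B) (hb : 0 < b)
    (hbα : b ≤ α) {x : ℝ} (hx : x ∈ regSet g) {c : ℝ} {Op : (ℝ → ℝ) → ℝ → ℝ} (hOp : IsPV g c Op)
    {j : ℝ} (hj : Tendsto (fun e => oddInt g x e α) (𝓝[>] 0) (𝓝 j)) :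
    Op (fun y => θ (y - x)) x = -s * j - remInt g x α s θ := by
  refine (hOp _ x).1 _ (((hj.const_mul (-s)).sub
    (tendsto_setIntegral_le_abs (h.integrable_rem hθ hb hbα hx))).congr' ?_)
  filter_upwards [self_mem_nhdsWithin] with e he
  rw [h.truncOp_profile hθ hb hbα hx he]

theorem KernelBd.op_profile_of_not_tendsto (h : KernelBd g C α)
    (hθ : ProfileBd θ s Λ b α K B) (hb : 0 < b)
    (hbα : b ≤ α) {x : ℝ} (hx : x ∈ regSet g) {c : ℝ} {Op : (ℝ → ℝ) → ℝ → ℝ} (hOp : IsPV g c Op)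
    (hj : ¬ ∃ j, Tendsto (fun e => oddInt g x e α) (𝓝[>] 0) (𝓝 j)) (hs : s ≠ 0) :
    Op (fun y => θ (y - x)) x = c := by
  refine (hOp _ x).2 fun ⟨l, hl⟩ => hj ⟨_, ((hl.add (tendsto_setIntegral_le_abs
    (h.integrable_rem hθ hb hbα hx))).const_mul (-s⁻¹)).congr' ?_⟩
  filter_upwards [self_mem_nhdsWithin] with e he
  rw [h.truncOp_profile hθ hb hbα hx he]
  field_simp
  ring

theorem KernelBd.abs_remInt_le (h : KernelBd g C α) (hθ : ProfileBd θ s Λ b α K B) (hb : 0 < b)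
    (hbα : b ≤ α) {x : ℝ} (hx : x ∈ regSet g) :
    |remInt g x α s θ| ≤
      2 * b * (C * Λ) + 2 * (C * K) * Real.log (α / b) + B * tailMass g α x := by
  have hint := h.integrable_rem hθ hb hbα hx
  unfold remInt
  refine (norm_integral_le_integral_norm (fun z => g x z * remainder α s θ z / z ^ 2)).trans ?_
  rw [tailMass, ← integral_const_mul]
  exact integral_le_of_three hb hbα hint.norm (fun z hz => h.rem_near hθ hb hbα x hz)
    (fun z hz hz' => h.rem_mid hθ hb x hz hz') (fun z hz => h.rem_far hθ x hz)
    ((hx α h.pos).const_mul B)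

theorem KernelBd.remInt_sub_le (h : KernelBd g C α) {θ₁ θ₂ ν : ℝ → ℝ} {s₁ s₂ E : ℝ}
    (h₁ : ProfileBd θ₁ s₁ Λ b α K B) (h₂ : ProfileBd θ₂ s₂ Λ b α K B) (hb : 0 < b)
    (hbα : b ≤ α) {x y : ℝ} (hx : x ∈ regSet g) (hy : y ∈ regSet g) (hE : 0 ≤ E)
    (hmid : ∀ z, b ≤ |z| → |z| < α → θ₁ z - s₁ * z - (θ₂ z - s₂ * z) ≤ E * |z|)
    (hfar : ∀ z, α ≤ |z| → g x z * (θ₁ z - θ₂ z) / z ^ 2 ≤ ν z)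
    (hν : IntegrableOn ν {z : ℝ | α ≤ |z|}) :
    remInt g x α s₁ θ₁ - remInt g y α s₂ θ₂ ≤ 2 * b * (2 * C * Λ + C * |x - y| * Λ) +
      2 * (C * E + C * |x - y| * K) * Real.log (α / b) +
      ((∫ z in {z : ℝ | α ≤ |z|}, ν z) +
        C * |x - y| * B * ∫ z in {z : ℝ | α ≤ |z|}, 1 / z ^ 2) := by
  have hC := h.C_pos
  have hα := h.pos
  have i1 := h.integrable_rem h₁ hb hbα hx
  have i2 := h.integrable_rem h₂ hb hbα hy
  have hB : 0 ≤ B := (abs_nonneg _).trans (h₁.far α (le_abs_self α))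
  have hΛ : 0 ≤ Λ := by
    have := (abs_nonneg _).trans (h₁.near (b / 2) (by rw [abs_of_pos] <;> linarith))
    by_contra! hh
    nlinarith [sq_pos_of_pos (half_pos hb)]
  rw [remInt, remInt, ← integral_sub i1 i2, ← integral_const_mul,
    ← integral_add hν ((integrableOn_inv_sq hα).const_mul _)]
  have hsplit : ∀ z, g x z * remainder α s₁ θ₁ z / z ^ 2 - g y z * remainder α s₂ θ₂ z / z ^ 2 ≤
      g x z * (remainder α s₁ θ₁ z - remainder α s₂ θ₂ z) / z ^ 2 +
        C * |x - y| * |remainder α s₂ θ₂ z| / z ^ 2 := fun z => by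
    rw [← sub_div, ← add_div]
    have e1 : (g x z - g y z) * remainder α s₂ θ₂ z ≤ C * |x - y| * |remainder α s₂ θ₂ z| := by
      refine (le_abs_self _).trans ?_
      rw [abs_mul]
      exact mul_le_mul_of_nonneg_right (h.lip x y z) (abs_nonneg _)
    gcongr
    linarith
  have hxy := abs_nonneg (x - y)
  refine integral_le_of_three hb hbα (i1.sub i2) (fun z hz => ?_) (fun z hz hz' => ?_)
    (fun z hz => ?_) (hν.add ((integrableOn_inv_sq hα).const_mul _))
  · have hzα := hz.trans_le hbα
    rcases eq_or_ne z 0 with rfl | hz0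
    · simp; positivity
    · refine (hsplit z).trans ?_
      have hz2 : 0 < z ^ 2 := by positivity
      have e1 := h₁.near z hz
      have e2 := h₂.near z hz
      rw [remainder, remainder, if_pos hzα, if_pos hzα, ← add_div, div_le_iff₀ hz2]
      have e3 : θ₁ z - s₁ * z - (θ₂ z - s₂ * z) ≤ 2 * Λ * z ^ 2 := by
        linarith [(abs_le.1 e1).2, (abs_le.1 e2).1]
      have e4 : g x z * (θ₁ z - s₁ * z - (θ₂ z - s₂ * z)) ≤ C * (2 * Λ * z ^ 2) := by
        refine (mul_le_mul_of_nonneg_left e3 (h.nonneg x z)).trans ?_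
        have := h.upper x z hzα
        gcongr
      have e5 := mul_le_mul_of_nonneg_left e2 (mul_nonneg hC.le hxy)
      linarith
  · refine (hsplit z).trans ?_
    have hz1 : 0 < |z| := hb.trans_le hz
    have hz2 : 0 < z ^ 2 := by rw [← sq_abs]; positivity
    have e2 := h₂.mid z hz hz'
    rw [remainder, remainder, if_pos hz', if_pos hz', ← add_div, div_le_div_iff₀ hz2 hz1]
    have e4 : g x z * (θ₁ z - s₁ * z - (θ₂ z - s₂ * z)) ≤ C * (E * |z|) := by
      refine (mul_le_mul_of_nonneg_left (hmid z hz hz') (h.nonneg x z)).trans ?_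
      have := h.upper x z hz'
      gcongr
    have e5 := mul_le_mul_of_nonneg_left e2 (mul_nonneg hC.le hxy)
    have e6 := mul_le_mul_of_nonneg_right (add_le_add e4 e5) hz1.le
    have e7 : z ^ 2 = |z| * |z| := (abs_mul_abs_self z).symm ▸ by ring
    rw [e7]
    linarith
  · refine (hsplit z).trans ?_
    rw [remainder, remainder, if_neg (not_lt.2 hz), if_neg (not_lt.2 hz), sub_zero, sub_zero]
    refine add_le_add (hfar z hz) ?_
    rw [mul_one_div]
    have := h₂.far z hz
    gcongr
end

/-- The part of the far field bounded through a fixed reference point `y`. -/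
noncomputable def tailModulus (g : ℝ → ℝ → ℝ) (α y N ε : ℝ) : ℝ :=
  ∫ z in {z : ℝ | α ≤ |z|}, min (ε * |z|) N * (g y z / z ^ 2)

/-- Two profiles that are close to each other at scale `ε`, centred at `x` and at `y`. -/
structure CloseProfiles (g : ℝ → ℝ → ℝ) (α N κ ε x y p p₁ : ℝ) (θ₁ θ₂ : ℝ → ℝ) : Prop where
  mem_left : x ∈ regSet g
  mem_right : y ∈ regSet g
  dist_le : |x - y| ≤ N * ε
  slope_le : |p| ≤ N
  slope_sub : |p₁ - p| * (1 + |x| + ε⁻¹) ≤ 6 * κ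
  log_le : ε * Real.log (1 + |x|) ≤ κ
  bd_left : ProfileBd θ₁ p₁ (ε⁻¹ + 1) (ε ^ 2 / 2) α N N
  bd_right : ProfileBd θ₂ p (ε⁻¹ + 1) (ε ^ 2 / 2) α N N
  mid : ∀ z, ε ^ 2 / 2 ≤ |z| → |z| < α → θ₁ z - θ₂ z ≤ 12 * ε * |z|
  far : ∃ (μ : ℝ → ℝ) (τ : ℝ), 0 ≤ τ ∧ τ * tailMass g α x ≤ ε ∧
    ∀ z, α ≤ |z| → θ₁ z - θ₂ z ≤ μ z + 4 * τ ∧ 0 ≤ μ z ∧ μ z ≤ min (ε * |z|) N ∧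
      μ z ≤ 2 * κ * Real.log (1 + |z| / √(ε⁻¹ ^ 2 + x ^ 2)) / Real.log (ε⁻¹ ^ 2 + x ^ 2)

section
variable {g : ℝ → ℝ → ℝ} {C α N κ ε x y p p₁ : ℝ} {θ₁ θ₂ : ℝ → ℝ}

theorem KernelBd.integrableOn_tailModulus (h : KernelBd g C α) (hy : y ∈ regSet g) (hN : 0 ≤ N)
    (hε : 0 ≤ ε) :
    IntegrableOn (fun z => min (ε * |z|) N * (g y z / z ^ 2)) {z : ℝ | α ≤ |z|} := by
  refine Integrable.bdd_mul (c := N) (hy α h.pos)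
    (by fun_prop : Continuous fun z : ℝ => min (ε * |z|) N).aestronglyMeasurable
    (Eventually.of_forall fun z => ?_)
  rw [Real.norm_of_nonneg (le_min (by positivity) hN)]
  exact min_le_right _ _

theorem KernelBd.tendsto_tailModulus (h : KernelBd g C α) (hy : y ∈ regSet g) (hN : 0 ≤ N) :
    Tendsto (fun ε => tailModulus g α y N ε) (𝓝[>] 0) (𝓝 0) := by
  have key : Tendsto (fun ε => tailModulus g α y N ε) (𝓝[>] 0)
      (𝓝 (∫ z in {z : ℝ | α ≤ |z|}, (0 : ℝ))) := by
    refine tendsto_integral_filter_of_dominated_convergence (fun z => N * (g y z / z ^ 2)) ?_ ?_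
      ((hy α h.pos).const_mul N) ?_
    · filter_upwards [self_mem_nhdsWithin] with ε hε
      exact (h.integrableOn_tailModulus hy hN (le_of_lt hε)).aestronglyMeasurable
    · filter_upwards [self_mem_nhdsWithin] with ε hε
      refine Eventually.of_forall fun z => ?_
      have hε : 0 < ε := hε
      have h1 : 0 ≤ g y z / z ^ 2 := div_nonneg (h.nonneg _ _) (sq_nonneg _)
      rw [Real.norm_of_nonneg (mul_nonneg (le_min (by positivity) hN) h1)]
      exact mul_le_mul_of_nonneg_right (min_le_right _ _) h1
    · refine Eventually.of_forall fun z => ?_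
      have : Tendsto (fun ε : ℝ => min (ε * |z|) N * (g y z / z ^ 2)) (𝓝 0)
          (𝓝 (min (0 * |z|) N * (g y z / z ^ 2))) :=
        Continuous.tendsto (by fun_prop) 0
      rw [zero_mul, min_eq_left hN, zero_mul] at this
      exact this.mono_left nhdsWithin_le_nhds
  simpa using key

theorem one_add_log_le {a : ℝ} (hα : 0 < α) (ha : Real.exp 1 ≤ a) :
    1 + Real.log (1 + a / α) ≤ (1 + Real.log (1 + 1 / α)) * Real.log (a ^ 2) := by
  have h1 : 1 ≤ Real.log a := (Real.le_log_iff_exp_le ((Real.exp_pos 1).trans_le ha)).2 ha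
  have ha1 : 1 ≤ a := by linarith [Real.add_one_le_exp (1 : ℝ)]
  have hl : 0 ≤ Real.log (1 + 1 / α) := Real.log_nonneg (by
    have : 0 < 1 / α := by positivity
    linarith)
  have h2 : Real.log (1 + a / α) ≤ Real.log a + Real.log (1 + 1 / α) := by
    rw [← Real.log_mul (by positivity) (by positivity)]
    refine Real.log_le_log (by positivity) ?_
    rw [mul_add, mul_one, mul_one_div]
    linarith
  rw [Real.log_pow]
  push_cast
  nlinarith

/-- The scale `ε` is small compared with the fixed data. -/
structure SmallScale (g : ℝ → ℝ → ℝ) (α N κ y₀ ε : ℝ) : Prop where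
  pos : 0 < ε
  mul_le : N * ε ≤ κ
  le_one : ε ≤ 1
  exp_le : Real.exp 1 ≤ ε⁻¹
  ref_le : |y₀| ≤ ε⁻¹
  sq_le : ε ^ 2 / 2 ≤ α
  log_le : ε * Real.log (α / (ε ^ 2 / 2)) ≤ κ
  tail_le : tailModulus g α y₀ N ε ≤ κ

theorem KernelBd.eventually_smallScale (h : KernelBd g C α) (hN : 0 ≤ N) (hκ : 0 < κ)
    {y₀ : ℝ} (hy₀ : y₀ ∈ regSet g) : ∀ᶠ ε in 𝓝[>] (0 : ℝ), SmallScale g α N κ y₀ ε := by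
  have hsmall : ∀ {f : ℝ → ℝ} {a c : ℝ}, Continuous f → f 0 = a → a < c →
      ∀ᶠ ε in 𝓝[>] (0 : ℝ), f ε < c := fun {f a c} hf h0 hac =>
    (hf.tendsto 0).eventually_lt_const (by rwa [h0]) |>.filter_mono nhdsWithin_le_nhds
  have hα := h.pos
  have hlog : Tendsto (fun ε : ℝ => ε * Real.log (α / (ε ^ 2 / 2))) (𝓝[>] 0) (𝓝 0) := by
    have h1 : Tendsto (fun ε : ℝ => ε * Real.log (2 * α) - 2 * (Real.log ε * ε)) (𝓝[>] 0)
        (𝓝 (0 * Real.log (2 * α) - 2 * 0)) := by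
      refine Tendsto.sub ?_ ?_
      · exact ((continuous_id.mul continuous_const).tendsto (0 : ℝ)).mono_left nhdsWithin_le_nhds
      · have := (Real.continuous_mul_log.tendsto (0 : ℝ)).mono_left (nhdsWithin_le_nhds (s := Ioi 0))
        rw [zero_mul] at this
        exact (this.congr fun ε => mul_comm _ _).const_mul 2
    rw [zero_mul, mul_zero, sub_zero] at h1
    refine h1.congr' ?_
    filter_upwards [self_mem_nhdsWithin] with ε hε
    have hε : 0 < ε := hε
    rw [show α / (ε ^ 2 / 2) = 2 * α / ε ^ 2 by field_simp,
      Real.log_div (by positivity) (by positivity), Real.log_pow]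
    push_cast
    ring
  have hinv := tendsto_inv_nhdsGT_zero (𝕜 := ℝ)
  filter_upwards [self_mem_nhdsWithin,
    hsmall (f := fun ε => N * ε) (by fun_prop) (mul_zero N) hκ,
    hsmall (f := fun ε => ε) (by fun_prop) rfl one_pos,
    hinv.eventually_ge_atTop (Real.exp 1), hinv.eventually_ge_atTop |y₀|,
    hsmall (f := fun ε => ε ^ 2 / 2) (by fun_prop) (by norm_num) hα,
    hlog.eventually_lt_const hκ, (h.tendsto_tailModulus hy₀ hN).eventually_lt_const hκ]
    with ε h1 h2 h3 h4 h5 h6 h7 h8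
  exact ⟨h1, h2.le, h3.le, h4, h5, h6.le, h7.le, h8.le⟩

theorem CloseProfiles.remInt_sub_le (H : CloseProfiles g α N κ ε x y p p₁ θ₁ θ₂)
    (h : KernelBd g C α) {y₀ : ℝ} (hy₀ : y₀ ∈ regSet g) (hs : SmallScale g α N κ y₀ ε)
    (hN : 1 ≤ N) (hκ : 0 < κ) (hκ1 : κ ≤ 1) :
    remInt g x α p₁ θ₁ - remInt g y α p θ₂ ≤
      (42 * C + 2 * C * N * N + 8 * C * (1 + Real.log (1 + 1 / α)) + 5 +
        C * N * ∫ z in {z : ℝ | α ≤ |z|}, 1 / z ^ 2) * κ := by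
  have hC := h.one_le
  have hε := hs.pos
  have hα := h.pos
  have hεκ : ε ≤ κ := by nlinarith [hs.mul_le]
  have hb : 0 < ε ^ 2 / 2 := by positivity
  obtain ⟨μ, τ, hτ, hτm, hμ⟩ := H.far
  set A := ε⁻¹ ^ 2 + x ^ 2 with hA
  have hεi : 0 < ε⁻¹ := by positivity
  have hA0 : 0 < A := by positivity
  have hεa : ε⁻¹ ≤ √A := Real.le_sqrt_of_sq_le (by rw [hA]; linarith [sq_nonneg x])
  have hxa : |x| ≤ √A := Real.le_sqrt_of_sq_le (by rw [hA, sq_abs]; linarith [sq_nonneg ε⁻¹])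
  set a := √A with ha
  have haA : a ^ 2 = A := Real.sq_sqrt hA0.le
  have ha0 : 0 < a := hεi.trans_le hεa
  have hlogA : 0 < Real.log A := by
    rw [← haA]
    refine Real.log_pos ?_
    have : 1 < Real.exp 1 := by linarith [Real.add_one_lt_exp (one_ne_zero' ℝ)]
    nlinarith [hs.exp_le]
  have hlg := one_add_log_le hα (hs.exp_le.trans hεa)
  rw [haA] at hlg
  obtain ⟨hli, hle⟩ := log_tail ha0 hα
  have hΔ : |p₁ - p| ≤ 6 * ε := by
    have h1 := H.slope_sub
    have h2 : |p₁ - p| * ε⁻¹ ≤ 6 * κ := (mul_le_mul_of_nonneg_left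
      (by linarith [abs_nonneg x]) (abs_nonneg _)).trans h1
    rw [← div_eq_mul_inv, div_le_iff₀ hε] at h2
    nlinarith
  set c₁ := C * |x - y₀| * (2 * κ / Real.log A) with hc₁
  have hc₁0 : 0 ≤ c₁ := by positivity
  have i1 := h.integrableOn_tailModulus hy₀ (by linarith : 0 ≤ N) hε.le
  have i2 := hli.const_mul c₁
  have i12 : IntegrableOn (fun z => min (ε * |z|) N * (g y₀ z / z ^ 2) +
      c₁ * (Real.log (1 + |z| / a) / z ^ 2)) {z : ℝ | α ≤ |z|} := i1.add i2
  have i3 := (H.mem_left α hα).const_mul (4 * τ)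
  have key := h.remInt_sub_le (E := 18 * ε) (ν := fun z => min (ε * |z|) N * (g y₀ z / z ^ 2) +
      c₁ * (Real.log (1 + |z| / a) / z ^ 2) + 4 * τ * (g x z / z ^ 2))
      H.bd_left H.bd_right hb hs.sq_le H.mem_left H.mem_right
    (by positivity) (fun z hz hz' => ?_) (fun z hz => ?_) (i12.add i3)
  · have hν : (∫ z in {z : ℝ | α ≤ |z|}, (min (ε * |z|) N * (g y₀ z / z ^ 2) +
      c₁ * (Real.log (1 + |z| / a) / z ^ 2) + 4 * τ * (g x z / z ^ 2))) ≤
        κ + 8 * C * (1 + Real.log (1 + 1 / α)) * κ + 4 * κ := by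
      rw [integral_add i12 i3, integral_add i1 i2, integral_const_mul, integral_const_mul]
      refine add_le_add (add_le_add hs.tail_le ?_) ?_
      · have e1 : |x - y₀| ≤ 2 * a := by
          have := abs_sub x y₀
          linarith [hs.ref_le]
        have e0 : 0 < Real.log (1 + 1 / α) := Real.log_pos (by
          have : 0 < 1 / α := by positivity
          linarith)
        have e2 : 0 ≤ Real.log (1 + a / α) := Real.log_nonneg (by
          have : 0 < a / α := by positivity
          linarith)
        calc _ ≤ c₁ * (2 / a * (1 + Real.log (1 + a / α))) := by gcongr
          _ ≤ (C * (2 * a) * (2 * κ / Real.log A)) *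
              (2 / a * ((1 + Real.log (1 + 1 / α)) * Real.log A)) := by
            rw [hc₁]; gcongr
          _ = _ := by field_simp; ring
      · have : 4 * τ * ∫ z in {z : ℝ | α ≤ |z|}, g x z / z ^ 2 = 4 * (τ * tailMass g α x) := by
          rw [tailMass]; ring
        rw [this]; linarith
    have hI : 0 ≤ ∫ z in {z : ℝ | α ≤ |z|}, 1 / z ^ 2 := integral_nonneg fun z => by positivity
    set I := ∫ z in {z : ℝ | α ≤ |z|}, 1 / z ^ 2
    have hd := H.dist_le.trans hs.mul_le
    have hL0 : 0 ≤ Real.log (α / (ε ^ 2 / 2)) :=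
      Real.log_nonneg ((one_le_div hb).2 hs.sq_le)
    have t1 : 2 * (ε ^ 2 / 2) * (2 * C * (ε⁻¹ + 1) + C * |x - y| * (ε⁻¹ + 1)) ≤ 6 * C * κ := by
      have : 2 * (ε ^ 2 / 2) * (2 * C * (ε⁻¹ + 1) + C * |x - y| * (ε⁻¹ + 1)) =
        C * (ε + ε * ε) * (2 + |x - y|) := by field_simp
      rw [this]
      have h2 : ε + ε * ε ≤ 2 * κ := by nlinarith [hs.le_one]
      calc _ ≤ C * (2 * κ) * (2 + 1) := by gcongr; linarith
        _ = _ := by ring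
    have t2 : 2 * (C * (18 * ε) + C * |x - y| * N) * Real.log (α / (ε ^ 2 / 2)) ≤
        (36 * C + 2 * C * N * N) * κ := by
      calc _ ≤ 2 * (C * (18 * ε) + C * (N * ε) * N) * Real.log (α / (ε ^ 2 / 2)) := by
            gcongr; exact H.dist_le
        _ = (36 * C + 2 * C * N * N) * (ε * Real.log (α / (ε ^ 2 / 2))) := by ring
        _ ≤ _ := by gcongr; exact hs.log_le
    have t3 : C * |x - y| * N * I ≤ C * N * I * κ := by
      calc _ ≤ C * κ * N * I := by gcongr
        _ = _ := by ring
    linarith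
  · have := H.mid z hz hz'
    have h2 : (p - p₁) * z ≤ 6 * ε * |z| := by
      refine (le_abs_self _).trans ?_
      rw [abs_mul, abs_sub_comm]
      gcongr
    linarith
  · obtain ⟨m1, m2, m3, m4⟩ := hμ z hz
    have hz2 : 0 < z ^ 2 := by rw [← sq_abs]; have := hα.trans_le hz; positivity
    have e1 : g x z * (θ₁ z - θ₂ z) ≤ g x z * (μ z + 4 * τ) :=
      mul_le_mul_of_nonneg_left m1 (h.nonneg _ _)
    have e2 : g x z ≤ g y₀ z + C * |x - y₀| := by linarith [(abs_le.1 (h.lip x y₀ z)).2]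
    have e3 : g x z * μ z ≤ (g y₀ z + C * |x - y₀|) * μ z := mul_le_mul_of_nonneg_right e2 m2
    have e4 : g y₀ z * μ z ≤ g y₀ z * min (ε * |z|) N :=
      mul_le_mul_of_nonneg_left m3 (h.nonneg _ _)
    have e5 : C * |x - y₀| * μ z ≤ c₁ * Real.log (1 + |z| / a) := by
      calc _ ≤ C * |x - y₀| * (2 * κ * Real.log (1 + |z| / a) / Real.log A) := by gcongr
        _ = _ := by rw [hc₁]; ring
    calc _ ≤ (min (ε * |z|) N * g y₀ z + c₁ * Real.log (1 + |z| / a) + 4 * τ * g x z) / z ^ 2 := by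
          gcongr
          linarith
      _ = _ := by ring
end

section
variable {g : ℝ → ℝ → ℝ} {C α N κ ε x y p p₁ : ℝ} {θ₁ θ₂ : ℝ → ℝ}

theorem CloseProfiles.abs_slope_sub_le (H : CloseProfiles g α N κ ε x y p p₁ θ₁ θ₂)
    {w : ℝ} (hw : w ≤ 1 + |x| + ε⁻¹) : |p₁ - p| * w ≤ 6 * κ :=
  (mul_le_mul_of_nonneg_left hw (abs_nonneg _)).trans H.slope_sub

theorem log_one_add_abs_le (x : ℝ) : Real.log (1 + |x|) ≤ |x| := by
  have := Real.log_le_sub_one_of_pos (show 0 < 1 + |x| by positivity)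
  linarith

theorem log_one_add_abs_le_add (x y : ℝ) :
    Real.log (1 + |y|) ≤ Real.log (1 + |x|) + |x - y| := by
  have h1 : 1 + |y| ≤ (1 + |x|) * (1 + |x - y|) := by
    have := abs_sub_abs_le_abs_sub y x
    rw [abs_sub_comm y x] at this
    nlinarith [abs_nonneg x, abs_nonneg (x - y), mul_nonneg (abs_nonneg x) (abs_nonneg (x - y))]
  have h2 := Real.log_le_log (by positivity) h1
  rw [Real.log_mul (by positivity) (by positivity)] at h2
  linarith [log_one_add_abs_le (x - y)]

theorem abs_max_zero_sub_le (a b : ℝ) : |max a 0 - max b 0| ≤ |a - b| := by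
  simpa using abs_max_sub_max_le_max a 0 b 0

set_option maxHeartbeats 1000000 in
/-- When the first order part of the kernel converges, the operator is almost monotone on close
profiles. -/
theorem CloseProfiles.op_sub_ge_of_tendsto (H : CloseProfiles g α N κ ε x y p p₁ θ₁ θ₂)
    (h : KernelBd g C α) {c : ℝ} {Op : (ℝ → ℝ) → ℝ → ℝ} (hOp : IsPV g c Op)
    {y₀ : ℝ} (hy₀ : y₀ ∈ regSet g) (hs : SmallScale g α N κ y₀ ε)
    (hN : 1 ≤ N) (hκ : 0 < κ) (hκ1 : κ ≤ 1) {D Q₁ j₁ j₂ : ℝ} (hD : 0 ≤ D)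
    (hDb : ∀ x ∈ regSet g, ∀ e, 0 < e → e ≤ α →
      |oddInt g x e α| ≤ D * (1 + Real.log (1 + |x|)))
    (hj₁ : Tendsto (fun e => oddInt g x e α) (𝓝[>] 0) (𝓝 j₁))
    (hj₂ : Tendsto (fun e => oddInt g y e α) (𝓝[>] 0) (𝓝 j₂)) (hQ₁ : 0 ≤ Q₁)
    (hR : remInt g x α p₁ θ₁ - remInt g y α p θ₂ ≤ Q₁ * κ) :
    -((N * (6 * D + N * (2 * C + C ^ 2 * D * (2 + N)) + Q₁) + (N + 6) * (6 * D) + 12 * C +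
      12 * C * N + 6 * N * (tailMass g α y₀ +
        C * (1 + |y₀|) * ∫ z in {z : ℝ | α ≤ |z|}, 1 / z ^ 2)) * κ) ≤
      max p₁ 0 * Op (fun u => θ₁ (u - x)) x - max p 0 * Op (fun u => θ₂ (u - y)) y := by
  have hC := h.one_le
  have hε := hs.pos
  have hα := h.pos
  have hb : 0 < ε ^ 2 / 2 := by positivity
  have hεi : 0 < ε⁻¹ := by positivity
  rw [h.op_profile H.bd_left hb hs.sq_le H.mem_left hOp hj₁,
    h.op_profile H.bd_right hb hs.sq_le H.mem_right hOp hj₂]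
  have hRb := h.abs_remInt_le H.bd_left hb hs.sq_le H.mem_left
  have hT := h.tailMass_le H.mem_left hy₀
  have hT0 := h.tailMass_nonneg y₀
  have hI : 0 ≤ ∫ z in {z : ℝ | α ≤ |z|}, 1 / z ^ 2 := integral_nonneg fun z => by positivity
  set I := ∫ z in {z : ℝ | α ≤ |z|}, 1 / z ^ 2
  set R₁ := remInt g x α p₁ θ₁
  set R₂ := remInt g y α p θ₂
  have hev : ∀ᶠ e in 𝓝[>] (0 : ℝ), 0 < e ∧ e ≤ α := by
    filter_upwards [Ioc_mem_nhdsGT hα] with e he using he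
  have hlim : ∀ {x j}, x ∈ regSet g → Tendsto (fun e => oddInt g x e α) (𝓝[>] 0) (𝓝 j) →
      |j| ≤ D * (1 + Real.log (1 + |x|)) := fun {x j} hx hj =>
    le_of_tendsto hj.abs (hev.mono fun e he => hDb x hx e he.1 he.2)
  have b₁ := hlim H.mem_left hj₁
  have b₂ := hlim H.mem_right hj₂
  have b₁₂ : |j₁ - g x 0 / g y 0 * j₂| ≤ 2 * C * α * |x - y| :=
    le_of_tendsto (hj₁.sub (hj₂.const_mul _)).abs (hev.mono fun e he =>
      h.abs_oddInt_sub_le H.mem_left H.mem_right he.1 he.2 le_rfl)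
  have hlx := log_one_add_abs_le x
  have hlx0 : 0 ≤ Real.log (1 + |x|) := Real.log_nonneg (by linarith [abs_nonneg x])
  have hly0 : 0 ≤ Real.log (1 + |y|) := Real.log_nonneg (by linarith [abs_nonneg y])
  have hly := log_one_add_abs_le_add x y
  have hd := H.dist_le.trans hs.mul_le
  have d0 := abs_nonneg (p₁ - p)
  have d1 : |p₁ - p| ≤ 6 * κ := by
    have := H.abs_slope_sub_le (w := 1) (by linarith [abs_nonneg x])
    linarith
  have d2 : |p₁ - p| ≤ 6 * κ * ε := by
    have := H.abs_slope_sub_le (w := ε⁻¹) (by linarith [abs_nonneg x])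
    rwa [← div_eq_mul_inv, div_le_iff₀ hε] at this
  have d3 : |p₁ - p| * |j₁| ≤ 6 * D * κ := by
    have := H.abs_slope_sub_le (w := 1 + Real.log (1 + |x|)) (by linarith)
    calc _ ≤ |p₁ - p| * (D * (1 + Real.log (1 + |x|))) := by gcongr
      _ = D * (|p₁ - p| * (1 + Real.log (1 + |x|))) := by ring
      _ ≤ D * (6 * κ) := by gcongr
      _ = _ := by ring
  have d4 : |x - y| * (1 + Real.log (1 + |y|)) ≤ (2 + N) * κ := by
    have e1 : |x - y| * (1 + Real.log (1 + |y|)) ≤ N * ε * (2 + Real.log (1 + |x|)) := by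
      exact mul_le_mul H.dist_le (by linarith) (by linarith) (by positivity)
    have e2 := mul_le_mul_of_nonneg_left H.log_le (by linarith : 0 ≤ N)
    have e3 := hs.mul_le
    linarith
  have d5 : |j₁ - j₂| ≤ (2 * C + C ^ 2 * D * (2 + N)) * κ := by
    have e1 : |j₁ - j₂| ≤ |j₁ - g x 0 / g y 0 * j₂| + |(g x 0 / g y 0 - 1) * j₂| := by
      refine le_trans (le_of_eq ?_) (abs_add_le _ _)
      congr 1; ring
    have e2 : |(g x 0 / g y 0 - 1) * j₂| ≤ C ^ 2 * D * ((2 + N) * κ) := by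
      rw [abs_mul]
      calc _ ≤ C ^ 2 * |x - y| * (D * (1 + Real.log (1 + |y|))) := by
            gcongr
            exact h.abs_ratio_sub_one_le x y
        _ = C ^ 2 * D * (|x - y| * (1 + Real.log (1 + |y|))) := by ring
        _ ≤ _ := by gcongr
    have e3 : 2 * C * α * |x - y| ≤ 2 * C * 1 * κ := by
      have := h.le_one
      gcongr
    linarith
  have d6 : |p₁ - p| * |R₁| ≤
      (12 * C + 12 * C * N + 6 * N * (tailMass g α y₀ + C * (1 + |y₀|) * I)) * κ := by
    have e1 : |p₁ - p| * (2 * (ε ^ 2 / 2) * (C * (ε⁻¹ + 1))) ≤ 6 * κ * (2 * C) := by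
      have : 2 * (ε ^ 2 / 2) * (C * (ε⁻¹ + 1)) = C * (ε + ε * ε) := by field_simp
      rw [this]
      have : ε + ε * ε ≤ 2 := by nlinarith [hs.le_one]
      calc _ ≤ 6 * κ * (C * 2) := by gcongr
        _ = _ := by ring
    have hL0 : 0 ≤ Real.log (α / (ε ^ 2 / 2)) :=
      Real.log_nonneg ((one_le_div hb).2 hs.sq_le)
    have e2 : |p₁ - p| * (2 * (C * N) * Real.log (α / (ε ^ 2 / 2))) ≤ 12 * C * N * κ := by
      calc _ ≤ 6 * κ * ε * (2 * (C * N) * Real.log (α / (ε ^ 2 / 2))) := by gcongr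
        _ = 12 * C * N * κ * (ε * Real.log (α / (ε ^ 2 / 2))) := by ring
        _ ≤ 12 * C * N * κ * 1 := by
          gcongr
          exact hs.log_le.trans hκ1
        _ = _ := by ring
    have e3 : |p₁ - p| * tailMass g α x ≤ 6 * κ * (tailMass g α y₀ + C * (1 + |y₀|) * I) := by
      have f1 : tailMass g α x ≤ (1 + |x|) * (tailMass g α y₀ + C * (1 + |y₀|) * I) := by
        refine hT.trans ?_
        have f2 : |x - y₀| ≤ (1 + |x|) * (1 + |y₀|) := by
          have := abs_sub x y₀
          linarith [abs_nonneg x, abs_nonneg y₀, mul_nonneg (abs_nonneg x) (abs_nonneg y₀)]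
        have f3 : C * |x - y₀| * I ≤ C * ((1 + |x|) * (1 + |y₀|)) * I := by gcongr
        linarith [mul_nonneg (abs_nonneg x) hT0]
      calc _ ≤ |p₁ - p| * ((1 + |x|) * (tailMass g α y₀ + C * (1 + |y₀|) * I)) := by gcongr
        _ = |p₁ - p| * (1 + |x|) * (tailMass g α y₀ + C * (1 + |y₀|) * I) := by ring
        _ ≤ _ := by
          refine mul_le_mul_of_nonneg_right (H.abs_slope_sub_le (w := 1 + |x|) ?_) (by positivity)
          linarith
    calc _ ≤ |p₁ - p| * _ := mul_le_mul_of_nonneg_left hRb d0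
      _ = |p₁ - p| * (2 * (ε ^ 2 / 2) * (C * (ε⁻¹ + 1))) +
          |p₁ - p| * (2 * (C * N) * Real.log (α / (ε ^ 2 / 2))) +
          N * (|p₁ - p| * tailMass g α x) := by ring
      _ ≤ 6 * κ * (2 * C) + 12 * C * N * κ +
          N * (6 * κ * (tailMass g α y₀ + C * (1 + |y₀|) * I)) := by gcongr
      _ = _ := by ring
  have d7 : |p₁| ≤ N + 6 := by
    have : |p₁| ≤ |p₁ - p| + |p| := by
      refine le_trans (le_of_eq ?_) (abs_add_le _ _)
      congr 1; ring
    linarith [H.slope_le]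
  have k1 : |max p₁ 0 - max p 0| * |-p₁ * j₁ - R₁| ≤ (N + 6) * (6 * D) * κ +
      (12 * C + 12 * C * N + 6 * N * (tailMass g α y₀ + C * (1 + |y₀|) * I)) * κ := by
    have e1 : |-p₁ * j₁ - R₁| ≤ |p₁| * |j₁| + |R₁| := by
      refine (abs_sub _ _).trans ?_
      rw [abs_mul, abs_neg]
    calc _ ≤ |p₁ - p| * (|p₁| * |j₁| + |R₁|) := by
          exact mul_le_mul (abs_max_zero_sub_le _ _) e1 (abs_nonneg _) d0
      _ = |p₁| * (|p₁ - p| * |j₁|) + |p₁ - p| * |R₁| := by ring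
      _ ≤ (N + 6) * (6 * D * κ) +
          (12 * C + 12 * C * N + 6 * N * (tailMass g α y₀ + C * (1 + |y₀|) * I)) * κ :=
        add_le_add (mul_le_mul d7 d3 (by positivity) (by linarith)) d6
      _ = _ := by ring
  have k2 : -(N * ((6 * D + N * (2 * C + C ^ 2 * D * (2 + N)) + Q₁) * κ)) ≤
      max p 0 * ((-p₁ * j₁ - R₁) - (-p * j₂ - R₂)) := by
    have e1 : -((6 * D + N * (2 * C + C ^ 2 * D * (2 + N)) + Q₁) * κ) ≤
        (-p₁ * j₁ - R₁) - (-p * j₂ - R₂) := by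
      have f1 := (abs_le.1 ((abs_mul (p₁ - p) j₁).le.trans d3)).2
      have f2 : p * (j₁ - j₂) ≤ N * ((2 * C + C ^ 2 * D * (2 + N)) * κ) := by
        refine (le_abs_self _).trans ?_
        rw [abs_mul]
        exact mul_le_mul H.slope_le d5 (abs_nonneg _) (by linarith)
      linarith
    have e2 : max p 0 ≤ N := max_le ((le_abs_self p).trans H.slope_le) (by linarith)
    have e3 : 0 ≤ (6 * D + N * (2 * C + C ^ 2 * D * (2 + N)) + Q₁) * κ := by positivity
    have e4 := mul_le_mul_of_nonneg_left e1 (le_max_right p 0)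
    have e5 := mul_le_mul_of_nonneg_right e2 e3
    linarith
  have k3 := (neg_abs_le ((max p₁ 0 - max p 0) * (-p₁ * j₁ - R₁)))
  rw [abs_mul] at k3
  linarith

theorem KernelBd.exists_op_sub_ge (h : KernelBd g C α) {c : ℝ} {Op : (ℝ → ℝ) → ℝ → ℝ}
    (hOp : IsPV g c Op) (hN : 1 ≤ N) :
    ∃ Q, 0 ≤ Q ∧ ∀ κ, 0 < κ → κ ≤ 1 → ∀ᶠ ε in 𝓝[>] (0 : ℝ), ∀ x y p p₁ θ₁ θ₂,
      CloseProfiles g α N κ ε x y p p₁ θ₁ θ₂ → -(Q * κ) ≤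
        max p₁ 0 * Op (fun u => θ₁ (u - x)) x - max p 0 * Op (fun u => θ₂ (u - y)) y := by
  have hC := h.one_le
  have hα := h.pos
  rcases (regSet g).eq_empty_or_nonempty with he | ⟨y₀, hy₀⟩
  · refine ⟨0, le_rfl, fun κ _ _ => Eventually.of_forall fun ε x y p p₁ θ₁ θ₂ H => ?_⟩
    have := H.mem_left
    rw [he] at this
    exact this.elim
  by_cases hcv : ∃ j, Tendsto (fun e => oddInt g y₀ e α) (𝓝[>] 0) (𝓝 j)
  · obtain ⟨j, hj⟩ := hcv
    obtain ⟨D, hD, hDb⟩ := h.exists_oddInt_bound hy₀ hj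
    have hI : 0 ≤ ∫ z in {z : ℝ | α ≤ |z|}, 1 / z ^ 2 := integral_nonneg fun z => by positivity
    have e0 : 0 ≤ Real.log (1 + 1 / α) := Real.log_nonneg (by
      have : 0 < 1 / α := by positivity
      linarith)
    have hT0 := h.tailMass_nonneg y₀
    obtain ⟨Q₁, hQ₁, hR⟩ : ∃ Q₁, 0 ≤ Q₁ ∧ ∀ κ ε x y p p₁ θ₁ θ₂, 0 < κ → κ ≤ 1 →
        SmallScale g α N κ y₀ ε → CloseProfiles g α N κ ε x y p p₁ θ₁ θ₂ →
        remInt g x α p₁ θ₁ - remInt g y α p θ₂ ≤ Q₁ * κ :=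
      ⟨_, by positivity, fun κ ε x y p p₁ θ₁ θ₂ hκ hκ1 hs H =>
        H.remInt_sub_le h hy₀ hs hN hκ hκ1⟩
    refine ⟨N * (6 * D + N * (2 * C + C ^ 2 * D * (2 + N)) + Q₁) + (N + 6) * (6 * D) + 12 * C +
      12 * C * N + 6 * N * (tailMass g α y₀ +
        C * (1 + |y₀|) * ∫ z in {z : ℝ | α ≤ |z|}, 1 / z ^ 2), by positivity,
      fun κ hκ hκ1 => (h.eventually_smallScale (by linarith : 0 ≤ N) hκ hy₀).mono
      fun ε hs x y p p₁ θ₁ θ₂ H => ?_⟩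
    obtain ⟨j₁, hj₁⟩ := h.exists_tendsto_oddInt H.mem_left hy₀ hj
    obtain ⟨j₂, hj₂⟩ := h.exists_tendsto_oddInt H.mem_right hy₀ hj
    exact H.op_sub_ge_of_tendsto h hOp hy₀ hs hN hκ hκ1 hD hDb hj₁ hj₂ hQ₁
      (hR κ ε x y p p₁ θ₁ θ₂ hκ hκ1 hs H)
  · refine ⟨6 * |c|, by positivity, fun κ hκ hκ1 =>
      (h.eventually_smallScale (by linarith : 0 ≤ N) hκ hy₀).mono fun ε hs x y p p₁ θ₁ θ₂ H => ?_⟩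
    have hb : 0 < ε ^ 2 / 2 := by have := hs.pos; positivity
    have key : ∀ {x s θ}, x ∈ regSet g → ProfileBd θ s (ε⁻¹ + 1) (ε ^ 2 / 2) α N N →
        max s 0 * Op (fun u => θ (u - x)) x = max s 0 * c := fun {x s θ} hx hθ => by
      rcases eq_or_ne s 0 with rfl | hs0
      · simp
      · rw [h.op_profile_of_not_tendsto hθ hb hs.sq_le hx hOp
          (fun ⟨j, hj⟩ => hcv (h.exists_tendsto_oddInt hy₀ hx hj)) hs0]
    rw [key H.mem_left H.bd_left, key H.mem_right H.bd_right, ← sub_mul]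
    have e1 := H.abs_slope_sub_le (w := 1)
      (by have := hs.pos; have := abs_nonneg x; have : 0 < ε⁻¹ := by positivity
          linarith)
    have e2 := neg_abs_le ((max p₁ 0 - max p 0) * c)
    rw [abs_mul] at e2
    have e3 : |max p₁ 0 - max p 0| * |c| ≤ 6 * κ * |c| := by
      gcongr
      linarith [abs_max_zero_sub_le p₁ p]
    linarith
end

section
variable {g : ℝ → ℝ → ℝ} {C α N κ ε x y p : ℝ}

theorem abs_convex_comb_le {s a b c : ℝ} (h0 : 0 ≤ s) (h1 : s ≤ 1) (ha : |a| ≤ c) (hb : |b| ≤ c) :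
    |s * a + (1 - s) * b| ≤ c := by
  rw [abs_le] at *
  constructor <;> nlinarith

set_option maxHeartbeats 1000000 in
/-- Test profiles above `f` and below its perturbation that form a close pair. -/
theorem KernelBd.exists_closeProfiles (kb : KernelBd g C α) {f d : ℝ → ℝ} {K B q : ℝ}
    (hfK : ∀ u v, |f u - f v| ≤ K * |u - v|) (hfB : ∀ z, |f z| ≤ B) (hf0 : f 0 = 0)
    (hdK : ∀ u v, |d u - d v| ≤ 1 * |u - v|)
    (hx : x ∈ regSet g) (hy : y ∈ regSet g) (hxy : |x - y| ≤ N * ε) (hp : |p| ≤ 4 * K)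
    (hε : 0 < ε) (hε1 : ε ≤ 1) (hεα : ε ^ 2 ≤ α) (hκ : κ ≤ 1) (hq1 : q < 1)
    (hfd : ∀ z, f z ≤ p * z + z ^ 2 / ε + d z) (hdq : ∀ z, d z ≤ 2 * q * x * z + q * z ^ 2)
    (hdε : ∀ z, d z ≤ ε * |z|)
    (hdl : ∀ z, d z ≤ 2 * κ * Real.log (1 + |z| / √(ε⁻¹ ^ 2 + x ^ 2)) /
      Real.log (ε⁻¹ ^ 2 + x ^ 2))
    (hl0 : ∀ z, 0 ≤ 2 * κ * Real.log (1 + |z| / √(ε⁻¹ ^ 2 + x ^ 2)) /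
      Real.log (ε⁻¹ ^ 2 + x ^ 2))
    (hs : |2 * q * x| * (1 + |x| + ε⁻¹) ≤ 6 * κ) (hlog : ε * Real.log (1 + |x|) ≤ κ)
    (hNK : 5 * K + 8 ≤ N) (hNB : 2 * B + 2 ≤ N) :
    ∃ θ₁ θ₂ : ℝ → ℝ, C2b θ₁ ∧ C2b θ₂ ∧ HasDerivAt θ₁ (p + 2 * q * x) 0 ∧ HasDerivAt θ₂ p 0 ∧
      (∀ z, z ≠ 0 → f z < θ₁ z) ∧
      (∀ z, z ≠ 0 → θ₂ z < max (f z - min (max (d z) 0) B) (p * z - z ^ 2 / ε)) ∧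
      CloseProfiles g α N κ ε x y p (p + 2 * q * x) θ₁ θ₂ := by
  have hB : 0 ≤ B := (abs_nonneg _).trans (hfB 0)
  have hK : 0 ≤ K := by simpa using (abs_nonneg _).trans (hfK 1 0)
  have hb : 0 < ε ^ 2 / 2 := by positivity
  have hεi : 0 < ε⁻¹ := by positivity
  have hbα : ε ^ 2 / 2 ≤ α := by linarith
  set D : ℝ → ℝ := fun z => min (max (d z) 0) B with hD
  have hD0 : ∀ z, 0 ≤ D z := fun z => le_min (le_max_right _ _) hB
  have hDB : ∀ z, D z ≤ B := fun z => min_le_right _ _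
  have hDε : ∀ z, D z ≤ ε * |z| := fun z =>
    (min_le_left _ _).trans (max_le (hdε z) (by positivity))
  have hDK : ∀ u v, |D u - D v| ≤ 1 * |u - v| := fun u v => by
    refine le_trans ?_ (hdK u v)
    have h1 := abs_min_sub_min_le_max (max (d u) 0) B (max (d v) 0) B
    rw [sub_self, abs_zero, max_eq_left (abs_nonneg (max (d u) 0 - max (d v) 0))] at h1
    exact h1.trans (abs_max_zero_sub_le _ _)
  set τ := min (ε * (ε ^ 2 / 2)) (ε / (1 + tailMass g α x)) with hτ
  have hT := kb.tailMass_nonneg x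
  have hτ0 : 0 < τ := lt_min (by positivity) (by positivity)
  have hτb : τ ≤ ε * (ε ^ 2 / 2) := min_le_left _ _
  have hτT : τ * tailMass g α x ≤ ε := by
    have : τ ≤ ε / (1 + tailMass g α x) := min_le_right _ _
    rw [le_div_iff₀ (by positivity)] at this
    linarith
  have hτ1 : τ ≤ 1 := by
    have : ε * (ε ^ 2 / 2) ≤ 1 * (1 ^ 2 / 2) := by gcongr
    linarith
  obtain ⟨u, hu, hu'⟩ := exists_c2b_above hτ0 hfK hfB
  obtain ⟨v, hv, hv'⟩ := exists_c2b_below (f := fun z => f z - D z) (K := K + 1) (B := B + B) hτ0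
    (fun s t => by
      have : f s - D s - (f t - D t) = (f s - f t) - (D s - D t) := by ring
      rw [this]
      linarith [abs_sub (f s - f t) (D s - D t), hfK s t, hDK s t])
    (fun z => by
      have := abs_sub (f z) (D z)
      rw [abs_of_nonneg (hD0 z)] at this
      linarith [hfB z, hDB z])
  obtain ⟨ζ, h01, hζ1, hζ0, hglue⟩ := exists_glued hb
  obtain ⟨g1, g1'⟩ := hglue u hu (p + 2 * q * x) (ε⁻¹ + 1)
  obtain ⟨g2, g2'⟩ := hglue v hv p (-(ε⁻¹ + 1))
  have hs6 : |2 * q * x| ≤ 6 * κ * ε := by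
    have : |2 * q * x| * ε⁻¹ ≤ 6 * κ :=
      (mul_le_mul_of_nonneg_left (by linarith [abs_nonneg x]) (abs_nonneg _)).trans hs
    rwa [← div_eq_mul_inv, div_le_iff₀ hε] at this
  have hκ0 : 0 ≤ κ := by
    have : 0 ≤ |2 * q * x| * (1 + |x| + ε⁻¹) := by positivity
    linarith
  have hs7 : |2 * q * x| ≤ 6 * ε := hs6.trans (by
    have := mul_le_mul_of_nonneg_right hκ hε.le
    linarith)
  have hfz : ∀ z, |f z| ≤ K * |z| := fun z => by simpa [hf0] using hfK z 0
  have hquad : ∀ z, |z| ≤ ε ^ 2 → (ε⁻¹ + 1) * z ^ 2 ≤ 2 * ε * |z| := fun z hz => by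
    rw [← sq_abs z]
    calc (ε⁻¹ + 1) * |z| ^ 2 = (ε⁻¹ + 1) * |z| * |z| := by ring
      _ ≤ (ε⁻¹ + 1) * ε ^ 2 * |z| := by gcongr
      _ = (ε + ε * ε) * |z| := by field_simp
      _ ≤ _ := by
        gcongr
        nlinarith
  refine ⟨_, _, g1, g2, g1', g2', fun z hz => ?_, fun z hz => ?_, ?_⟩
  · obtain ⟨s0, s1⟩ := h01 z
    have hz2 : 0 < z ^ 2 := by positivity
    have e1 : f z < (p + 2 * q * x) * z + (ε⁻¹ + 1) * z ^ 2 := by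
      have := hfd z
      have := hdq z
      have : q * z ^ 2 < 1 * z ^ 2 := by gcongr
      have : z ^ 2 / ε = ε⁻¹ * z ^ 2 := by ring
      linarith
    have e2 := (hu' z).1
    rcases s0.eq_or_lt with h | h
    · rw [← h]; linarith
    · nlinarith
  · obtain ⟨s0, s1⟩ := h01 z
    have hz2 : 0 < z ^ 2 := by positivity
    have e1 : p * z + -(ε⁻¹ + 1) * z ^ 2 < max (f z - D z) (p * z - z ^ 2 / ε) := by
      refine lt_of_lt_of_le ?_ (le_max_right _ _)
      have : z ^ 2 / ε = ε⁻¹ * z ^ 2 := by ring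
      linarith
    have e2 : v z < max (f z - D z) (p * z - z ^ 2 / ε) := (hv' z).2.trans_le (le_max_left _ _)
    rcases s0.eq_or_lt with h | h
    · rw [← h]; linarith
    · nlinarith
  have hdiff : ∀ z, u z - v z ≤ D z + 4 * τ := fun z => by linarith [(hu' z).2, (hv' z).1]
  have hmid1 : ∀ z, ε ^ 2 / 2 ≤ |z| → |u z - (p + 2 * q * x) * z| ≤ N * |z| := fun z hz => by
    have e1 : |u z - (p + 2 * q * x) * z| ≤ |f z| + 2 * τ + |(p + 2 * q * x) * z| := by
      refine (abs_sub _ _).trans (add_le_add ?_ le_rfl)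
      have := abs_le.1 (le_refl |f z|)
      exact abs_le.2 ⟨by linarith [(hu' z).1], by linarith [(hu' z).2]⟩
    have e2 : |(p + 2 * q * x) * z| ≤ (4 * K + 6) * |z| := by
      rw [abs_mul]
      gcongr
      linarith [abs_add_le p (2 * q * x)]
    have e3 : τ ≤ 1 * |z| := hτb.trans (by gcongr)
    have e4 := mul_le_mul_of_nonneg_right hNK (abs_nonneg z)
    linarith [hfz z]
  have hmid2 : ∀ z, ε ^ 2 / 2 ≤ |z| → |v z - p * z| ≤ N * |z| := fun z hz => by
    have e1 : |v z - p * z| ≤ |f z| + D z + 2 * τ + |p * z| := by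
      refine (abs_sub _ _).trans (add_le_add ?_ le_rfl)
      have := abs_le.1 (le_refl |f z|)
      have := hD0 z
      exact abs_le.2 ⟨by linarith [(hv' z).1], by linarith [(hv' z).2]⟩
    have e2 : |p * z| ≤ 4 * K * |z| := by
      rw [abs_mul]
      gcongr
    have e3 : τ ≤ 1 * |z| := hτb.trans (by gcongr)
    have e4 := mul_le_mul_of_nonneg_right hNK (abs_nonneg z)
    have e5 : D z ≤ 1 * |z| := (hDε z).trans (by gcongr)
    linarith [hfz z, abs_nonneg z]
  have hquadN : ∀ z, |z| ≤ ε ^ 2 → (ε⁻¹ + 1) * z ^ 2 ≤ N * |z| := fun z hz => by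
    refine (hquad z hz).trans ?_
    gcongr
    linarith
  have hzero : ∀ z, α ≤ |z| → ζ z = 0 := fun z hz => hζ0 z (by linarith)
  have hq2 : ∀ z : ℝ, 0 ≤ (ε⁻¹ + 1) * z ^ 2 := fun z => by positivity
  refine ⟨hx, hy, hxy, by linarith, by rwa [add_sub_cancel_left], hlog, ⟨?_, ?_, ?_, ?_⟩,
    ⟨?_, ?_, ?_, ?_⟩, fun z hz hzα => ?_, ⟨D, τ, hτ0.le, hτT, fun z hz => ⟨?_, hD0 z, ?_, ?_⟩⟩⟩
  · exact g1.continuous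
  · intro z hz
    rw [hζ1 z hz.le]
    refine le_of_eq ?_
    rw [show 1 * ((p + 2 * q * x) * z + (ε⁻¹ + 1) * z ^ 2) + (1 - 1) * u z -
      (p + 2 * q * x) * z = (ε⁻¹ + 1) * z ^ 2 by ring, abs_of_nonneg (hq2 z)]
  · intro z hz _
    rcases le_total (2 * (ε ^ 2 / 2)) |z| with hh | hh
    · rw [hζ0 z hh]
      simpa using hmid1 z hz
    · rw [show ζ z * ((p + 2 * q * x) * z + (ε⁻¹ + 1) * z ^ 2) + (1 - ζ z) * u z -
        (p + 2 * q * x) * z = ζ z * ((ε⁻¹ + 1) * z ^ 2) +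
        (1 - ζ z) * (u z - (p + 2 * q * x) * z) by ring]
      refine abs_convex_comb_le (h01 z).1 (h01 z).2 ?_ (hmid1 z hz)
      rw [abs_of_nonneg (hq2 z)]
      exact hquadN z (by linarith)
  · intro z hz
    rw [hzero z hz]
    have := abs_le.1 (hfB z)
    exact abs_le.2 ⟨by linarith [(hu' z).1], by linarith [(hu' z).2]⟩
  · exact g2.continuous
  · intro z hz
    rw [hζ1 z hz.le]
    refine le_of_eq ?_
    rw [show 1 * (p * z + -(ε⁻¹ + 1) * z ^ 2) + (1 - 1) * v z -
      p * z = -((ε⁻¹ + 1) * z ^ 2) by ring, abs_neg, abs_of_nonneg (hq2 z)]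
  · intro z hz _
    rcases le_total (2 * (ε ^ 2 / 2)) |z| with hh | hh
    · rw [hζ0 z hh]
      simpa using hmid2 z hz
    · rw [show ζ z * (p * z + -(ε⁻¹ + 1) * z ^ 2) + (1 - ζ z) * v z -
        p * z = ζ z * -((ε⁻¹ + 1) * z ^ 2) + (1 - ζ z) * (v z - p * z) by ring]
      refine abs_convex_comb_le (h01 z).1 (h01 z).2 ?_ (hmid2 z hz)
      rw [abs_neg, abs_of_nonneg (hq2 z)]
      exact hquadN z (by linarith)
  · intro z hz
    rw [hzero z hz]
    have := abs_le.1 (hfB z)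
    have := hD0 z
    have := hDB z
    exact abs_le.2 ⟨by linarith [(hv' z).1], by linarith [(hv' z).2]⟩
  · have e1 : τ ≤ ε * |z| := hτb.trans (by gcongr)
    have e2 : u z - v z ≤ 12 * ε * |z| := by
      have := hdiff z
      have := hDε z
      have : 0 ≤ ε * |z| := by positivity
      linarith
    rcases le_total (2 * (ε ^ 2 / 2)) |z| with hh | hh
    · rw [hζ0 z hh]
      simpa using e2
    · have e3 := hquad z (by linarith)
      have e4 : 2 * q * x * z ≤ 6 * ε * |z| := by
        refine (le_abs_self _).trans ?_
        rw [abs_mul]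
        gcongr
      have e5 : 2 * q * x * z + 2 * ((ε⁻¹ + 1) * z ^ 2) ≤ 12 * ε * |z| := by linarith
      obtain ⟨s0, s1⟩ := h01 z
      have e6 := mul_le_mul_of_nonneg_left e5 s0
      have e7 := mul_le_mul_of_nonneg_left e2 (sub_nonneg.2 s1)
      calc _ = ζ z * (2 * q * x * z + 2 * ((ε⁻¹ + 1) * z ^ 2)) + (1 - ζ z) * (u z - v z) := by ring
        _ ≤ ζ z * (12 * ε * |z|) + (1 - ζ z) * (12 * ε * |z|) := add_le_add e6 e7
        _ = _ := by ring
  · rw [hzero z hz]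
    linarith [hdiff z]
  · exact le_min (hDε z) ((hDB z).trans (by linarith))
  · exact (min_le_left _ _).trans (max_le (hdl z) (hl0 z))
end

/-- A slowly growing penalisation `Ψ` with local quadratic upper expansions of size `q`. -/
structure Barrier (κ ε m : ℝ) (Ψ q : ℝ → ℝ) : Prop where
  zero : Ψ 0 = 0
  nonneg : ∀ x, 0 ≤ Ψ x
  log_le : ∀ x, Ψ x ≤ m → ε * Real.log (1 + |x|) ≤ κ
  lt_one : ∀ x, q x < 1
  slope : ∀ x, |2 * q x * x| * (1 + |x| + ε⁻¹) ≤ 6 * κ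
  quad : ∀ x z, Ψ (x + z) - Ψ x ≤ 2 * q x * x * z + q x * z ^ 2
  lin : ∀ x z, Ψ (x + z) - Ψ x ≤ ε * |z|
  log : ∀ x z, Ψ (x + z) - Ψ x ≤
    2 * κ * Real.log (1 + |z| / √(ε⁻¹ ^ 2 + x ^ 2)) / Real.log (ε⁻¹ ^ 2 + x ^ 2)
  log_nonneg : ∀ x z, 0 ≤
    2 * κ * Real.log (1 + |z| / √(ε⁻¹ ^ 2 + x ^ 2)) / Real.log (ε⁻¹ ^ 2 + x ^ 2)

theorem Barrier.abs_sub_le {κ ε m : ℝ} {Ψ q : ℝ → ℝ} (h : Barrier κ ε m Ψ q) (x y : ℝ) :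
    |Ψ x - Ψ y| ≤ ε * |x - y| := by
  have h1 := h.lin x (y - x)
  have h2 := h.lin y (x - y)
  rw [add_sub_cancel] at h1 h2
  rw [abs_sub_comm y x] at h1
  exact abs_le.2 ⟨by linarith, h2⟩

theorem Barrier.le_mul_abs {κ ε m : ℝ} {Ψ q : ℝ → ℝ} (h : Barrier κ ε m Ψ q) (x : ℝ) :
    Ψ x ≤ ε * |x| := by
  simpa [h.zero] using h.lin 0 x

set_option maxHeartbeats 1000000 in
theorem exists_barrier {κ ε m : ℝ} (hκ : 0 < κ) (hκ1 : κ ≤ 1) (hε : 0 < ε)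
    (he : Real.exp 1 ≤ ε⁻¹) (hm : 2 * Real.exp (m / κ) * (ε * Real.log ε⁻¹) ≤ κ) :
    ∃ Ψ q, Barrier κ ε m Ψ q := by
  set L := ε⁻¹ with hL
  have he2 : 2 ≤ Real.exp 1 := by linarith [Real.add_one_le_exp (1 : ℝ)]
  have hL2 : 2 ≤ L := he2.trans he
  have hεL : ε * L = 1 := mul_inv_cancel₀ hε.ne'
  have hlL : 1 ≤ Real.log L := (Real.le_log_iff_exp_le (by linarith)).2 he
  have hA4 : ∀ x : ℝ, 4 ≤ L ^ 2 + x ^ 2 := fun x => by nlinarith [sq_nonneg x]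
  have hA : ∀ x : ℝ, 0 < L ^ 2 + x ^ 2 := fun x => by linarith [hA4 x]
  have hlA : ∀ x : ℝ, 2 ≤ Real.log (L ^ 2 + x ^ 2) := fun x => by
    have : Real.log (L ^ 2) ≤ Real.log (L ^ 2 + x ^ 2) :=
      Real.log_le_log (by positivity) (by linarith [sq_nonneg x])
    rw [Real.log_pow] at this
    push_cast at this
    linarith
  have hlA0 : ∀ x : ℝ, 0 < Real.log (L ^ 2 + x ^ 2) := fun x => by linarith [hlA x]
  have hll : ∀ x z : ℝ, Real.log (Real.log (L ^ 2 + (x + z) ^ 2)) -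
      Real.log (Real.log (L ^ 2 + x ^ 2)) ≤
      Real.log ((L ^ 2 + (x + z) ^ 2) / (L ^ 2 + x ^ 2)) / Real.log (L ^ 2 + x ^ 2) := fun x z => by
    rw [← Real.log_div (hlA0 _).ne' (hlA0 _).ne', Real.log_div (hA _).ne' (hA _).ne', sub_div,
      div_self (hlA0 x).ne']
    exact Real.log_le_sub_one_of_pos (div_pos (hlA0 _) (hlA0 _))
  have hsq : ∀ x : ℝ, L ≤ √(L ^ 2 + x ^ 2) := fun x => Real.le_sqrt_of_sq_le (by
    linarith [sq_nonneg x])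
  have hsq0 : ∀ x : ℝ, 0 < √(L ^ 2 + x ^ 2) := fun x => by linarith [hsq x]
  have hlog : ∀ x z : ℝ, κ * (Real.log (Real.log (L ^ 2 + (x + z) ^ 2)) -
      Real.log (Real.log (L ^ 2 + x ^ 2))) ≤
      2 * κ * Real.log (1 + |z| / √(L ^ 2 + x ^ 2)) / Real.log (L ^ 2 + x ^ 2) := fun x z => by
    have h1 : (L ^ 2 + (x + z) ^ 2) / (L ^ 2 + x ^ 2) ≤ (1 + |z| / √(L ^ 2 + x ^ 2)) ^ 2 := by
      have h2 : (1 + |z| / √(L ^ 2 + x ^ 2)) ^ 2 =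
          (√(L ^ 2 + x ^ 2) + |z|) ^ 2 / (L ^ 2 + x ^ 2) := by
        rw [one_add_div (hsq0 x).ne', div_pow, Real.sq_sqrt (hA x).le]
      rw [h2]
      refine div_le_div_of_nonneg_right ?_ (hA x).le
      have h3 : |x| ≤ √(L ^ 2 + x ^ 2) := Real.abs_le_sqrt (by nlinarith)
      have h4 := Real.sq_sqrt (hA x).le
      have h5 : x * z ≤ √(L ^ 2 + x ^ 2) * |z| := (le_abs_self _).trans (by
        rw [abs_mul]; gcongr)
      nlinarith [sq_abs z]
    have h2 := Real.log_le_log (div_pos (hA _) (hA _)) h1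
    rw [Real.log_pow] at h2
    push_cast at h2
    have h3 := (hll x z).trans (div_le_div_of_nonneg_right h2 (hlA0 x).le)
    have h4 := mul_le_mul_of_nonneg_left h3 hκ.le
    refine h4.trans (le_of_eq (by ring))
  have hl1 : ∀ x z : ℝ, 0 ≤ Real.log (1 + |z| / √(L ^ 2 + x ^ 2)) := fun x z =>
    Real.log_nonneg (by
      have := div_nonneg (abs_nonneg z) (hsq0 x).le
      linarith)
  refine ⟨fun x => κ * (Real.log (Real.log (L ^ 2 + x ^ 2)) - Real.log (Real.log (L ^ 2 + 0 ^ 2))),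
    fun x => κ / ((L ^ 2 + x ^ 2) * Real.log (L ^ 2 + x ^ 2)), ?_, ?_, ?_, ?_, ?_, ?_, ?_, ?_, ?_⟩
  · simp
  · intro x
    refine mul_nonneg hκ.le (sub_nonneg.2 (Real.log_le_log (hlA0 0) (Real.log_le_log (hA 0) ?_)))
    nlinarith [sq_nonneg x]
  · intro x hx
    have h1 : Real.log (Real.log (L ^ 2 + x ^ 2)) ≤
        m / κ + Real.log (Real.log (L ^ 2 + 0 ^ 2)) := by
      have := (le_div_iff₀' hκ).2 hx
      linarith
    rw [Real.log_le_iff_le_exp (hlA0 x), Real.exp_add, Real.exp_log (hlA0 0)] at h1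
    have h2 : Real.log (1 + |x|) ≤ Real.log (L ^ 2 + x ^ 2) := by
      refine Real.log_le_log (by positivity) ?_
      nlinarith [sq_abs x, sq_nonneg (|x| - 1)]
    have h3 : Real.log (L ^ 2 + 0 ^ 2) = 2 * Real.log L := by
      rw [zero_pow two_ne_zero, add_zero, Real.log_pow]; norm_num
    rw [h3] at h1
    have := mul_le_mul_of_nonneg_left (h2.trans h1) hε.le
    refine this.trans (le_trans (le_of_eq (by ring)) hm)
  · intro x
    rw [div_lt_one (mul_pos (hA x) (hlA0 x))]
    nlinarith [hA4 x, hlA x]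
  · intro x
    have hq : 0 ≤ κ / ((L ^ 2 + x ^ 2) * Real.log (L ^ 2 + x ^ 2)) :=
      div_nonneg hκ.le (mul_pos (hA x) (hlA0 x)).le
    rw [abs_mul, abs_mul, abs_of_nonneg hq, abs_two]
    have h1 : |x| * (1 + |x| + L) ≤ 2 * (L ^ 2 + x ^ 2) := by
      nlinarith [sq_abs x, abs_nonneg x, sq_nonneg (|x| - L)]
    have h2 : 2 * (L ^ 2 + x ^ 2) ≤ (L ^ 2 + x ^ 2) * Real.log (L ^ 2 + x ^ 2) := by
      nlinarith [hlA x, hA x]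
    have h3 : κ / ((L ^ 2 + x ^ 2) * Real.log (L ^ 2 + x ^ 2)) * (|x| * (1 + |x| + L)) ≤ κ := by
      rw [div_mul_eq_mul_div, div_le_iff₀ (mul_pos (hA x) (hlA0 x))]
      exact mul_le_mul_of_nonneg_left (h1.trans h2) hκ.le
    linarith
  · intro x z
    have h1 := Real.log_le_sub_one_of_pos (div_pos (hA (x + z)) (hA x))
    have h2 := (hll x z).trans (div_le_div_of_nonneg_right h1 (hlA0 x).le)
    have h3 := mul_le_mul_of_nonneg_left h2 hκ.le
    have h4 : κ * (((L ^ 2 + (x + z) ^ 2) / (L ^ 2 + x ^ 2) - 1) / Real.log (L ^ 2 + x ^ 2)) =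
        2 * (κ / ((L ^ 2 + x ^ 2) * Real.log (L ^ 2 + x ^ 2))) * x * z +
        κ / ((L ^ 2 + x ^ 2) * Real.log (L ^ 2 + x ^ 2)) * z ^ 2 := by
      have := (hA x).ne'
      have := (hlA0 x).ne'
      field_simp
      ring
    linarith
  · intro x z
    have h1 : Real.log (1 + |z| / √(L ^ 2 + x ^ 2)) ≤ ε * |z| := by
      have h2 := Real.log_le_sub_one_of_pos (show 0 < 1 + |z| / √(L ^ 2 + x ^ 2) by
        have := div_nonneg (abs_nonneg z) (hsq0 x).le
        linarith)
      have h3 : |z| / √(L ^ 2 + x ^ 2) ≤ |z| / L :=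
        div_le_div_of_nonneg_left (abs_nonneg z) (by linarith) (hsq x)
      have h4 : |z| / L = ε * |z| := by rw [hL, div_inv_eq_mul, mul_comm]
      linarith
    have h2 : 2 * κ * Real.log (1 + |z| / √(L ^ 2 + x ^ 2)) / Real.log (L ^ 2 + x ^ 2) ≤
        ε * |z| := by
      rw [div_le_iff₀ (hlA0 x)]
      have h5 : 0 ≤ ε * |z| := by positivity
      have h6 := mul_le_mul hκ1 h1 (hl1 x z) zero_le_one
      nlinarith [hlA x]
    have := hlog x z
    linarith
  · intro x z
    have := hlog x z
    linarith
  · intro x z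
    exact div_nonneg (mul_nonneg (by positivity) (hl1 x z)) (hlA0 x).le

theorem eventually_exists_barrier {κ : ℝ} (hκ : 0 < κ) (hκ1 : κ ≤ 1) (m : ℝ) :
    ∀ᶠ ε in 𝓝[>] (0 : ℝ), ∃ Ψ q, Barrier κ ε m Ψ q := by
  have h1 : Tendsto (fun ε : ℝ => 2 * Real.exp (m / κ) * (ε * Real.log ε⁻¹)) (𝓝[>] 0)
      (𝓝 (2 * Real.exp (m / κ) * 0)) := by
    refine Tendsto.const_mul _ ?_
    have : Tendsto (fun ε : ℝ => -(ε * Real.log ε)) (𝓝[>] 0) (𝓝 (-(0 * Real.log 0))) :=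
      (Real.continuous_mul_log.neg.tendsto 0).mono_left nhdsWithin_le_nhds
    rw [zero_mul, neg_zero] at this
    refine this.congr fun ε => ?_
    rw [Real.log_inv]; ring
  rw [mul_zero] at h1
  filter_upwards [self_mem_nhdsWithin, tendsto_inv_nhdsGT_zero.eventually_ge_atTop (Real.exp 1),
    h1.eventually_le_const hκ] with ε h2 h3 h4
  exact exists_barrier hκ hκ1 h2 h3 h4

theorem exists_sup_lipschitz {T b K : ℝ} (hT : 0 ≤ T) {G : ℝ → ℝ → ℝ}
    (hb : ∀ t ∈ Icc 0 T, ∀ x, G t x ≤ b)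
    (hK : ∀ t ∈ Icc 0 T, ∀ x y, |G t x - G t y| ≤ K * |x - y|) :
    ∃ H : ℝ → ℝ, (∀ t ∈ Icc 0 T, ∀ x, G t x ≤ H x) ∧
      (∀ x c, (∀ t ∈ Icc 0 T, G t x ≤ c) → H x ≤ c) ∧ ∀ x y, |H x - H y| ≤ K * |x - y| := by
  have h1 : ∀ t ∈ Icc 0 T, ∀ x, G t x ≤ ⨆ t : Icc (0 : ℝ) T, G t x := fun t ht x =>
    le_ciSup (f := fun t : Icc (0 : ℝ) T => G t x) ⟨b, by rintro _ ⟨s, rfl⟩; exact hb s s.2 x⟩ ⟨t, ht⟩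
  have h2 : ∀ x c, (∀ t ∈ Icc 0 T, G t x ≤ c) → ⨆ t : Icc (0 : ℝ) T, G t x ≤ c := fun x c h => by
    have : Nonempty (Icc (0 : ℝ) T) := ⟨⟨0, left_mem_Icc.2 hT⟩⟩
    exact ciSup_le fun t => h t t.2
  refine ⟨fun x => ⨆ t : Icc (0 : ℝ) T, G t x, h1, h2, ?_⟩
  have h3 : ∀ x y, (⨆ t : Icc (0 : ℝ) T, G t x) ≤ (⨆ t : Icc (0 : ℝ) T, G t y) + K * |x - y| :=
    fun x y => h2 x _ fun t ht => by linarith [h1 t ht y, (abs_le.1 (hK t ht x y)).2]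
  intro x y
  have := h3 y x
  rw [abs_sub_comm y x] at this
  exact abs_le.2 ⟨by linarith, by linarith [h3 x y]⟩

section
variable {g : ℝ → ℝ → ℝ} {C α N κ ε : ℝ}

set_option maxHeartbeats 1000000 in
/-- At a doubled maximum point inside the regular set, the two viscosity inequalities produce a
close pair of profiles violating the monotonicity of the operator by `η`. -/
theorem KernelBd.exists_closeProfiles_of_max (kb : KernelBd g C α) {Op : (ℝ → ℝ) → ℝ → ℝ}
    {F₁ F₂ : ℝ → ℝ → ℝ} {M K T η δ ρ m t s x y : ℝ} {Ψ q : ℝ → ℝ}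
    (hsub : IsSubsolution Op F₁) (hsup : IsSupersolution Op F₂)
    (hM₁ : ∀ t x, 0 ≤ t → |F₁ t x| ≤ M) (hM₂ : ∀ t x, 0 ≤ t → |F₂ t x| ≤ M)
    (hK : ∀ t ∈ Icc 0 T, ∀ x y, |F₁ t x - F₁ t y| ≤ K * |x - y|)
    (hΨ : Barrier κ ε m Ψ q) (hΨx : Ψ x ≤ m) (hη : 0 < η) (hδ : 0 < δ) (hκ : κ ≤ 1)
    (hε : 0 < ε) (hε1 : ε ≤ 1) (hεα : ε ^ 2 ≤ α)
    (hx : x ∈ regSet g) (hy : y ∈ regSet g) (hxy : |x - y| ≤ N * ε)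
    (hp : |2 * (x - y + ρ) / ε| ≤ 4 * K) (hNK : 5 * K + 8 ≤ N) (hNM : 16 * M + 2 ≤ N)
    (ht : 0 < t) (htT : t + 1 ≤ T) (hηt : η * t ≤ 2 * M) (hs : 0 < s)
    (hts : (t - s) ^ 2 / δ ≤ 2 * M)
    (hmax : ∀ t' s' x' y', 0 ≤ t' → 0 ≤ s' →
      F₁ t' x' - F₂ s' y' - η * t' - (t' - s') ^ 2 / δ - (x' - y' + ρ) ^ 2 / ε - Ψ x' ≤
      F₁ t x - F₂ s y - η * t - (t - s) ^ 2 / δ - (x - y + ρ) ^ 2 / ε - Ψ x) :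
    ∃ p p₁ θ₁ θ₂, CloseProfiles g α N κ ε x y p p₁ θ₁ θ₂ ∧
      max p₁ 0 * Op (fun u => θ₁ (u - x)) x - max p 0 * Op (fun u => θ₂ (u - y)) y ≤ -η := by
  have hM : 0 ≤ M := (abs_nonneg _).trans (hM₁ 0 0 le_rfl)
  set p := 2 * (x - y + ρ) / ε with hpdef
  set w₁ : ℝ → ℝ := fun t' => η * (t' - t) + (2 * (t - s) * (t' - t) + 2 * (t' - t) ^ 2) / δ
    with hw₁
  set w₂ : ℝ → ℝ := fun s' => (2 * (t - s) * (s' - s) - 2 * (s' - s) ^ 2) / δ with hw₂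
  have hsplit : ∀ t' s' x' y', 0 ≤ t' → 0 ≤ s' → F₁ t' x' - F₂ s' y' ≤
      F₁ t x - F₂ s y + w₁ t' - w₂ s' + ((x' - y' + ρ) ^ 2 - (x - y + ρ) ^ 2) / ε +
        (Ψ x' - Ψ x) := fun t' s' x' y' ht' hs' => by
    have h1 := hmax t' s' x' y' ht' hs'
    have h2 : (t' - s') ^ 2 / δ ≤ (t - s) ^ 2 / δ + (w₁ t' - η * (t' - t)) - w₂ s' := by
      have : (t - s) ^ 2 / δ + (w₁ t' - η * (t' - t)) - w₂ s' =
          ((t - s) ^ 2 + (2 * (t - s) * (t' - t) + 2 * (t' - t) ^ 2) -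
            (2 * (t - s) * (s' - s) - 2 * (s' - s) ^ 2)) / δ := by
        rw [hw₁, hw₂]; ring
      rw [this]
      refine div_le_div_of_nonneg_right ?_ hδ.le
      nlinarith [sq_nonneg ((t' - t) + (s' - s))]
    rw [sub_div]
    linarith
  have hw₁t : w₁ t = 0 := by simp [hw₁]
  have hw₂s : w₂ s = 0 := by simp [hw₂]
  have hw₁l : ∀ t', 0 ≤ t' → -(3 * M) ≤ w₁ t' := fun t' ht' => by
    have h1 : -((t - s) ^ 2 / δ / 2) ≤ (2 * (t - s) * (t' - t) + 2 * (t' - t) ^ 2) / δ := by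
      rw [div_div, mul_comm δ, ← div_div, ← neg_div]
      refine div_le_div_of_nonneg_right ?_ hδ.le
      nlinarith [sq_nonneg ((t - s) + 2 * (t' - t))]
    have h2 : -(2 * M) ≤ η * (t' - t) := by nlinarith [mul_nonneg hη.le ht']
    simp only [hw₁]
    linarith
  have hw₂u : ∀ s', w₂ s' ≤ M := fun s' => by
    have h1 : (2 * (t - s) * (s' - s) - 2 * (s' - s) ^ 2) / δ ≤ (t - s) ^ 2 / δ / 2 := by
      rw [div_div, mul_comm δ, ← div_div]
      refine div_le_div_of_nonneg_right ?_ hδ.le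
      nlinarith [sq_nonneg ((t - s) - 2 * (s' - s))]
    simp only [hw₂]
    linarith
  have ht0 : t ∈ Icc 0 T := ⟨ht.le, by linarith⟩
  obtain ⟨H, hH1, hH2, hH3⟩ := exists_sup_lipschitz (G := fun t' x' => F₁ t' x' - w₁ t')
    (b := 4 * M) (K := K) (by linarith : 0 ≤ T)
    (fun t' ht' x' => by linarith [(abs_le.1 (hM₁ t' x' ht'.1)).2, hw₁l t' ht'.1])
    (fun t' ht' x' y' => by simpa using hK t' ht' x' y')
  have hHx : H x = F₁ t x := by
    refine le_antisymm (hH2 x _ fun t' ht' => ?_) ?_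
    · have := hsplit t' s x y ht'.1 hs.le
      rw [hw₂s] at this
      simp only [sub_self, zero_div] at this
      linarith
    · have := hH1 t ht0 x
      rw [hw₁t] at this
      linarith
  set f : ℝ → ℝ := fun z => H (x + z) - H x with hf
  have hf0 : f 0 = 0 := by simp [hf]
  have hHl : ∀ x', -M ≤ H x' := fun x' => by
    have := hH1 t ht0 x'
    rw [hw₁t] at this
    linarith [(abs_le.1 (hM₁ t x' ht.le)).1]
  have hHu : ∀ x', H x' ≤ 4 * M := fun x' => hH2 x' _ fun t' ht' => by
    linarith [(abs_le.1 (hM₁ t' x' ht'.1)).2, hw₁l t' ht'.1]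
  have hfB : ∀ z, |f z| ≤ 5 * M := fun z => abs_le.2
    ⟨by linarith [hHl (x + z), hHu x], by linarith [hHl x, hHu (x + z)]⟩
  set d : ℝ → ℝ := fun z => Ψ (x + z) - Ψ x with hd
  have hfd : ∀ z, f z ≤ p * z + z ^ 2 / ε + d z := fun z => by
    have : H (x + z) ≤ H x + (p * z + z ^ 2 / ε + d z) := hH2 _ _ fun t' ht' => by
      have := hsplit t' s (x + z) y ht'.1 hs.le
      rw [hw₂s] at this
      have e : ((x + z - y + ρ) ^ 2 - (x - y + ρ) ^ 2) / ε = p * z + z ^ 2 / ε := by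
        rw [hpdef]; ring
      rw [e] at this
      rw [hHx]
      linarith
    linarith
  have hF₂ : ∀ s' z, 0 ≤ s' → F₂ s y + w₂ s' +
      max (f z - min (max (d z) 0) (8 * M)) (p * z - z ^ 2 / ε) ≤ F₂ s' (y + z) := by
    intro s' z hs'
    have h1 : p * z - z ^ 2 / ε ≤ F₂ s' (y + z) - F₂ s y - w₂ s' := by
      have := hsplit t s' x (y + z) ht.le hs'
      rw [hw₁t] at this
      have e : ((x - (y + z) + ρ) ^ 2 - (x - y + ρ) ^ 2) / ε = -(p * z - z ^ 2 / ε) := by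
        rw [hpdef]; ring
      rw [e] at this
      linarith
    have h2 : f z - d z ≤ F₂ s' (y + z) - F₂ s y - w₂ s' := by
      have : H (x + z) ≤ H x + d z + (F₂ s' (y + z) - F₂ s y - w₂ s') := hH2 _ _ fun t' ht' => by
        have := hsplit t' s' (x + z) (y + z) ht'.1 hs'
        have e : ((x + z - (y + z) + ρ) ^ 2 - (x - y + ρ) ^ 2) / ε = 0 := by ring
        rw [e] at this
        rw [hHx]
        linarith
      linarith
    have h3 : f z - 8 * M ≤ F₂ s' (y + z) - F₂ s y - w₂ s' := by
      linarith [(abs_le.1 (hfB z)).2, hw₂u s', (abs_le.1 (hM₂ s' (y + z) hs')).1,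
        (abs_le.1 (hM₂ s y hs.le)).2]
    have h4 : max (f z - min (max (d z) 0) (8 * M)) (p * z - z ^ 2 / ε) ≤
        F₂ s' (y + z) - F₂ s y - w₂ s' := by
      refine max_le ?_ h1
      rcases min_choice (max (d z) 0) (8 * M) with h | h <;> rw [h]
      · linarith [le_max_left (d z) 0]
      · exact h3
    linarith
  obtain ⟨θ₁, θ₂, c₁, c₂, d₁, d₂, u₁, u₂, hθ⟩ := kb.exists_closeProfiles (f := f) (d := d)
    (B := 8 * M) (q := q x)
    (fun u v => by
      have := hH3 (x + u) (x + v)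
      rw [add_sub_add_left_eq_sub] at this
      simpa [hf] using this)
    (fun z => (hfB z).trans (by linarith)) hf0
    (fun u v => by
      have h1 := hΨ.abs_sub_le (x + u) (x + v)
      rw [add_sub_add_left_eq_sub] at h1
      have h2 : d u - d v = Ψ (x + u) - Ψ (x + v) := by simp only [hd]; ring
      rw [h2]
      exact h1.trans (by gcongr))
    hx hy hxy hp hε hε1 hεα hκ (hΨ.lt_one x) hfd (fun z => hΨ.quad x z) (fun z => hΨ.lin x z)
    (fun z => hΨ.log x z) (fun z => hΨ.log_nonneg x z) (hΨ.slope x) (hΨ.log_le x hΨx) hNK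
    (by linarith)
  refine ⟨_, _, θ₁, θ₂, hθ, ?_⟩
  have hθ₁ := hθ.bd_left.apply_zero (by positivity)
  have hθ₂ := hθ.bd_right.apply_zero (by positivity)
  have hlin : ∀ a b c : ℝ, ContDiff ℝ 1 fun t' : ℝ => a * (t' - b) + c * (t' - b) ^ 2 :=
    fun a b c => by fun_prop
  have hder : ∀ a b c : ℝ, deriv (fun t' : ℝ => a * (t' - b) + c * (t' - b) ^ 2) b = a := by
    intro a b c
    have h1 : HasDerivAt (fun t' : ℝ => t' - b) 1 b := (hasDerivAt_id b).sub_const b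
    have h2 := (h1.const_mul a).add ((h1.pow 2).const_mul c)
    exact h2.deriv.trans (by simp)
  have hshift : ∀ (θ : ℝ → ℝ) (r b : ℝ), HasDerivAt θ r 0 →
      deriv (fun u => θ (u - b)) b = r := fun θ r b h => by
    rw [deriv_comp_sub_const, sub_self]
    exact h.deriv
  have A₁ := hsub.2 _ ((c₁.comp_sub x).testFun
    (hlin (η + 2 * (t - s) / δ) t (2 / δ + (10 * M + 1)))) t x ht (by
      intro t' x' ht' hne
      have hw : (η + 2 * (t - s) / δ) * (t' - t) + (2 / δ + (10 * M + 1)) * (t' - t) ^ 2 =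
          w₁ t' + (10 * M + 1) * (t' - t) ^ 2 := by rw [hw₁]; ring
      simp only [sub_self, hθ₁, mul_zero, ne_eq, OfNat.ofNat_ne_zero, not_false_eq_true, zero_pow,
        add_zero, sub_zero]
      rw [hw]
      have hfe : f (x' - x) = H x' - H x := by simp [hf]
      have hle : f (x' - x) ≤ θ₁ (x' - x) := by
        rcases eq_or_ne (x' - x) 0 with h | h
        · rw [h, hf0, hθ₁]
        · exact (u₁ _ h).le
      rcases le_total t' T with hT | hT
      · have h1 := hH1 t' ⟨ht', hT⟩ x'
        have h2 : 0 ≤ (10 * M + 1) * (t' - t) ^ 2 := by positivity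
        by_cases hxx : x' = x
        · have h3 : t' ≠ t := fun h => hne (by rw [h, hxx])
          have h4 : 0 < (10 * M + 1) * (t' - t) ^ 2 := by
            have := sub_ne_zero.2 h3
            positivity
          rw [← hHx]
          linarith
        · have h3 := u₁ _ (sub_ne_zero.2 hxx)
          rw [← hHx]
          linarith
      · have h1 : (10 * M + 1) * 1 ≤ (10 * M + 1) * (t' - t) ^ 2 :=
          mul_le_mul_of_nonneg_left (by nlinarith) (by positivity)
        linarith [(abs_le.1 (hM₁ t' x' ht')).2, hw₁l t' ht', (abs_le.1 (hM₁ t x ht.le)).1,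
          (abs_le.1 (hfB (x' - x))).1])
  have A₂ := hsup.2 _ ((c₂.comp_sub y).testFun
    (hlin (2 * (t - s) / δ) s (-(2 / δ) - 1))) s y hs (by
      intro s' y' hs' hne
      have hw : (2 * (t - s) / δ) * (s' - s) + (-(2 / δ) - 1) * (s' - s) ^ 2 =
          w₂ s' - (s' - s) ^ 2 := by rw [hw₂]; ring
      simp only [sub_self, hθ₂, mul_zero, ne_eq, OfNat.ofNat_ne_zero, not_false_eq_true, zero_pow,
        add_zero, sub_zero]
      rw [hw]
      have h1 := hF₂ s' (y' - y) hs'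
      rw [add_sub_cancel] at h1
      by_cases hyy : y' = y
      · have h3 : s' ≠ s := fun h => hne (by rw [h, hyy])
        have h4 : 0 < (s' - s) ^ 2 := by
          have := sub_ne_zero.2 h3
          positivity
        have h5 := le_max_right (f (y' - y) - min (max (d (y' - y)) 0) (8 * M))
          (p * (y' - y) - (y' - y) ^ 2 / ε)
        have h6 : p * (y' - y) - (y' - y) ^ 2 / ε = 0 := by rw [hyy]; simp
        have h7 : θ₂ (y' - y) = 0 := by rw [hyy, sub_self, hθ₂]
        linarith
      · have h3 := u₂ _ (sub_ne_zero.2 hyy)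
        have := sq_nonneg (s' - s)
        linarith)
  simp only [sub_self, hθ₁, hθ₂, zero_add, mul_zero, ne_eq, OfNat.ofNat_ne_zero,
    not_false_eq_true, zero_pow, add_zero, hder, hshift _ _ _ d₁, hshift _ _ _ d₂] at A₁ A₂
  linarith
end

theorem UpperSemicontinuousOn.extend_time {F : ℝ → ℝ → ℝ}
    (h : UpperSemicontinuousOn (fun p : ℝ × ℝ => F p.1 p.2) (Ici 0 ×ˢ univ)) :
    UpperSemicontinuous fun p : ℝ × ℝ => F (max p.1 0) p.2 := by
  have hc : Continuous fun p : ℝ × ℝ => (max p.1 0, p.2) := by fun_prop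
  have hm : MapsTo (fun p : ℝ × ℝ => (max p.1 0, p.2)) univ (Ici (0 : ℝ) ×ˢ univ) :=
    fun p _ => ⟨mem_Ici.2 (le_max_right _ _), mem_univ _⟩
  exact upperSemicontinuousOn_univ_iff.1 (h.comp hc.continuousOn hm)

set_option maxHeartbeats 1000000 in
/-- Doubling of variables: for a small time penalisation the maximum exists and has positive
times. -/
theorem exists_doubled_max {F₁ F₂ : ℝ → ℝ → ℝ} {M η σ ρ ε R t₁ x₁ y₁ : ℝ} {Ψ : ℝ → ℝ}
    (h₁ : UpperSemicontinuousOn (fun p : ℝ × ℝ => F₁ p.1 p.2) (Ici 0 ×ˢ univ))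
    (h₂ : UpperSemicontinuousOn (fun p : ℝ × ℝ => -F₂ p.1 p.2) (Ici 0 ×ˢ univ))
    (hM₁ : ∀ t x, 0 ≤ t → |F₁ t x| ≤ M) (hM₂ : ∀ t x, 0 ≤ t → |F₂ t x| ≤ M)
    (hη : 0 < η) (hσ : 0 < σ) (hε : 0 < ε) (hε1 : ε ≤ 1) (hΨc : Continuous Ψ) (hΨ : ∀ x, 0 ≤ Ψ x)
    (hR : ∀ x, Ψ x ≤ 2 * M → |x| ≤ R)
    (h0 : ∀ x y, F₁ 0 x - F₂ 0 y - (x - y + ρ) ^ 2 / ε < σ) (ht₁ : 0 ≤ t₁)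
    (hv : σ ≤ F₁ t₁ x₁ - F₂ t₁ y₁ - η * t₁ - (x₁ - y₁ + ρ) ^ 2 / ε - Ψ x₁) :
    ∃ δ t s x y, 0 < δ ∧ 0 < t ∧ 0 < s ∧
      σ ≤ F₁ t x - F₂ s y - η * t - (t - s) ^ 2 / δ - (x - y + ρ) ^ 2 / ε - Ψ x ∧
      ∀ t' s' x' y', 0 ≤ t' → 0 ≤ s' →
      F₁ t' x' - F₂ s' y' - η * t' - (t' - s') ^ 2 / δ - (x' - y' + ρ) ^ 2 / ε - Ψ x' ≤
      F₁ t x - F₂ s y - η * t - (t - s) ^ 2 / δ - (x - y + ρ) ^ 2 / ε - Ψ x := by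
  have hM : 0 ≤ M := (abs_nonneg _).trans (hM₁ 0 0 le_rfl)
  have hdiff : ∀ t s x y, 0 ≤ t → 0 ≤ s → F₁ t x - F₂ s y ≤ 2 * M := fun t s x y ht hs => by
    linarith [(abs_le.1 (hM₁ t x ht)).2, (abs_le.1 (hM₂ s y hs)).1]
  have hG : UpperSemicontinuous fun v : (ℝ × ℝ) × ℝ × ℝ =>
      F₁ (max v.1.1 0) v.2.1 + -F₂ (max v.1.2 0) v.2.2 := by
    have e1 := h₁.extend_time.comp
      (by fun_prop : Continuous fun v : (ℝ × ℝ) × ℝ × ℝ => (v.1.1, v.2.1))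
    have e2 := UpperSemicontinuousOn.extend_time (F := fun t x => -F₂ t x) h₂ |>.comp
      (by fun_prop : Continuous fun v : (ℝ × ℝ) × ℝ × ℝ => (v.1.2, v.2.2))
    exact e1.add e2
  set R' := R + |ρ| + 2 * M + 1 with hR'
  have hbox : ∀ x y, Ψ x ≤ 2 * M → (x - y + ρ) ^ 2 / ε ≤ 2 * M →
      (x, y) ∈ Icc (-R') R' ×ˢ Icc (-R') R' := fun x y hx hxy => by
    have h1 := abs_le.1 (hR x hx)
    have h2 : |x - y + ρ| ≤ 2 * M + 1 := by
      rw [div_le_iff₀ hε] at hxy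
      refine abs_le_of_sq_le_sq ?_ (by linarith)
      nlinarith
    have h3 := abs_le.1 h2
    have h4 := abs_le.1 (le_refl |ρ|)
    refine ⟨⟨?_, ?_⟩, ?_, ?_⟩ <;> simp only <;> linarith [abs_nonneg ρ]
  have hKc : IsCompact (Icc (-R') R' ×ˢ Icc (-R') R') := isCompact_Icc.prod isCompact_Icc
  have hev : ∀ᶠ τ : ℝ × ℝ in 𝓝 (0, 0), ∀ v ∈ Icc (-R') R' ×ˢ Icc (-R') R',
      F₁ (max τ.1 0) v.1 + -F₂ (max τ.2 0) v.2 + -((v.1 - v.2 + ρ) ^ 2 / ε) < σ := by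
    refine hKc.eventually_forall_of_forall_eventually
      (P := fun (τ : ℝ × ℝ) (v : ℝ × ℝ) => F₁ (max τ.1 0) v.1 + -F₂ (max τ.2 0) v.2 + -((v.1 - v.2 + ρ) ^ 2 / ε) < σ)
      fun v _ => ?_
    have hc : Continuous fun v : (ℝ × ℝ) × ℝ × ℝ => -((v.2.1 - v.2.2 + ρ) ^ 2 / ε) := by
      fun_prop
    refine hG.add hc.upperSemicontinuous ((0, 0), v) σ ?_
    have := h0 v.1 v.2
    simp only [max_self]
    linarith
  obtain ⟨r, hr, hr'⟩ := Metric.eventually_nhds_iff.1 hev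
  have hclose : ∀ t s x y, 0 ≤ t → 0 ≤ s → t < r → s < r → Ψ x ≤ 2 * M →
      (x - y + ρ) ^ 2 / ε ≤ 2 * M → F₁ t x - F₂ s y - (x - y + ρ) ^ 2 / ε < σ := by
    intro t s x y ht hs htr hsr hx hxy
    have := hr' (y := (t, s)) (by
      rw [Prod.dist_eq]
      simpa [Real.dist_eq, abs_of_nonneg ht, abs_of_nonneg hs] using ⟨htr, hsr⟩) (x, y)
      (hbox x y hx hxy)
    simp only [max_eq_left ht, max_eq_left hs] at this
    linarith
  set δ := min 1 (r ^ 2 / (2 * M + 1)) with hδ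
  have hδ0 : 0 < δ := lt_min one_pos (by positivity)
  have hδ1 : δ ≤ 1 := min_le_left _ _
  have hδr : 2 * M * δ < r ^ 2 := by
    have : δ ≤ r ^ 2 / (2 * M + 1) := min_le_right _ _
    rw [le_div_iff₀ (by positivity)] at this
    linarith
  set Φ : (ℝ × ℝ) × ℝ × ℝ → ℝ := fun v => F₁ v.1.1 v.2.1 - F₂ v.1.2 v.2.2 - η * v.1.1 -
    (v.1.1 - v.1.2) ^ 2 / δ - (v.2.1 - v.2.2 + ρ) ^ 2 / ε - Ψ v.2.1 with hΦ
  have hpos : ∀ t s x y, 0 ≤ t → 0 ≤ s → σ ≤ Φ ((t, s), (x, y)) →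
      η * t ≤ 2 * M ∧ (t - s) ^ 2 / δ ≤ 2 * M ∧ (x - y + ρ) ^ 2 / ε ≤ 2 * M ∧ Ψ x ≤ 2 * M ∧
      σ ≤ F₁ t x - F₂ s y - (x - y + ρ) ^ 2 / ε := by
    intro t s x y ht hs h
    simp only [hΦ] at h
    have e1 := hdiff t s x y ht hs
    have e2 : 0 ≤ η * t := by positivity
    have e3 : 0 ≤ (t - s) ^ 2 / δ := by positivity
    have e4 : 0 ≤ (x - y + ρ) ^ 2 / ε := by positivity
    have e5 := hΨ x
    refine ⟨?_, ?_, ?_, ?_, ?_⟩ <;> linarith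
  set S : Set ((ℝ × ℝ) × ℝ × ℝ) := (Icc 0 (2 * M / η) ×ˢ Icc 0 (2 * M / η + 2 * M + 1)) ×ˢ
    (Icc (-R') R' ×ˢ Icc (-R') R') with hS
  have hmem : ∀ t s x y, 0 ≤ t → 0 ≤ s → σ ≤ Φ ((t, s), (x, y)) → ((t, s), (x, y)) ∈ S := by
    intro t s x y ht hs h
    obtain ⟨e1, e2, e3, e4, -⟩ := hpos t s x y ht hs h
    have e5 : t ≤ 2 * M / η := (le_div_iff₀' hη).2 e1
    have e6 : |t - s| ≤ 2 * M + 1 := by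
      rw [div_le_iff₀ hδ0] at e2
      refine abs_le_of_sq_le_sq ?_ (by linarith)
      nlinarith
    exact ⟨⟨⟨ht, e5⟩, hs, by linarith [(abs_le.1 e6).1]⟩, hbox x y e4 e3⟩
  have hv' : σ ≤ Φ ((t₁, t₁), (x₁, y₁)) := by
    simp only [hΦ, sub_self, zero_pow two_ne_zero, zero_div, sub_zero]
    exact hv
  have husc : UpperSemicontinuousOn Φ S := by
    have hc : Continuous fun v : (ℝ × ℝ) × ℝ × ℝ => -(η * v.1.1 +
        (v.1.1 - v.1.2) ^ 2 / δ + (v.2.1 - v.2.2 + ρ) ^ 2 / ε + Ψ v.2.1) := by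
      fun_prop
    have he : ∀ v ∈ S, Φ v = F₁ (max v.1.1 0) v.2.1 + -F₂ (max v.1.2 0) v.2.2 + -(η * v.1.1 +
        (v.1.1 - v.1.2) ^ 2 / δ + (v.2.1 - v.2.2 + ρ) ^ 2 / ε + Ψ v.2.1) := fun v hv => by
      simp only [hΦ, max_eq_left hv.1.1.1, max_eq_left hv.1.2.1]
      ring
    intro v hv b hb
    have h3 := (hG.add hc.upperSemicontinuous).upperSemicontinuousOn S v hv b
      (by rw [he v hv] at hb; exact hb)
    filter_upwards [h3, self_mem_nhdsWithin] with u hu huS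
    rw [he u huS]
    exact hu
  obtain ⟨⟨⟨t, s⟩, x, y⟩, hmS, hmax⟩ := husc.exists_isMaxOn
    ⟨_, hmem t₁ t₁ x₁ y₁ ht₁ ht₁ hv'⟩
    ((isCompact_Icc.prod isCompact_Icc).prod hKc)
  have hval : σ ≤ Φ ((t, s), (x, y)) := hv'.trans (hmax (hmem t₁ t₁ x₁ y₁ ht₁ ht₁ hv'))
  have ht : 0 ≤ t := hmS.1.1.1
  have hs : 0 ≤ s := hmS.1.2.1
  obtain ⟨-, e2, e3, e4, e5⟩ := hpos t s x y ht hs hval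
  rw [div_le_iff₀ hδ0] at e2
  refine ⟨δ, t, s, x, y, hδ0, ?_, ?_, hval, fun t' s' x' y' ht' hs' => ?_⟩
  · refine ht.lt_of_ne fun h => ?_
    have : s < r := by
      rw [← h] at e2
      refine lt_of_pow_lt_pow_left₀ 2 hr.le ?_
      linarith [neg_sq s, zero_sub s]
    have := hclose t s x y ht hs (h ▸ hr) this e4 e3
    linarith
  · refine hs.lt_of_ne fun h => ?_
    have : t < r := by
      rw [← h, sub_zero] at e2
      exact lt_of_pow_lt_pow_left₀ 2 hr.le (by linarith)
    have := hclose t s x y ht hs this (h ▸ hr) e4 e3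
    linarith
  · rcases le_or_gt σ (Φ ((t', s'), (x', y'))) with h | h
    · exact hmax (hmem t' s' x' y' ht' hs' h)
    · exact h.le.trans hval

theorem IsSupersolution.upperSemicontinuousOn_neg {Op : (ℝ → ℝ) → ℝ → ℝ} {F : ℝ → ℝ → ℝ}
    (h : IsSupersolution Op F) :
    UpperSemicontinuousOn (fun p : ℝ × ℝ => -F p.1 p.2) (Ici 0 ×ˢ univ) := by
  intro p hp b hb
  filter_upwards [h.1 p hp (-b) (neg_lt.1 hb)] with q hq
  exact neg_lt.1 hq

theorem eventually_mul_lt {r : ℝ} (c : ℝ) (hr : 0 < r) : ∀ᶠ ε in 𝓝[>] (0 : ℝ), c * ε < r := by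
  have : Tendsto (fun ε : ℝ => c * ε) (𝓝[>] 0) (𝓝 (c * 0)) :=
    (Continuous.tendsto (by fun_prop) 0).mono_left nhdsWithin_le_nhds
  rw [mul_zero] at this
  exact this.eventually_lt_const hr

set_option maxHeartbeats 1000000 in
theorem KernelBd.le_of_lipschitz_left {g : ℝ → ℝ → ℝ} {C α : ℝ} (kb : KernelBd g C α) {c : ℝ}
    {Op : (ℝ → ℝ) → ℝ → ℝ} (hOp : IsPV g c Op) {F₁ F₂ : ℝ → ℝ → ℝ} {M : ℝ}
    (hM₁ : ∀ t x, 0 ≤ t → |F₁ t x| ≤ M) (hM₂ : ∀ t x, 0 ≤ t → |F₂ t x| ≤ M)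
    (hsub : IsSubsolution Op F₁) (hsup : IsSupersolution Op F₂)
    (hlip : ∀ T > (0 : ℝ), ∃ K : ℝ, ∀ s ∈ Icc 0 T, ∀ x y, |F₁ s x - F₁ s y| ≤ K * |x - y|)
    (hinit : ∀ x, F₁ 0 x ≤ F₂ 0 x) (t₁ x₁ : ℝ) (ht₁ : 0 ≤ t₁) : F₁ t₁ x₁ ≤ F₂ t₁ x₁ := by
  by_contra! hlt
  have hM : 0 ≤ M := (abs_nonneg _).trans (hM₁ 0 0 le_rfl)
  obtain ⟨σ, hσ, hσe⟩ : ∃ σ, 0 < σ ∧ F₁ t₁ x₁ - F₂ t₁ x₁ = 4 * σ :=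
    ⟨(F₁ t₁ x₁ - F₂ t₁ x₁) / 4, by linarith, by ring⟩
  set η := σ / (t₁ + 1) with hη
  have hη0 : 0 < η := by positivity
  have hηt : η * t₁ ≤ σ := by
    rw [hη, div_mul_eq_mul_div, div_le_iff₀ (by positivity)]
    linarith
  set T := 2 * M / η + 1 + t₁ with hT
  have hT0 : 0 < T := by positivity
  obtain ⟨K₀, hK₀⟩ := hlip T hT0
  set K := max K₀ 1 with hKdef
  have hK1 : 1 ≤ K := le_max_right _ _
  have hK : ∀ s ∈ Icc 0 T, ∀ x y, |F₁ s x - F₁ s y| ≤ K * |x - y| := fun s hs x y =>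
    (hK₀ s hs x y).trans (mul_le_mul_of_nonneg_right (le_max_left _ _) (abs_nonneg _))
  set N := 5 * K + 16 * M + 8 with hN
  obtain ⟨Q, hQ, hop⟩ := kb.exists_op_sub_ge hOp (N := N) (by linarith)
  set κ := min 1 (η / (2 * (Q + 1))) with hκ
  have hκ0 : 0 < κ := lt_min one_pos (by positivity)
  have hκ1 : κ ≤ 1 := min_le_left _ _
  have hQκ : Q * κ < η := by
    have : κ ≤ η / (2 * (Q + 1)) := min_le_right _ _
    rw [le_div_iff₀ (by positivity)] at this
    linarith
  set d := σ / (4 * K) with hd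
  have hd0 : 0 < d := by positivity
  have hKd : K * d = σ / 4 := by rw [hd]; field_simp
  obtain ⟨ε, hopε, ⟨Ψ, q, hΨ⟩, c1, c2, c3, c4, c5, c6, hε⟩ := ((hop κ hκ0 hκ1).and <|
    (eventually_exists_barrier hκ0 hκ1 (2 * M)).and <|
    (eventually_mul_lt 1 one_pos).and <| (eventually_mul_lt 1 kb.pos).and <|
    (eventually_mul_lt (3 * K ^ 2 + |x₁| + 3 * K) hσ).and <|
    (eventually_mul_lt (5 * K ^ 2) hσ).and <| (eventually_mul_lt (5 * K) hd0).and <|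
    (eventually_mul_lt (2 * M / d * (5 * K)) (show 0 < σ / 4 by positivity)).and
      self_mem_nhdsWithin).exists
  have hε : 0 < ε := hε
  have hε1 : ε ≤ 1 := by linarith
  set ρ := 3 * K * ε with hρ
  have hρ0 : 0 < ρ := by positivity
  obtain ⟨δ, t, s, x, y, hδ, ht, hs, hval, hmax⟩ := exists_doubled_max (ρ := ρ) (ε := ε) (η := η)
    (σ := σ) (Ψ := Ψ) (R := Real.exp (κ / ε)) (t₁ := t₁) (x₁ := x₁ - ρ) (y₁ := x₁) hsub.1
    hsup.upperSemicontinuousOn_neg hM₁ hM₂ hη0 hσ hε hε1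
    (LipschitzWith.of_dist_le' (K := ε) fun u v => by
      simpa [Real.dist_eq] using hΨ.abs_sub_le u v).continuous hΨ.nonneg
    (fun x hx => by
      have h1 := hΨ.log_le x hx
      rw [mul_comm, ← le_div_iff₀ hε, Real.log_le_iff_le_exp (by positivity)] at h1
      linarith)
    (fun x y => by
      have h1 := (abs_le.1 (hK 0 ⟨le_rfl, hT0.le⟩ x y)).2
      have h2 := hinit y
      have h3 : |x - y| ≤ |x - y + ρ| + ρ := by
        have := abs_sub (x - y + ρ) ρ
        rwa [add_sub_cancel_right, abs_of_pos hρ0] at this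
      have h4 : K * |x - y + ρ| ≤ (x - y + ρ) ^ 2 / ε + K ^ 2 * ε := by
        rw [← sub_le_iff_le_add, le_div_iff₀ hε, ← sq_abs (x - y + ρ)]
        nlinarith [sq_nonneg (|x - y + ρ| - K * ε), sq_nonneg (|x - y + ρ|), sq_nonneg (K * ε),
          mul_nonneg (abs_nonneg (x - y + ρ)) (by positivity : 0 ≤ K * ε)]
      have h5 := mul_le_mul_of_nonneg_left h3 (by linarith : 0 ≤ K)
      have h6 : K * ρ = 3 * K ^ 2 * ε := by rw [hρ]; ring
      have h7 : 0 ≤ K ^ 2 * ε := by positivity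
      linarith)
    ht₁ (by
      have h1 := (abs_le.1 (hK t₁ ⟨ht₁, by rw [hT]; linarith [show 0 ≤ 2 * M / η by positivity]⟩
        (x₁ - ρ) x₁)).1
      rw [show x₁ - ρ - x₁ = -ρ by ring, abs_neg, abs_of_pos hρ0] at h1
      have h2 := hΨ.le_mul_abs (x₁ - ρ)
      have h3 := mul_le_mul_of_nonneg_left (abs_sub x₁ ρ) hε.le
      rw [abs_of_pos hρ0] at h3
      have h4 : K * ρ = 3 * K ^ 2 * ε := by rw [hρ]; ring
      have h5 : ε * ρ ≤ 1 * ρ := by gcongr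
      rw [show x₁ - ρ - x₁ + ρ = 0 by ring]
      simp only [zero_pow two_ne_zero, zero_div, sub_zero]
      linarith)
  have hdiff : F₁ t x - F₂ s y ≤ 2 * M := by
    linarith [(abs_le.1 (hM₁ t x ht.le)).2, (abs_le.1 (hM₂ s y hs.le)).1]
  have p1 : 0 ≤ η * t := by positivity
  have p2 : 0 ≤ (t - s) ^ 2 / δ := by positivity
  have p3 : 0 ≤ (x - y + ρ) ^ 2 / ε := by positivity
  have p4 := hΨ.nonneg x
  have htM : η * t ≤ 2 * M := by linarith
  have htT : t + 1 ≤ T := by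
    have := (le_div_iff₀' hη0).2 htM
    linarith
  have htI : t ∈ Icc 0 T := ⟨ht.le, by linarith⟩
  have hu : |x - y + ρ| ≤ 2 * K * ε := by
    have h1 := hmax t s (y - ρ) y ht.le hs.le
    have h2 := (abs_le.1 (hK t htI x (y - ρ))).2
    have h3 := (abs_le.1 (hΨ.abs_sub_le x (y - ρ))).1
    rw [show x - (y - ρ) = x - y + ρ by ring] at h2 h3
    rw [show y - ρ - y + ρ = 0 by ring] at h1
    simp only [zero_pow two_ne_zero, zero_div, sub_zero] at h1
    have h4 : ε * |x - y + ρ| ≤ K * |x - y + ρ| := by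
      gcongr
      linarith
    have h5 : (x - y + ρ) ^ 2 / ε ≤ 2 * K * |x - y + ρ| := by linarith
    rw [div_le_iff₀ hε, ← sq_abs] at h5
    rcases (abs_nonneg (x - y + ρ)).eq_or_lt with h | h
    · rw [← h]; positivity
    · nlinarith
  have hu' := abs_le.1 hu
  have hxy1 : x < y := by
    have : 0 < K * ε := by positivity
    linarith
  have hxy2 : y - x ≤ 5 * K * ε := by linarith
  have hxy3 : |x - y| = y - x := by rw [abs_sub_comm, abs_of_pos (by linarith)]
  have hKxy : K * (y - x) ≤ 5 * K ^ 2 * ε := by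
    have := mul_le_mul_of_nonneg_left hxy2 (by linarith : 0 ≤ K)
    linarith
  by_cases hy : y ∈ regSet g
  swap
  · have h1 := hsup.initial_le_of_notMem hOp kb.refl.isClosed_regSet hM₂ hy hs.le
    have h2 := hsub.le_initial_of_notMem hOp kb.isClosed_regSet hM₁ hy ht.le
    have h3 := (abs_le.1 (hK t htI x y)).2
    rw [hxy3] at h3
    linarith [hinit y]
  by_cases hx : x ∈ regSet g
  swap
  · have h2 := hsub.le_initial_of_notMem hOp kb.isClosed_regSet hM₁ hx ht.le
    have h1 := hsup.linear_le_of_notMem hOp kb.refl.isClosed_regSet hM₂ hx hd0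
      (m := F₁ 0 x - K * d) (fun z hz => by
        have h3 := (abs_le.1 (hK 0 ⟨le_rfl, hT0.le⟩ x z)).2
        have h4 : |x - z| ≤ d := abs_le.2 ⟨by linarith [hz.2], by linarith [hz.1]⟩
        have h5 := mul_le_mul_of_nonneg_left h4 (by linarith : 0 ≤ K)
        linarith [hinit z]) hs.le (y := y) ⟨hxy1.le, by linarith⟩
    have h3 : 2 * M / d * (y - x) ≤ 2 * M / d * (5 * K * ε) := by gcongr
    linarith
  obtain ⟨p, p₁, θ₁, θ₂, hθ, hle⟩ := kb.exists_closeProfiles_of_max (N := N) hsub hsup hM₁ hM₂ hK hΨ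
    (by linarith) hη0 hδ hκ1 hε hε1 (by nlinarith) hx hy
    (by
      rw [hxy3]
      refine hxy2.trans (mul_le_mul_of_nonneg_right ?_ hε.le)
      linarith)
    (by
      rw [abs_div, abs_mul, abs_two, abs_of_pos hε, div_le_iff₀ hε]
      linarith)
    (by linarith) (by linarith) ht htT htM hs (by linarith) hmax
  have := hopε x y p p₁ θ₁ θ₂ hθ
  linarith

/-- Comparison principle for `∂ₜF + (∂ₓF)₊ L[F] = 0` on `(0,∞) × ℝ`
when one of the bounded sub/supersolutions is Lipschitz in space locally uniformly
in time. -/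
theorem comparison_lipschitz_general_kernel
    (g : ℝ → ℝ → ℝ) (hg : StandingKernel g)
    (F₁ F₂ : ℝ → ℝ → ℝ) (M : ℝ)
    (hb₁ : ∀ t x, 0 ≤ t → |F₁ t x| ≤ M)
    (hb₂ : ∀ t x, 0 ≤ t → |F₂ t x| ≤ M)
    (hsub : IsSubsolution (Lop g) F₁)
    (hsup : IsSupersolution (Lop g) F₂)
    (hlip : (∀ T > (0 : ℝ), ∃ K : ℝ, ∀ s ∈ Set.Icc 0 T, ∀ x y : ℝ,
        |F₁ s x - F₁ s y| ≤ K * |x - y|) ∨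
      (∀ T > (0 : ℝ), ∃ K : ℝ, ∀ s ∈ Set.Icc 0 T, ∀ x y : ℝ,
        |F₂ s x - F₂ s y| ≤ K * |x - y|))
    (hinit : ∀ x, F₁ 0 x ≤ F₂ 0 x) :
    ∀ t x, 0 ≤ t → F₁ t x ≤ F₂ t x := by
  obtain ⟨c, hc⟩ := isPV_Lop g
  obtain ⟨C, α, kb⟩ := hg.kernelBd
  intro t x ht
  rcases hlip with hlip | hlip
  · exact kb.le_of_lipschitz_left hc hb₁ hb₂ hsub hsup hlip hinit t x ht
  · have := kb.refl.le_of_lipschitz_left hc.refl (M := M) (fun t x ht => by simpa using hb₂ t (-x) ht)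
      (fun t x ht => by simpa using hb₁ t (-x) ht) hsup.refl hsub.refl
      (fun T hT => by
        obtain ⟨K, hK⟩ := hlip T hT
        refine ⟨K, fun s hs x y => ?_⟩
        rw [neg_sub_neg, show x - y = -y - -x by ring]
        exact hK s hs (-y) (-x))
      (fun x => neg_le_neg (hinit (-x))) t (-x) ht
    simpa using this
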